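/- For every integer d ≥ 2, a very general complex hypersurface X ⊂ ℙ⁵ of degree d + 2 having multiplicity d along a fixed 2-plane is not stably rational. -/

import Mathlib

/-!
Rationality, stable rationality and stable birationality, expressed via function fields:
a variety `X` over `k` with function field `F` (a `k`-algebra via `c : k →+* F`) is rational
iff `F ≅ k(t₁,…,t_n)` over `k`, and stably rational iff `F(t₁,…,t_m) ≅ k(t₁,…,t_n)` over `k`
for some `m, n`. Two varieties are stably birational iff their function fields become
isomorphic after adjoining finitely many indeterminates.
-/

noncomputable section

/-- The rational function field `k(t₁, …, t_n)`. -/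
def ratFuncField (k : Type) [Field k] (n : ℕ) : Type :=
  FractionRing (MvPolynomial (Fin n) k)

instance (k : Type) [Field k] (n : ℕ) : Field (ratFuncField k n) := by
  unfold ratFuncField; infer_instance

/-- The canonical map `k → k(t₁, …, t_n)`. -/
def ratFuncFieldMap (k : Type) [Field k] (n : ℕ) : k →+* ratFuncField k n :=
  (algebraMap (MvPolynomial (Fin n) k) (FractionRing (MvPolynomial (Fin n) k))).comp
    (MvPolynomial.C)

/-- Given a function field `F` over `k` (via `c : k →+* F`), the canonical map
`k → Frac(F[t₁,…,t_m]) = F(t₁,…,t_m)`. -/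
def adjoinIndetsMap {k F : Type} [CommRing k] [CommRing F] (c : k →+* F) (m : ℕ) :
    k →+* FractionRing (MvPolynomial (Fin m) F) :=
  (algebraMap (MvPolynomial (Fin m) F) (FractionRing (MvPolynomial (Fin m) F))).comp
    ((MvPolynomial.C).comp c)

/-- A variety over `k` with function field `F` (via `c : k →+* F`) is rational iff
`F ≅ k(t₁,…,t_n)` as `k`-algebras for some `n`. -/
def IsRationalFunctionField {k F : Type} [Field k] [CommRing F] (c : k →+* F) : Prop :=
  ∃ (n : ℕ) (e : F ≃+* ratFuncField k n), (e : F →+* ratFuncField k n).comp c =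
    ratFuncFieldMap k n

/-- A variety over `k` with function field `F` (via `c : k →+* F`) is stably rational iff
`F(t₁,…,t_m) ≅ k(t₁,…,t_n)` as `k`-algebras for some `m, n`. -/
def IsStablyRationalFunctionField {k F : Type} [Field k] [CommRing F] (c : k →+* F) : Prop :=
  ∃ (m n : ℕ) (e : FractionRing (MvPolynomial (Fin m) F) ≃+* ratFuncField k n),
    (e : FractionRing (MvPolynomial (Fin m) F) →+* ratFuncField k n).comp
      (adjoinIndetsMap c m) = ratFuncFieldMap k n

/-- Two varieties over `K` with function fields `L₁, L₂` (via `i₁ : K →+* L₁`,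
`i₂ : K →+* L₂`) are stably birational over `K` iff `L₁(t₁,…,t_a) ≅ L₂(t₁,…,t_b)`
as `K`-algebras for some `a, b`. -/
def StablyBirationalOver {K L₁ L₂ : Type} [Field K] [CommRing L₁] [CommRing L₂]
    (i₁ : K →+* L₁) (i₂ : K →+* L₂) : Prop :=
  ∃ (a b : ℕ) (e : FractionRing (MvPolynomial (Fin a) L₁) ≃+*
      FractionRing (MvPolynomial (Fin b) L₂)),
    (e : FractionRing (MvPolynomial (Fin a) L₁) →+*
      FractionRing (MvPolynomial (Fin b) L₂)).comp (adjoinIndetsMap i₁ a) =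
      adjoinIndetsMap i₂ b

end

/-!
Very general members of linear families, and quadric surface bundles over `ℙ²` given by
symmetric matrices of homogeneous forms, described via affine charts and function fields.
-/

noncomputable section

/-- A polynomial function on a `ℂ`-vector space `P`: a function factoring through finitely
many linear coordinates via a polynomial. -/
def IsPolynomialFun {P : Type} [AddCommGroup P] [Module ℂ P] (f : P → ℂ) : Prop :=
  ∃ (N : ℕ) (l : Fin N → (P →ₗ[ℂ] ℂ)) (F : MvPolynomial (Fin N) ℂ),
    ∀ p : P, f p = MvPolynomial.eval (fun i => l i p) F

/-- A property `Q` holds for a very general member of the linear parameter space `P` if it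
holds away from a countable union of proper algebraic hypersurfaces, i.e. if there are
countably many nonzero polynomial functions on `P` such that `Q p` holds whenever none of
them vanishes at `p`. -/
def VeryGeneral {P : Type} [AddCommGroup P] [Module ℂ P] (Q : P → Prop) : Prop :=
  ∃ 𝒞 : Set (P → ℂ), 𝒞.Countable ∧ (∀ f ∈ 𝒞, IsPolynomialFun f ∧ f ≠ 0) ∧
    ∀ p : P, (∀ f ∈ 𝒞, f p ≠ 0) → Q p

/-- Dehomogenization `ℂ[x,y,z] → ℂ[x,y] ⊆ ℂ[x,y,z₁,z₂,z₃]` at the chart `z = 1` of `ℙ²`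
(the first two variables of `Fin 5` are the base coordinates). -/
def dehomP2 : MvPolynomial (Fin 3) ℂ →+* MvPolynomial (Fin 5) ℂ :=
  (MvPolynomial.aeval ![MvPolynomial.X 0, MvPolynomial.X 1, 1]).toRingHom

/-- Dehomogenization `ℂ[x,y,z] → ℂ[x,y]` at the chart `z = 1`. -/
def dehomP2' : MvPolynomial (Fin 3) ℂ →+* MvPolynomial (Fin 2) ℂ :=
  (MvPolynomial.aeval ![MvPolynomial.X 0, MvPolynomial.X 1, 1]).toRingHom

/-- The defining polynomial `∑_{i,j} a_{ij}(x,y,1) z_i z_j` (with `z₀ = 1`) of the affine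
chart of the quadric surface bundle `X = {∑ a_{ij} z_i z_j = 0} ⊆ ℙ(E)` over `ℙ²`. -/
def quadricBundleChartPoly (A : Fin 4 → Fin 4 → MvPolynomial (Fin 3) ℂ) :
    MvPolynomial (Fin 5) ℂ :=
  ∑ i : Fin 4, ∑ j : Fin 4, dehomP2 (A i j) *
    (![1, MvPolynomial.X 2, MvPolynomial.X 3, MvPolynomial.X 4] i) *
    (![1, MvPolynomial.X 2, MvPolynomial.X 3, MvPolynomial.X 4] j)

/-- The coordinate ring of the affine chart (`z = 1` on `ℙ²` and `z₀ = 1` on the fibre)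
of the quadric surface bundle `X ⊆ ℙ(E)` over `ℙ²` determined by the symmetric matrix
`(a_{ij})`. -/
def quadricBundleChartRing (A : Fin 4 → Fin 4 → MvPolynomial (Fin 3) ℂ) : Type :=
  MvPolynomial (Fin 5) ℂ ⧸ Ideal.span {quadricBundleChartPoly A}

instance (A : Fin 4 → Fin 4 → MvPolynomial (Fin 3) ℂ) :
    CommRing (quadricBundleChartRing A) :=
  Ideal.Quotient.commRing _

/-- The function field `ℂ(X)` of the quadric surface bundle `X` over `ℙ²` given by the
matrix `(a_{ij})`, as the fraction ring of the affine chart. -/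
def quadricBundleFunctionField (A : Fin 4 → Fin 4 → MvPolynomial (Fin 3) ℂ) : Type :=
  FractionRing (quadricBundleChartRing A)

instance (A : Fin 4 → Fin 4 → MvPolynomial (Fin 3) ℂ) :
    CommRing (quadricBundleFunctionField A) := by
  unfold quadricBundleFunctionField; infer_instance

/-- The canonical map `ℂ → ℂ(X)`. -/
def quadricBundleFFMap (A : Fin 4 → Fin 4 → MvPolynomial (Fin 3) ℂ) :
    ℂ →+* quadricBundleFunctionField A :=
  (algebraMap (quadricBundleChartRing A) (FractionRing (quadricBundleChartRing A))).comp
    ((Ideal.Quotient.mk _).comp (MvPolynomial.C))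

/-- The conditions for the symmetric matrix `(a_{ij})` of forms to define a quadric surface
bundle over `ℙ²`: the quadratic form is generically nondegenerate, and nonzero on every
fibre (so that `X → ℙ²` is flat). Homogeneity of the `a_{ij}` of the correct degrees is
part of the choice of parameter space. -/
def IsQuadricBundleP2 (A : Fin 4 → Fin 4 → MvPolynomial (Fin 3) ℂ) : Prop :=
  Matrix.det (Matrix.of fun i j => A i j + A j i) ≠ 0 ∧
  ∀ v : Fin 3 → ℂ, v ≠ 0 → ∃ i j, MvPolynomial.eval v (A i j + A j i) ≠ 0

/-- The quadric surface bundle over `ℙ²` given by `(a_{ij})` admits a rational section: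
there are rational functions `σ₀, …, σ₃` on `ℙ²`, not all zero, with
`∑ a_{ij} σ_i σ_j = 0`. -/
def HasRationalSectionP2 (A : Fin 4 → Fin 4 → MvPolynomial (Fin 3) ℂ) : Prop :=
  ∃ σ : Fin 4 → FractionRing (MvPolynomial (Fin 2) ℂ), σ ≠ 0 ∧
    ∑ i : Fin 4, ∑ j : Fin 4,
      (algebraMap (MvPolynomial (Fin 2) ℂ) (FractionRing (MvPolynomial (Fin 2) ℂ)))
        (dehomP2' (A i j)) * σ i * σ j = 0

end

/-!
STATEMENT 11: For every integer `d ≥ 2`, a very general complex hypersurface `X ⊆ ℙ⁵` of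
degree `d + 2` having multiplicity `d` along the fixed 2-plane `{x₃ = x₄ = x₅ = 0}` is not
stably rational. Multiplicity `≥ d` along the plane means that `F` lies in the `d`-th
power of the ideal `(x₃, x₄, x₅)`; the parameter space is the linear system of such
degree-`(d+2)` forms.
-/

noncomputable section

/-- Dehomogenization at the chart `x₀ = 1` of `ℙ⁵`. -/
def dehomP5 : MvPolynomial (Fin 6) ℂ →+* MvPolynomial (Fin 5) ℂ :=
  (MvPolynomial.aeval ![1, MvPolynomial.X 0, MvPolynomial.X 1, MvPolynomial.X 2,
    MvPolynomial.X 3, MvPolynomial.X 4]).toRingHom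

/-- The coordinate ring of the affine chart of the hypersurface `{F = 0} ⊆ ℙ⁵`. -/
def hyperP5ChartRing (F : MvPolynomial (Fin 6) ℂ) : Type :=
  MvPolynomial (Fin 5) ℂ ⧸ Ideal.span {dehomP5 F}

instance (F : MvPolynomial (Fin 6) ℂ) : CommRing (hyperP5ChartRing F) :=
  Ideal.Quotient.commRing _

/-- The canonical map `ℂ → ℂ(X)` for `X = {F = 0} ⊆ ℙ⁵`. -/
def hyperP5FFMap (F : MvPolynomial (Fin 6) ℂ) :
    ℂ →+* FractionRing (hyperP5ChartRing F) :=
  (algebraMap (hyperP5ChartRing F) (FractionRing (hyperP5ChartRing F))).comp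
    ((Ideal.Quotient.mk _).comp (MvPolynomial.C))

/-- A ternary diagonal quadratic form over a commutative ring has a nontrivial zero. -/
def IsotropicTernary {R : Type*} [CommRing R] (a b c : R) : Prop :=
  ∃ A B C : R, (A ≠ 0 ∨ B ≠ 0 ∨ C ≠ 0) ∧ a * A ^ 2 + b * B ^ 2 + c * C ^ 2 = 0

namespace IsotropicTernary

variable {R : Type*} [CommRing R]

lemma of_exists_mul_eq [Nontrivial R] {a b c : R} (h : a = 0 ∨ b = 0 ∨ c = 0) :
    IsotropicTernary a b c := by
  rcases h with h | h | h
  · exact ⟨1, 0, 0, by simp, by simp [h]⟩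
  · exact ⟨0, 1, 0, by simp, by simp [h]⟩
  · exact ⟨0, 0, 1, by simp, by simp [h]⟩

lemma map {S : Type*} [CommRing S] {f : R →+* S} (hf : Function.Injective f) {a b c : R}
    (h : IsotropicTernary a b c) : IsotropicTernary (f a) (f b) (f c) := by
  obtain ⟨A, B, C, h0, h⟩ := h
  refine ⟨f A, f B, f C, ?_, by simp only [← map_pow, ← map_mul, ← map_add, h, map_zero]⟩
  simpa only [Ne, map_eq_zero_iff f hf] using h0

lemma swap {a b c : R} (h : IsotropicTernary a b c) : IsotropicTernary a c b := by
  obtain ⟨A, B, C, h0, h⟩ := h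
  exact ⟨A, C, B, by tauto, by linear_combination h⟩

lemma left_mul (g : R) {a b c : R} (h : IsotropicTernary a b c) :
    IsotropicTernary (g * a) (g * b) (g * c) := by
  obtain ⟨A, B, C, h0, h⟩ := h
  exact ⟨A, B, C, h0, by linear_combination g * h⟩

lemma of_isSquare_neg_mul {a b c : R} (hb : b ≠ 0) (h : IsSquare (-(a * b))) :
    IsotropicTernary a b c := by
  obtain ⟨r, hr⟩ := h
  exact ⟨b, r, 0, Or.inl hb, by linear_combination -b * hr⟩

lemma of_isSquare_neg_mul' {a b c : R} (hb : c ≠ 0) (h : IsSquare (-(a * c))) :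
    IsotropicTernary a b c := (of_isSquare_neg_mul hb h).swap

lemma of_isSquare_neg_mul'' {a b c : R} (hb : c ≠ 0) (h : IsSquare (-(b * c))) :
    IsotropicTernary a b c := by
  obtain ⟨r, hr⟩ := h
  exact ⟨0, c, r, Or.inr (Or.inl hb), by linear_combination -c * hr⟩

variable [IsDomain R]

lemma mul_left {g a b c : R} (hg : g ≠ 0) (h : IsotropicTernary (g * a) (g * b) (g * c)) :
    IsotropicTernary a b c := by
  obtain ⟨A, B, C, h0, h⟩ := h
  exact ⟨A, B, C, h0, mul_left_cancel₀ hg (by linear_combination h)⟩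

/-- Normalising the first coefficient to `1`. -/
lemma normalize_iff {x y z : R} (hx : x ≠ 0) :
    IsotropicTernary x y z ↔ IsotropicTernary 1 (x * y) (x * z) := by
  constructor
  · rintro ⟨A, B, C, h0, h⟩
    refine ⟨x * A, B, C, ?_, by linear_combination x * h⟩
    simpa [hx] using h0
  · rintro ⟨A, B, C, h0, h⟩
    refine ⟨A, x * B, x * C, ?_, by linear_combination x * h⟩
    simpa [hx] using h0

lemma mul_sq_iff {g U V : R} (hg : g ≠ 0) :
    IsotropicTernary 1 (g ^ 2 * U) V ↔ IsotropicTernary 1 U V := by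
  constructor
  · rintro ⟨A, B, C, h0, h⟩
    refine ⟨A, g * B, C, ?_, by linear_combination h⟩
    simpa [hg] using h0
  · rintro ⟨A, B, C, h0, h⟩
    refine ⟨g * A, B, g * C, ?_, by linear_combination g ^ 2 * h⟩
    simpa [hg] using h0

/-- If `U * U'` is a norm `w² + V`, then `⟨1, U, V⟩` isotropic implies `⟨1, U', V⟩` isotropic. -/
lemma of_mul_eq {U U' V w : R} (hU : U ≠ 0) (h : U * U' = w ^ 2 + V)
    (hi : IsotropicTernary 1 U V) : IsotropicTernary 1 U' V := by
  obtain ⟨A, B, C, h0, h1⟩ := hi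
  by_cases hB : B = 0
  · subst hB
    refine ⟨A, 0, C, ?_, by linear_combination h1⟩
    simpa using h0
  · refine ⟨A * w - V * C, U * B, A + w * C, Or.inr (Or.inl (mul_ne_zero hU hB)), ?_⟩
    linear_combination (w ^ 2 + V) * h1 + U * B ^ 2 * h

/-- An isotropic form `⟨x, y, z, xyz⟩` has isotropic subform `⟨x, y, z⟩`. -/
lemma of_pfister {x y z A B C D : R} (hx : x ≠ 0)
    (h0 : A ≠ 0 ∨ B ≠ 0 ∨ C ≠ 0 ∨ D ≠ 0)
    (h : x * A ^ 2 + y * B ^ 2 + z * C ^ 2 + x * y * z * D ^ 2 = 0) :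
    IsotropicTernary x y z := by
  by_cases hN : C ^ 2 + x * y * D ^ 2 = 0
  · by_cases hD : D = 0
    · subst hD
      have hC : C = 0 := by simpa using hN
      subst hC
      exact ⟨A, B, 0, by simpa using h0, by linear_combination h⟩
    · exact ⟨C, x * D, 0, Or.inr (Or.inl (mul_ne_zero hx hD)), by linear_combination x * hN⟩
  · exact ⟨A * C - y * B * D, B * C + x * A * D, C ^ 2 + x * y * D ^ 2, Or.inr (Or.inr hN),
      by linear_combination (C ^ 2 + x * y * D ^ 2) * h⟩

end IsotropicTernary

namespace PowerSeries

variable {k : Type*} [Field k]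

/-- The order of vanishing is finite and even. -/
def EvenOrd (p : k⟦X⟧) : Prop := p ≠ 0 ∧ Even p.order.toNat

lemma order_toNat_mul {p q : k⟦X⟧} (hp : p ≠ 0) (hq : q ≠ 0) :
    (p * q).order.toNat = p.order.toNat + q.order.toNat := by
  rw [order_mul, ENat.toNat_add] <;> simpa using by assumption

lemma EvenOrd.mul {p q : k⟦X⟧} (hp : EvenOrd p) (hq : EvenOrd q) : EvenOrd (p * q) :=
  ⟨mul_ne_zero hp.1 hq.1, by rw [order_toNat_mul hp.1 hq.1]; exact hp.2.add hq.2⟩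

lemma evenOrd_sq {p : k⟦X⟧} (hp : p ≠ 0) : EvenOrd (p ^ 2) := by
  refine ⟨pow_ne_zero 2 hp, ?_⟩
  rw [sq, order_toNat_mul hp hp]; exact ⟨_, rfl⟩

lemma EvenOrd.of_mul_left {p q : k⟦X⟧} (h : EvenOrd (p * q)) (hp : EvenOrd p) : EvenOrd q := by
  have hq : q ≠ 0 := right_ne_zero_of_mul h.1
  refine ⟨hq, ?_⟩
  have := h.2
  rw [order_toNat_mul hp.1 hq, Nat.even_add] at this
  exact this.1 hp.2

lemma evenOrd_of_constantCoeff {p : k⟦X⟧} (h : constantCoeff p ≠ 0) : EvenOrd p := by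
  have h0 : p.order = 0 := by
    rw [order_eq_nat (n := 0) |>.2]
    · rfl
    · simpa using h
  exact ⟨by rintro rfl; simp at h, by simp [h0]⟩

lemma isSquare_of_constantCoeff [CharZero k] {p : k⟦X⟧} {c : k} (hc : c ≠ 0)
    (h : constantCoeff p = c ^ 2) : IsSquare p := by
  have H : HenselianRing k⟦X⟧ (Ideal.span {X}) := inferInstance
  obtain ⟨a, ha, -⟩ := H.is_henselian (Polynomial.X ^ 2 - Polynomial.C p)
    (Polynomial.monic_X_pow_sub_C p two_ne_zero) (PowerSeries.C c) (by
      rw [Ideal.mem_span_singleton, X_dvd_iff]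
      simp [h]) (by
      apply IsUnit.map
      rw [isUnit_iff_constantCoeff]
      simp [hc])
  refine ⟨a, ?_⟩
  have : a ^ 2 - p = 0 := by simpa [Polynomial.IsRoot] using ha
  linear_combination -this

lemma exists_eq_X_pow_mul {p : k⟦X⟧} (hp : p ≠ 0) :
    ∃ q : k⟦X⟧, p = X ^ p.order.toNat * q ∧ constantCoeff q ≠ 0 := by
  obtain ⟨q, hq⟩ := X_pow_order_dvd (φ := p)
  refine ⟨q, hq, fun h0 => ?_⟩
  obtain ⟨r, hr⟩ := X_dvd_iff.2 h0
  have h1 : (X : k⟦X⟧) ^ (p.order.toNat + 1) ∣ p := ⟨r, by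
    rw [pow_succ, mul_assoc, ← hr]; exact hq⟩
  have h2 := nat_le_order p _ (X_pow_dvd_iff.1 h1)
  have h3 : (p.order.toNat : ℕ∞) = p.order := ENat.natCast_toNat (by simpa using hp)
  have h4 := Nat.cast_le.1 (h2.trans_eq h3.symm)
  omega

/-- If two power series of even order have a sum which is not of even order, minus
their product is a square. -/
lemma isSquare_neg_mul_of_evenOrd [CharZero k] {a b : k⟦X⟧} (ha : EvenOrd a) (hb : EvenOrd b)
    (h : ¬ EvenOrd (a + b)) : IsSquare (-(a * b)) := by
  obtain ⟨a', ha', ha0⟩ := exists_eq_X_pow_mul ha.1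
  obtain ⟨b', hb', hb0⟩ := exists_eq_X_pow_mul hb.1
  obtain ⟨m, hm⟩ := ha.2
  obtain ⟨n, hn⟩ := hb.2
  rw [hm] at ha'
  rw [hn] at hb'
  have key : ∀ (m j : ℕ) (c d : k⟦X⟧), constantCoeff c ≠ 0 → 
      EvenOrd (X ^ (m + m) * c + X ^ ((m + j + 1) + (m + j + 1)) * d) := by
    intro m j c d hc
    have : X ^ (m + m) * c + X ^ ((m + j + 1) + (m + j + 1)) * d
        = (X ^ m) ^ 2 * (c + X * (X ^ (2 * j + 1) * d)) := by ring
    rw [this]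
    exact (evenOrd_sq (pow_ne_zero _ X_ne_zero)).mul (evenOrd_of_constantCoeff (by simpa using hc))
  rcases lt_trichotomy m n with hlt | rfl | hlt
  · obtain ⟨j, rfl⟩ := Nat.exists_eq_add_of_lt hlt
    rw [ha', hb'] at h
    exact absurd (key _ _ _ _ ha0) h
  · have h0 : constantCoeff (a' + b') = 0 := by
      by_contra h0
      apply h
      have : a + b = (X ^ m) ^ 2 * (a' + b') := by rw [ha', hb']; ring
      rw [this]
      exact (evenOrd_sq (pow_ne_zero _ X_ne_zero)).mul (evenOrd_of_constantCoeff h0)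
    have h1 : IsSquare (-(a' * b')) := by
      apply isSquare_of_constantCoeff ha0
      rw [map_add] at h0
      simp only [map_neg, map_mul]
      linear_combination -constantCoeff a' * h0
    obtain ⟨r, hr⟩ := h1
    refine ⟨X ^ (m + m) * r, ?_⟩
    rw [ha', hb']
    linear_combination (X ^ (m + m)) ^ 2 * hr
  · obtain ⟨j, rfl⟩ := Nat.exists_eq_add_of_lt hlt
    rw [ha', hb', add_comm] at h
    exact absurd (key _ _ _ _ hb0) h

/-- Either isotropic or unramified. -/
def Tame (U V : k⟦X⟧) : Prop := IsotropicTernary 1 U V ∨ (EvenOrd U ∧ EvenOrd V)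

lemma Tame.swap {U V : k⟦X⟧} (h : Tame U V) : Tame V U := h.elim
  (fun h => Or.inl (by simpa using h.swap)) fun h => Or.inr h.symm

lemma Tame.of_mul_sq {g U V : k⟦X⟧} (hg : g ≠ 0) (h : Tame (g ^ 2 * U) V) : Tame U V := by
  rcases h with h | h
  · exact Or.inl ((IsotropicTernary.mul_sq_iff hg).1 h)
  · exact Or.inr ⟨h.1.of_mul_left (evenOrd_sq hg), h.2⟩

lemma Tame.of_mul_eq [CharZero k] {U U' V w : k⟦X⟧} (hU : U ≠ 0)
    (h : U * U' = w ^ 2 + V) (ht : Tame U V) : Tame U' V := by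
  rcases ht with ht | ⟨h1, h2⟩
  · exact Or.inl (ht.of_mul_eq hU h)
  by_cases he : EvenOrd U'
  · exact Or.inr ⟨he, h2⟩
  left
  have hw : w ≠ 0 := by
    rintro rfl
    apply he
    refine EvenOrd.of_mul_left (p := U) ?_ h1
    rw [h]; simpa using h2
  have h3 : ¬ EvenOrd (w ^ 2 + V) := by
    rw [← h]
    exact fun h4 => he (h4.of_mul_left h1)
  obtain ⟨r, hr⟩ := isSquare_neg_mul_of_evenOrd (evenOrd_sq hw) h2 h3
  exact ⟨r, 0, w, by simp [hw], by linear_combination -hr⟩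

/-- Primitive solutions. -/
lemma exists_primitive {A B C : k⟦X⟧} (h0 : A ≠ 0 ∨ B ≠ 0 ∨ C ≠ 0) :
    ∃ (n : ℕ) (A' B' C' : k⟦X⟧), A = X ^ n * A' ∧ B = X ^ n * B' ∧ C = X ^ n * C' ∧
      (constantCoeff A' ≠ 0 ∨ constantCoeff B' ≠ 0 ∨ constantCoeff C' ≠ 0) := by
  by_contra! hcon
  have : ∀ n : ℕ, (X : k⟦X⟧) ^ n ∣ A ∧ (X : k⟦X⟧) ^ n ∣ B ∧ (X : k⟦X⟧) ^ n ∣ C := by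
    intro n
    induction n with
    | zero => simp
    | succ n ih =>
      obtain ⟨⟨A', hA⟩, ⟨B', hB⟩, ⟨C', hC⟩⟩ := ih
      obtain ⟨h1, h2, h3⟩ := hcon n A' B' C' hA hB hC
      rw [hA, hB, hC, pow_succ]
      exact ⟨mul_dvd_mul_left _ (X_dvd_iff.2 h1), mul_dvd_mul_left _ (X_dvd_iff.2 h2),
        mul_dvd_mul_left _ (X_dvd_iff.2 h3)⟩
  have hz : ∀ p : k⟦X⟧, (∀ n, (X : k⟦X⟧) ^ n ∣ p) → p = 0 := by
    intro p hp
    ext n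
    exact X_pow_dvd_iff.1 (hp (n + 1)) n (Nat.lt_succ_self n)
  rcases h0 with h | h | h
  · exact h (hz _ fun n => (this n).1)
  · exact h (hz _ fun n => (this n).2.1)
  · exact h (hz _ fun n => (this n).2.2)

/-- Local analysis of the quaternary form `⟨x, y, z, xyzF⟩`, `F = (x+y+z)² - 4xz`, for a triple
with a nonvanishing constant coefficient. -/
lemma isotropicTernary_or_constantCoeff_ne [CharZero k] (hi : IsSquare (-1 : k)) {x y z : k⟦X⟧}
    (hx : x ≠ 0) (hy : y ≠ 0) (hz : z ≠ 0)
    (hc : constantCoeff x ≠ 0 ∨ constantCoeff y ≠ 0 ∨ constantCoeff z ≠ 0)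
    {A B C D : k⟦X⟧} (h0 : A ≠ 0 ∨ B ≠ 0 ∨ C ≠ 0 ∨ D ≠ 0)
    (h : x * A ^ 2 + y * B ^ 2 + z * C ^ 2
      + x * y * z * ((x + y + z) ^ 2 - 4 * x * z) * D ^ 2 = 0) :
    IsotropicTernary x y z ∨
      (constantCoeff x ≠ 0 ∧ constantCoeff y ≠ 0 ∧ constantCoeff z ≠ 0) := by
  have hF : IsSquare ((x + y + z) ^ 2 - 4 * x * z) → (x + y + z) ^ 2 - 4 * x * z ≠ 0 →
      IsotropicTernary x y z := by
    rintro ⟨r, hr⟩ hne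
    have hr0 : r ≠ 0 := by rintro rfl; simp [hr] at hne
    refine IsotropicTernary.of_pfister (A := A) (B := B) (C := C) (D := r * D) hx ?_ ?_
    · simpa [hr0] using h0
    · rw [hr] at h
      linear_combination h
  have hF' : ∀ c : k, c ≠ 0 → constantCoeff ((x + y + z) ^ 2 - 4 * x * z) = c ^ 2 →
      IsotropicTernary x y z := fun c hc he =>
    hF (isSquare_of_constantCoeff hc he) (by
      intro hz; rw [hz, map_zero] at he; exact pow_ne_zero 2 hc he.symm)
  have h4 : constantCoeff (4 : k⟦X⟧) = 4 := map_ofNat _ 4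
  by_cases hx0 : constantCoeff x = 0
  · left
    by_cases hyz : constantCoeff y + constantCoeff z = 0
    · have hz0 : constantCoeff z ≠ 0 := by
        intro hz0
        simp [hx0, hz0] at hc hyz
        exact hc hyz
      refine IsotropicTernary.of_isSquare_neg_mul'' hz (isSquare_of_constantCoeff hz0 ?_)
      simp only [map_neg, map_mul]
      linear_combination -constantCoeff z * hyz
    · exact hF' _ hyz (by simp [hx0])
  by_cases hz0 : constantCoeff z = 0
  · left
    by_cases hyz : constantCoeff x + constantCoeff y = 0
    · refine IsotropicTernary.of_isSquare_neg_mul hy (isSquare_of_constantCoeff hx0 ?_)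
      simp only [map_neg, map_mul]
      linear_combination -constantCoeff x * hyz
    · exact hF' _ hyz (by simp [hz0])
  by_cases hy0 : constantCoeff y = 0
  · left
    by_cases hyz : constantCoeff x - constantCoeff z = 0
    · obtain ⟨i, hi⟩ := hi
      have hi0 : i ≠ 0 := by rintro rfl; simp at hi
      refine IsotropicTernary.of_isSquare_neg_mul' hz
        (isSquare_of_constantCoeff (mul_ne_zero hi0 hx0) ?_)
      simp only [map_neg, map_mul]
      linear_combination constantCoeff x * hyz + constantCoeff x ^ 2 * hi
    · exact hF' _ hyz (by simp [hy0, h4]; ring)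
  exact Or.inr ⟨hx0, hy0, hz0⟩

end PowerSeries

namespace PowerSeries

variable {k : Type*} [Field k]

/-- Tame ramified symbols: the residue is trivial. -/
lemma Tame.isSquare_neg_constantCoeff {U V : k⟦X⟧} (h : Tame U V) (hU0 : constantCoeff U = 0)
    (hU1 : coeff 1 U ≠ 0) : IsSquare (-constantCoeff V) := by
  obtain ⟨U, rfl⟩ := X_dvd_iff.2 hU0
  have hU : constantCoeff U ≠ 0 := by
    rw [← zero_add 1, coeff_succ_X_mul] at hU1
    simpa using hU1
  rcases h with ⟨A, B, C, h0, h⟩ | ⟨h, -⟩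
  · obtain ⟨n, A, B, C, rfl, rfl, rfl, hp⟩ := exists_primitive h0
    have h1 : A ^ 2 + X * U * B ^ 2 + V * C ^ 2 = 0 := by
      refine (mul_eq_zero.1 (?_ : (X ^ n) ^ 2 * (A ^ 2 + X * U * B ^ 2 + V * C ^ 2) = 0)).resolve_left
        (pow_ne_zero _ (pow_ne_zero _ X_ne_zero))
      linear_combination h
    have h2 := congrArg constantCoeff h1
    simp at h2
    by_cases hC : constantCoeff C = 0
    · have hA : constantCoeff A = 0 := by simpa [hC] using h2
      have hB : constantCoeff B ≠ 0 := by simpa [hC, hA] using hp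
      obtain ⟨A, rfl⟩ := X_dvd_iff.2 hA
      obtain ⟨C, rfl⟩ := X_dvd_iff.2 hC
      have h3 : X * A ^ 2 + U * B ^ 2 + X * (V * C ^ 2) = 0 := by
        refine (mul_eq_zero.1 (?_ : X * _ = 0)).resolve_left X_ne_zero
        linear_combination h1
      have h4 := congrArg constantCoeff h3
      simp [hU, hB] at h4
    · refine ⟨constantCoeff A / constantCoeff C, ?_⟩
      field_simp
      linear_combination -h2
  · rw [mul_comm] at h
    have := (h.of_mul_left (evenOrd_of_constantCoeff hU)).2
    rw [order_X] at this
    exact absurd this (by decide)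

lemma isotropicTernary_of_constantCoeff [CharZero k] {x y z : k⟦X⟧} (hx : constantCoeff x ≠ 0)
    (hy : constantCoeff y ≠ 0) (hz : constantCoeff z ≠ 0)
    (h : IsotropicTernary (constantCoeff x) (constantCoeff y) (constantCoeff z)) :
    IsotropicTernary x y z := by
  have key : ∀ {x y z : k⟦X⟧} {A B D : k}, constantCoeff z ≠ 0 → D ≠ 0 →
      constantCoeff x * A ^ 2 + constantCoeff y * B ^ 2 + constantCoeff z * D ^ 2 = 0 →
      ∃ r : k⟦X⟧, r ≠ 0 ∧ x * (z * C A) ^ 2 + y * (z * C B) ^ 2 + z * r ^ 2 = 0 := by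
    intro x y z A B D hz hD h
    obtain ⟨r, hr⟩ := isSquare_of_constantCoeff (p := -(z * (x * C A ^ 2 + y * C B ^ 2)))
      (mul_ne_zero hz hD) (by simp; linear_combination -constantCoeff z * h)
    refine ⟨r, ?_, by linear_combination -z * hr⟩
    rintro rfl
    have := congrArg constantCoeff hr
    simp at this
    rcases this with h1 | h1
    · exact hz h1
    · rw [h1] at h
      simp [hz, hD] at h
  obtain ⟨A, B, D, h0, h⟩ := h
  rcases h0 with h0 | h0 | h0
  · obtain ⟨r, hr, he⟩ := key (x := y) (y := z) (z := x) (A := B) (B := D) hx h0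
      (by linear_combination h)
    exact ⟨r, x * PowerSeries.C B, x * PowerSeries.C D, Or.inl hr, by linear_combination he⟩
  · obtain ⟨r, hr, he⟩ := key (x := x) (y := z) (z := y) (A := A) (B := D) hy h0
      (by linear_combination h)
    exact ⟨y * PowerSeries.C A, r, y * PowerSeries.C D, Or.inr (Or.inl hr), by linear_combination he⟩
  · obtain ⟨r, hr, he⟩ := key (x := x) (y := y) (z := z) (A := A) (B := B) hz h0
      (by linear_combination h)
    exact ⟨z * PowerSeries.C A, z * PowerSeries.C B, r, Or.inr (Or.inr hr), by linear_combination he⟩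

lemma exists_isotropic_normalized [CharZero k] (hi : IsSquare (-1 : k)) {x y z : k⟦X⟧}
    (hx : x ≠ 0) (hy : y ≠ 0) (hz : z ≠ 0)
    {A B C D : k⟦X⟧} (h0 : A ≠ 0 ∨ B ≠ 0 ∨ C ≠ 0 ∨ D ≠ 0)
    (h : x * A ^ 2 + y * B ^ 2 + z * C ^ 2
      + x * y * z * ((x + y + z) ^ 2 - 4 * x * z) * D ^ 2 = 0) :
    ∃ (n : ℕ) (x' y' z' : k⟦X⟧), x = X ^ n * x' ∧ y = X ^ n * y' ∧ z = X ^ n * z' ∧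
      (constantCoeff x' ≠ 0 ∨ constantCoeff y' ≠ 0 ∨ constantCoeff z' ≠ 0) ∧
      (IsotropicTernary x' y' z' ∨
        (constantCoeff x' ≠ 0 ∧ constantCoeff y' ≠ 0 ∧ constantCoeff z' ≠ 0)) := by
  obtain ⟨n, x, y, z, rfl, rfl, rfl, hc⟩ := exists_primitive (Or.inl hx (b := y ≠ 0 ∨ z ≠ 0))
  have hX : (X : k⟦X⟧) ^ n ≠ 0 := pow_ne_zero _ X_ne_zero
  refine ⟨n, x, y, z, rfl, rfl, rfl, hc,
    isotropicTernary_or_constantCoeff_ne hi (right_ne_zero_of_mul hx) (right_ne_zero_of_mul hy)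
    (right_ne_zero_of_mul hz) hc (A := A) (B := B) (C := C) (D := X ^ n * X ^ n * D) ?_ ?_⟩
  · simpa [hX] using h0
  · refine (mul_eq_zero.1 (?_ : X ^ n * _ = 0)).resolve_left hX
    linear_combination h

lemma tame_of_isotropic [CharZero k] (hi : IsSquare (-1 : k)) {x y z : k⟦X⟧}
    (hx : x ≠ 0) (hy : y ≠ 0) (hz : z ≠ 0)
    {A B C D : k⟦X⟧} (h0 : A ≠ 0 ∨ B ≠ 0 ∨ C ≠ 0 ∨ D ≠ 0)
    (h : x * A ^ 2 + y * B ^ 2 + z * C ^ 2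
      + x * y * z * ((x + y + z) ^ 2 - 4 * x * z) * D ^ 2 = 0) :
    Tame (x * y) (x * z) := by
  obtain ⟨n, x', y', z', rfl, rfl, rfl, -, hc | ⟨hcx, hcy, hcz⟩⟩ :=
    exists_isotropic_normalized hi hx hy hz h0 h
  · exact Or.inl ((IsotropicTernary.normalize_iff hx).1 (hc.left_mul _))
  · have hX : (X : k⟦X⟧) ^ n ≠ 0 := pow_ne_zero _ X_ne_zero
    right
    have : ∀ y' : k⟦X⟧, constantCoeff y' ≠ 0 → EvenOrd (X ^ n * x' * (X ^ n * y')) := by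
      intro y' hy'
      rw [show X ^ n * x' * (X ^ n * y') = (X ^ n) ^ 2 * (x' * y') by ring]
      exact (evenOrd_sq hX).mul ((evenOrd_of_constantCoeff hcx).mul (evenOrd_of_constantCoeff hy'))
    exact ⟨this _ hcy, this _ hcz⟩

end PowerSeries

namespace Polynomial

universe u

variable {Λ : Type u} [Field Λ]

/-- Expansion of polynomials at a point `θ` of an extension field. -/
noncomputable def expandAt {k : Type u} [Field k] [Algebra Λ k] (θ : k) : Λ[X] →+* PowerSeries k :=
  (coeToPowerSeries.ringHom.comp (taylorAlgHom θ).toRingHom).comp (mapRingHom (algebraMap Λ k))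

section expandAt

variable {k : Type u} [Field k] [Algebra Λ k] (θ : k)

lemma expandAt_apply (p : Λ[X]) :
    expandAt θ p = ((taylor θ (p.map (algebraMap Λ k)) : k[X]) : PowerSeries k) := rfl

attribute [irreducible] expandAt

lemma expandAt_injective : Function.Injective (expandAt (Λ := Λ) θ) := by
  intro p q h
  rw [expandAt_apply, expandAt_apply, coe_inj] at h
  exact map_injective _ (algebraMap Λ k).injective (taylor_injective _ h)

lemma constantCoeff_expandAt (p : Λ[X]) :
    PowerSeries.constantCoeff (expandAt θ p) = aeval θ p := by
  rw [expandAt_apply, ← PowerSeries.coeff_zero_eq_constantCoeff_apply, coeff_coe, taylor_coeff_zero,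
    eval_map_algebraMap]

lemma coeff_one_expandAt (p : Λ[X]) :
    PowerSeries.coeff 1 (expandAt θ p) = aeval θ (derivative p) := by
  rw [expandAt_apply, coeff_coe, taylor_coeff_one, derivative_map, eval_map_algebraMap]

end expandAt

/-- Tame everywhere. -/
def TameEverywhere (U V : Λ[X]) : Prop :=
  ∀ (k : Type u) [Field k] [Algebra Λ k] (θ : k), PowerSeries.Tame (expandAt θ U) (expandAt θ V)

lemma exists_dvd_sq_add_of_squarefree {U V : Λ[X]} (hU : Squarefree U)
    (h : ∀ P, Prime P → P ∣ U → ∃ w, P ∣ w ^ 2 + V) : ∃ w, U ∣ w ^ 2 + V := by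
  induction U using UniqueFactorizationMonoid.induction_on_prime with
  | h₁ => exact absurd hU not_squarefree_zero
  | h₂ U hu => exact ⟨0, hu.dvd⟩
  | h₃ U P hU0 hP ih =>
    obtain ⟨w₁, hw₁⟩ := ih (hU.of_mul_right) fun Q hQ hQU => h Q hQ (hQU.mul_left _)
    obtain ⟨w₂, hw₂⟩ := h P hP (dvd_mul_right _ _)
    have hc : IsCoprime P U := (hP.irreducible.coprime_iff_not_dvd).2 fun ⟨Q, hQ⟩ =>
      hP.not_isUnit (hU P ⟨Q, by rw [hQ, mul_assoc]⟩)
    obtain ⟨a, b, hab⟩ := hc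
    refine ⟨w₁ * (a * P) + w₂ * (b * U), IsCoprime.mul_dvd ⟨a, b, hab⟩ ?_ ?_⟩
    · obtain ⟨s, hs⟩ := hw₂
      exact ⟨s + a * ((w₁ - w₂) * (w₁ - w₂) * (a * P) + 2 * w₂ * (w₁ - w₂)), by
        have : b * U = 1 - a * P := by linear_combination hab
        rw [this]; linear_combination hs⟩
    · obtain ⟨s, hs⟩ := hw₁
      exact ⟨s + b * ((w₂ - w₁) * (w₂ - w₁) * (b * U) + 2 * w₁ * (w₂ - w₁)), by
        have : a * P = 1 - b * U := by linear_combination hab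
        rw [this]; linear_combination hs⟩

lemma TameEverywhere.exists_dvd_sq_add [CharZero Λ] {U V : Λ[X]} (h : TameEverywhere U V)
    (hU : Squarefree U) {P : Λ[X]} (hP : Prime P) (hPU : P ∣ U) : ∃ w, P ∣ w ^ 2 + V := by
  by_cases hPV : P ∣ V
  · exact ⟨0, by simpa using hPV⟩
  have : Fact (Irreducible P) := ⟨hP.irreducible⟩
  have hV : aeval (AdjoinRoot.root P) V ≠ 0 := by
    rwa [AdjoinRoot.aeval_eq, Ne, AdjoinRoot.mk_eq_zero]
  have hU0 : aeval (AdjoinRoot.root P) U = 0 := by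
    rwa [AdjoinRoot.aeval_eq, AdjoinRoot.mk_eq_zero]
  have hU1 : aeval (AdjoinRoot.root P) (derivative U) ≠ 0 :=
    (PerfectField.separable_iff_squarefree.2 hU).aeval_derivative_ne_zero hU0
  obtain ⟨r, hr⟩ := (h (AdjoinRoot P) (AdjoinRoot.root P)).isSquare_neg_constantCoeff
    (by rwa [constantCoeff_expandAt]) (by rwa [coeff_one_expandAt])
  obtain ⟨w, rfl⟩ := AdjoinRoot.mk_surjective r
  refine ⟨w, ?_⟩
  rw [constantCoeff_expandAt, AdjoinRoot.aeval_eq] at hr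
  rw [← AdjoinRoot.mk_eq_zero, map_add, map_pow]
  linear_combination -hr

lemma TameEverywhere.swap {U V : Λ[X]} (h : TameEverywhere U V) : TameEverywhere V U :=
  fun k _ _ θ => (h k θ).swap

/-- Legendre descent over `Λ[s]`: a conic bundle which is unramified at all finite places and has
a point over the completion at the origin has a section. -/
lemma isotropicTernary_of_tameEverywhere [CharZero Λ] (n : ℕ) (U V : Λ[X])
    (hn : U.natDegree + V.natDegree = n) (hU : U ≠ 0) (hV : V ≠ 0) (ht : TameEverywhere U V)
    (h0 : IsotropicTernary 1 (expandAt (0 : Λ) U) (expandAt (0 : Λ) V)) :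
    IsotropicTernary 1 U V := by
  induction n using Nat.strong_induction_on generalizing U V with
  | _ n ih =>
  wlog hle : V.natDegree ≤ U.natDegree generalizing U V
  · exact (this V U (by omega) hV hU ht.swap h0.swap (by omega)).swap
  have hinj := fun (k : Type u) [Field k] [Algebra Λ k] (θ : k) => expandAt_injective (Λ := Λ) θ
  rcases Nat.eq_zero_or_pos U.natDegree with hU0 | hU0
  · have hV0 : V.natDegree = 0 := by omega
    obtain ⟨u, rfl⟩ := natDegree_eq_zero.1 hU0
    obtain ⟨v, rfl⟩ := natDegree_eq_zero.1 hV0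
    obtain ⟨A, B, D, h0, h⟩ := h0
    obtain ⟨m, A, B, D, rfl, rfl, rfl, hp⟩ := PowerSeries.exists_primitive h0
    have h1 : A ^ 2 + expandAt (0 : Λ) (C u) * B ^ 2 + expandAt (0 : Λ) (C v) * D ^ 2 = 0 := by
      refine (mul_eq_zero.1 (?_ : (PowerSeries.X ^ m) ^ 2 * _ = 0)).resolve_left
        (pow_ne_zero _ (pow_ne_zero _ PowerSeries.X_ne_zero))
      linear_combination h
    have h2 := congrArg PowerSeries.constantCoeff h1
    simp only [map_add, map_mul, constantCoeff_expandAt, map_pow, aeval_C, map_zero,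
      Algebra.algebraMap_self, RingHom.id_apply] at h2
    have h3 : IsotropicTernary 1 u v := ⟨_, _, _, hp, by linear_combination h2⟩
    simpa using h3.map C_injective
  by_cases hsq : Squarefree U
  · obtain ⟨w, hw⟩ := exists_dvd_sq_add_of_squarefree (V := V) hsq fun P hP hPU =>
      ht.exists_dvd_sq_add hsq hP hPU
    wlog hdw : w.degree < U.degree generalizing w
    · refine this (w % U) ?_ (degree_mod_lt _ hU)
      obtain ⟨s, hs⟩ := hw
      have := EuclideanDomain.div_add_mod w U
      refine ⟨s - (w / U) * (2 * (w % U) + U * (w / U)), ?_⟩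
      linear_combination hs + (U * (w / U) + w % U + w) * this
    obtain ⟨U', hU'⟩ := hw
    by_cases hU'0 : U' = 0
    · exact ⟨w, 0, 1, by simp, by rw [hU'0] at hU'; linear_combination hU'⟩
    have hdw' : w.natDegree < U.natDegree := by
      by_cases hw0 : w = 0
      · simpa [hw0] using hU0
      · exact natDegree_lt_natDegree hw0 hdw
    have hdeg : U.natDegree + U'.natDegree < U.natDegree + U.natDegree := by
      rw [← natDegree_mul hU hU'0, ← hU']
      refine lt_of_le_of_lt (natDegree_add_le _ _) (max_lt ?_ (by omega))
      rw [natDegree_pow]; omega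
    have hval := fun (k : Type u) [Field k] [Algebra Λ k] (θ : k) => by
      have := congrArg (expandAt θ) hU'.symm
      rwa [map_mul, map_add, map_pow] at this
    have := ih (U'.natDegree + V.natDegree) (by omega) U' V rfl hU'0 hV
      (fun k _ _ θ =>
        have : CharZero k := charZero_of_injective_algebraMap (algebraMap Λ k).injective
        (ht k θ).of_mul_eq ((map_ne_zero_iff _ (hinj k θ)).2 hU) (hval k θ))
      (h0.of_mul_eq ((map_ne_zero_iff _ (hinj Λ 0)).2 hU) (hval Λ 0))
    exact this.of_mul_eq hU'0 (w := w) (by rw [hU', mul_comm])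
  · obtain ⟨g, hg, hgu⟩ : ∃ g, g * g ∣ U ∧ ¬ IsUnit g := by
      simpa [Squarefree] using hsq
    obtain ⟨U', rfl⟩ := hg
    have hg0 : g ≠ 0 := by rintro rfl; simp at hU
    have hU'0 : U' ≠ 0 := right_ne_zero_of_mul hU
    have hgd : 0 < g.natDegree := natDegree_pos_iff_degree_pos.2 (degree_pos_of_ne_zero_of_nonunit hg0 hgu)
    rw [← sq] at *
    have := ih (U'.natDegree + V.natDegree)
      (by rw [natDegree_mul (pow_ne_zero 2 hg0) hU'0, natDegree_pow] at hn; omega) U' V rfl hU'0 hV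
      (fun k _ _ θ => by
        have := ht k θ
        rw [map_mul, map_pow] at this
        exact this.of_mul_sq ((map_ne_zero_iff _ (hinj k θ)).2 hg0))
      (by
        rw [map_mul, map_pow] at h0
        exact (IsotropicTernary.mul_sq_iff ((map_ne_zero_iff _ (hinj Λ 0)).2 hg0)).1 h0)
    exact (IsotropicTernary.mul_sq_iff hg0).2 this

lemma isotropicTernary_coeff_of_isotropicTernary {x y z : Λ[X]} {N : ℕ}
    (hN : ∀ j > N, x.coeff j = 0 ∧ y.coeff j = 0 ∧ z.coeff j = 0)
    (h : IsotropicTernary x y z) :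
    IsotropicTernary (x.coeff N) (y.coeff N) (z.coeff N) := by
  obtain ⟨A, B, C, h0, h⟩ := h
  set e := max A.natDegree (max B.natDegree C.natDegree) with he
  have hdeg : ∀ p : Λ[X], (p = x ∨ p = y ∨ p = z) → p.natDegree ≤ N := by
    intro p hp
    rw [natDegree_le_iff_coeff_eq_zero]
    intro j hj
    have := hN j hj
    rcases hp with rfl | rfl | rfl <;> tauto
  have hprod : ∀ p A : Λ[X], (p = x ∨ p = y ∨ p = z) → A.natDegree ≤ e →
      (p * A ^ 2).coeff (N + 2 * e) = p.coeff N * A.coeff e ^ 2 := by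
    intro p A hp hA
    rw [coeff_mul_add_eq_of_natDegree_le (hdeg p hp) (natDegree_pow_le_of_le 2 hA),
      coeff_pow_of_natDegree_le hA]
  refine ⟨A.coeff e, B.coeff e, C.coeff e, ?_, ?_⟩
  · by_contra! hcon
    obtain ⟨hA, hB, hC⟩ := hcon
    have hlead : ∀ p : Λ[X], p.natDegree ≤ e → p.coeff e = 0 → p.natDegree = e → p = 0 := by
      intro p _ h1 h2
      rw [← h2] at h1
      simpa using h1
    have hlt : ∀ p : Λ[X], p.natDegree ≤ e → p.coeff e = 0 → p.natDegree < e ∨ p = 0 := by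
      intro p h1 h2
      by_cases h3 : p.natDegree = e
      · exact Or.inr (hlead p h1 h2 h3)
      · exact Or.inl (lt_of_le_of_ne h1 h3)
    have hA' := hlt A (by omega) hA
    have hB' := hlt B (by omega) hB
    have hC' := hlt C (by omega) hC
    have h00 : e = 0 → A = 0 ∧ B = 0 ∧ C = 0 := by
      intro he0
      refine ⟨hA'.resolve_left (by omega), hB'.resolve_left (by omega), hC'.resolve_left (by omega)⟩
    have he' : e = 0 := by
      have : ∀ p : Λ[X], p.natDegree < e ∨ p = 0 → p.natDegree < e ∨ p.natDegree = 0 :=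
        fun p hp => hp.imp id fun h => by simp [h]
      have hA' := this A hA'
      have hB' := this B hB'
      have hC' := this C hC'
      omega
    have := h00 he'
    tauto
  · have := congrArg (fun p => coeff p (N + 2 * e)) h
    simp only [coeff_add, coeff_zero] at this
    rwa [hprod x A (by simp) (by omega), hprod y B (by simp) (by omega),
      hprod z C (by simp) (by omega)] at this

/-- Propagation of isotropy from the lowest to the highest coefficient vector. -/
theorem isotropicTernary_coeff_of_isotropic [CharZero Λ] (hi : IsSquare (-1 : Λ)) {x y z : Λ[X]}
    {A B C D : Λ[X]} (h0 : A ≠ 0 ∨ B ≠ 0 ∨ C ≠ 0 ∨ D ≠ 0)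
    (h : x * y * z ≠ 0 → x * A ^ 2 + y * B ^ 2 + z * C ^ 2
      + x * y * z * ((x + y + z) ^ 2 - 4 * x * z) * D ^ 2 = 0)
    {m N : ℕ} (hlow : ∀ j < m, x.coeff j = 0 ∧ y.coeff j = 0 ∧ z.coeff j = 0)
    (hm : x.coeff m ≠ 0 ∨ y.coeff m ≠ 0 ∨ z.coeff m ≠ 0)
    (hN : ∀ j > N, x.coeff j = 0 ∧ y.coeff j = 0 ∧ z.coeff j = 0)
    (hiso : IsotropicTernary (x.coeff m) (y.coeff m) (z.coeff m)) :
    IsotropicTernary (x.coeff N) (y.coeff N) (z.coeff N) := by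
  by_cases hxN : x.coeff N = 0
  · exact .of_exists_mul_eq (Or.inl hxN)
  by_cases hyN : y.coeff N = 0
  · exact .of_exists_mul_eq (Or.inr (Or.inl hyN))
  by_cases hzN : z.coeff N = 0
  · exact .of_exists_mul_eq (Or.inr (Or.inr hzN))
  have hx : x ≠ 0 := by rintro rfl; simp at hxN
  have hy : y ≠ 0 := by rintro rfl; simp at hyN
  have hz : z ≠ 0 := by rintro rfl; simp at hzN
  specialize h (mul_ne_zero (mul_ne_zero hx hy) hz)
  have hk : ∀ (k : Type u) [Field k] [Algebra Λ k] (θ : k),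
      ∃ A B C D : PowerSeries k, (A ≠ 0 ∨ B ≠ 0 ∨ C ≠ 0 ∨ D ≠ 0) ∧
      expandAt θ x * A ^ 2 + expandAt θ y * B ^ 2 + expandAt θ z * C ^ 2
      + expandAt θ x * expandAt θ y * expandAt θ z * ((expandAt θ x + expandAt θ y
        + expandAt θ z) ^ 2 - 4 * expandAt θ x * expandAt θ z) * D ^ 2 = 0 := by
    intro k _ _ θ
    refine ⟨expandAt θ A, expandAt θ B, expandAt θ C, expandAt θ D, ?_, ?_⟩
    · simpa only [Ne, map_eq_zero_iff _ (expandAt_injective (Λ := Λ) θ)] using h0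
    · have := congrArg (expandAt θ) h
      simpa only [map_add, map_sub, map_mul, map_pow, map_zero, map_ofNat] using this
  have hne : ∀ (k : Type u) [Field k] [Algebra Λ k] (θ : k) {p : Λ[X]}, p ≠ 0 →
      expandAt θ p ≠ 0 :=
    fun k _ _ θ p hp => (map_ne_zero_iff _ (expandAt_injective (Λ := Λ) θ)).2 hp
  have htame : TameEverywhere (x * y) (x * z) := by
    intro k _ _ θ
    have : CharZero k := charZero_of_injective_algebraMap (algebraMap Λ k).injective
    obtain ⟨A, B, C, D, h0, h⟩ := hk k θ
    rw [map_mul, map_mul]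
    exact PowerSeries.tame_of_isotropic (by simpa using hi.map (algebraMap Λ k)) (hne k θ hx)
      (hne k θ hy) (hne k θ hz) h0 h
  have hzero : IsotropicTernary 1 (expandAt (0 : Λ) (x * y)) (expandAt (0 : Λ) (x * z)) := by
    rw [map_mul, map_mul, ← IsotropicTernary.normalize_iff (hne Λ 0 hx)]
    obtain ⟨A, B, C, D, h0, h⟩ := hk Λ 0
    obtain ⟨n, x', y', z', hx', hy', hz', hc, hcc⟩ :=
      PowerSeries.exists_isotropic_normalized hi (hne Λ 0 hx) (hne Λ 0 hy) (hne Λ 0 hz) h0 h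
    rw [hx', hy', hz']
    refine IsotropicTernary.left_mul _ (hcc.elim id fun ⟨h1, h2, h3⟩ =>
      PowerSeries.isotropicTernary_of_constantCoeff h1 h2 h3 ?_)
    have hco : ∀ (p : Λ[X]) (p' : PowerSeries Λ), expandAt (0 : Λ) p = PowerSeries.X ^ n * p' →
        (∀ j, p.coeff j = if n ≤ j then PowerSeries.coeff (j - n) p' else 0) := by
      intro p p' hp j
      rw [← PowerSeries.coeff_X_pow_mul', ← hp, expandAt_apply]
      simp
    have hmn : m = n := by
      rcases lt_trichotomy m n with hlt | he | hlt
      · exfalso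
        rw [hco x x' hx', hco y y' hy', hco z z' hz'] at hm
        simp [hlt.not_ge] at hm
      · exact he
      · exfalso
        have := hlow n hlt
        rw [hco x x' hx', hco y y' hy', hco z z' hz'] at this
        simp only [le_refl, if_true, Nat.sub_self, PowerSeries.coeff_zero_eq_constantCoeff_apply] at this
        obtain ⟨h1, h2, h3⟩ := this
        rcases hc with h | h | h
        exacts [h h1, h h2, h h3]
    subst hmn
    rw [hco x x' hx', hco y y' hy', hco z z' hz'] at hiso
    simpa using hiso
  exact isotropicTernary_coeff_of_isotropicTernary hN ((IsotropicTernary.normalize_iff hx).2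
    (isotropicTernary_of_tameEverywhere _ (x * y) (x * z) rfl (mul_ne_zero hx hy)
    (mul_ne_zero hx hz) htame hzero))

end Polynomial

/-- A diagonal quadratic form over a commutative ring has only the trivial zero. -/
def AnisotropicDiagonal {R ι : Type*} [CommRing R] [Fintype ι] (a : ι → R) : Prop :=
  ∀ g : ι → R, ∑ i, a i * g i ^ 2 = 0 → g = 0

namespace AnisotropicDiagonal

open Polynomial

variable {k ι : Type*} [Field k] [Fintype ι] {a : ι → k}

lemma coeff_sum_sq {m : ℕ} {g : ι → k[X]} (hg : ∀ i, (g i).natDegree ≤ m) :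
    (∑ i, C (a i) * g i ^ 2).coeff (2 * m) = ∑ i, a i * (g i).coeff m ^ 2 := by
  rw [finsetSum_coeff]
  refine Finset.sum_congr rfl fun i _ => ?_
  rw [coeff_C_mul, coeff_pow_of_natDegree_le (hg i)]

lemma natDegree_le (ha : AnisotropicDiagonal a) {g : ι → k[X]} {m : ℕ}
    (h : (∑ i, C (a i) * g i ^ 2).natDegree ≤ 2 * m) (i : ι) : (g i).natDegree ≤ m := by
  by_contra! hcon
  obtain ⟨j, -, hj⟩ := Finset.exists_max_image Finset.univ (fun i => (g i).natDegree) ⟨i, by simp⟩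
  have hm : m < (g j).natDegree := hcon.trans_le (hj i (by simp))
  have h1 := coeff_sum_sq (a := a) fun i => hj i (by simp)
  rw [coeff_eq_zero_of_natDegree_lt (by omega)] at h1
  have h2 := congrFun (ha _ h1.symm) j
  simp only [coeff_natDegree, Pi.zero_apply, leadingCoeff_eq_zero] at h2
  simp [h2] at hm

lemma polynomial (ha : AnisotropicDiagonal a) :
    AnisotropicDiagonal (fun i => (C (a i) : k[X])) := by
  intro g h
  have hd : ∀ i, (g i).natDegree ≤ 0 := ha.natDegree_le (by rw [h]; simp)
  have h1 := coeff_sum_sq (a := a) hd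
  rw [h] at h1
  have h2 := ha _ (by rw [← h1]; simp)
  funext i
  rw [eq_C_of_natDegree_le_zero (hd i)]
  simpa using congrFun h2 i

lemma polynomial_add_X (ha : AnisotropicDiagonal a) {g : ι → k[X]} {c : k[X]}
    (h : ∑ i, C (a i) * g i ^ 2 + X * c ^ 2 = 0) : g = 0 ∧ c = 0 := by
  have hc : c = 0 := by
    by_contra hc
    have h1 : ∑ i, C (a i) * g i ^ 2 = -(X * c ^ 2) := by linear_combination h
    have h2 : (∑ i, C (a i) * g i ^ 2).natDegree = 2 * c.natDegree + 1 := by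
      rw [h1, natDegree_neg, natDegree_X_mul (pow_ne_zero 2 hc), natDegree_pow]
    have hd := ha.natDegree_le (g := g) (m := c.natDegree + 1) (by omega)
    have h3 := coeff_sum_sq (a := a) hd
    rw [coeff_eq_zero_of_natDegree_lt (by omega)] at h3
    have h4 := ha _ h3.symm
    have hd' : ∀ i, (g i).natDegree ≤ c.natDegree := by
      intro i
      by_contra! hlt
      have h5 : (g i).natDegree = c.natDegree + 1 := le_antisymm (hd i) hlt
      have h6 := congrFun h4 i
      simp only [← h5, Pi.zero_apply, coeff_natDegree, leadingCoeff_eq_zero] at h6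
      simp [h6] at h5
    have h7 : (∑ i, C (a i) * g i ^ 2).natDegree ≤ 2 * c.natDegree :=
      natDegree_sum_le_of_forall_le _ _ fun i _ => (natDegree_C_mul_le _ _).trans
        (natDegree_pow_le_of_le 2 (hd' i))
    omega
  subst hc
  exact ⟨ha.polynomial _ (by simpa using h), rfl⟩

lemma exists_common_denominator {n : ℕ} (G : Fin n → RatFunc k) :
    ∃ (D : k[X]) (g : Fin n → k[X]), D ≠ 0 ∧
      ∀ i, algebraMap k[X] (RatFunc k) D * G i = algebraMap k[X] (RatFunc k) (g i) := by
  obtain ⟨D, hD⟩ := IsLocalization.exist_integer_multiples_of_finite (nonZeroDivisors k[X]) G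
  choose g hg using hD
  exact ⟨D, g, nonZeroDivisors.ne_zero D.2, fun i => by rw [hg i, Algebra.smul_def]⟩

/-- The Cassels–Pfister theorem. -/
theorem cassels_pfister (ha : AnisotropicDiagonal a) {p D : k[X]}
    {g : ι → k[X]} (hD : D ≠ 0) (h : ∑ i, C (a i) * g i ^ 2 = p * D ^ 2) :
    ∃ g : ι → k[X], ∑ i, C (a i) * g i ^ 2 = p := by
  induction hn : D.natDegree using Nat.strong_induction_on generalizing D g with
  | _ n ih =>
  subst hn
  have expand : ∀ (s t : k[X]) (g h : ι → k[X]), ∑ i, C (a i) * (s * g i - t * h i) ^ 2 =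
      s ^ 2 * ∑ i, C (a i) * g i ^ 2 - 2 * s * t * ∑ i, C (a i) * (g i * h i)
        + t ^ 2 * ∑ i, C (a i) * h i ^ 2 := by
    intro s t g h
    simp only [Finset.mul_sum, ← Finset.sum_sub_distrib, ← Finset.sum_add_distrib]
    exact Finset.sum_congr rfl fun i _ => by ring
  set q : ι → k[X] := fun i => g i / D with hq
  set b := ∑ i, C (a i) * (g i * q i) with hb
  set Q := ∑ i, C (a i) * q i ^ 2 with hQ
  have hr : ∀ i, g i - D * q i = g i % D := fun i =>
    sub_eq_iff_eq_add'.2 (EuclideanDomain.div_add_mod (g i) D).symm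
  have h3 : ∑ i, C (a i) * (g i % D) ^ 2 = D * (D * p - 2 * b + D * Q) := by
    have := expand 1 D g q
    simp only [one_mul, hr, h] at this
    rw [this]; ring
  by_cases h0 : D * p - 2 * b + D * Q = 0
  · rw [h0, mul_zero] at h3
    have h4 := ha.polynomial _ h3
    refine ⟨q, mul_left_cancel₀ (pow_ne_zero 2 hD) ?_⟩
    rw [mul_comm _ p, ← h, Finset.mul_sum]
    refine Finset.sum_congr rfl fun i _ => ?_
    have : g i - D * q i = 0 := by rw [hr]; exact congrFun h4 i
    rw [sub_eq_zero.1 this]; ring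
  · have hdpos : 0 < D.natDegree := by
      by_contra! hd
      obtain ⟨c, rfl⟩ := natDegree_eq_zero.1 (Nat.le_zero.1 hd)
      have hu : IsUnit (C c) := isUnit_C.2 (IsUnit.mk0 c (by simpa using hD))
      apply h0
      refine (mul_eq_zero.1 (h3.symm.trans ?_)).resolve_left hD
      refine Finset.sum_eq_zero fun i _ => ?_
      rw [EuclideanDomain.mod_eq_zero.2 (hu.dvd)]
      simp
    refine ih (D * p - 2 * b + D * Q).natDegree ?_ (g := fun i => (Q - p) * g i
      - 2 * (b - p * D) * q i) h0 ?_ rfl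
    · have h5 : (D * (D * p - 2 * b + D * Q)).natDegree ≤ 2 * (D.natDegree - 1) := by
        rw [← h3]
        refine natDegree_sum_le_of_forall_le _ _ fun i _ => (natDegree_C_mul_le _ _).trans
          (natDegree_pow_le_of_le 2 ?_)
        have := natDegree_mod_lt (g i) hdpos.ne'
        omega
      rw [natDegree_mul hD h0] at h5
      omega
    · rw [expand, h, ← hb, ← hQ]
      ring

lemma ratFunc {n : ℕ} {a : Fin n → k} (ha : AnisotropicDiagonal a) {G : Fin n → RatFunc k}
    (h : ∑ i, RatFunc.C (a i) * G i ^ 2 = 0) : G = 0 := by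
  obtain ⟨D, g, hD, hg⟩ := exists_common_denominator G
  have hD' : algebraMap k[X] (RatFunc k) D ≠ 0 := by simpa using hD
  have h1 : ∑ i, C (a i) * g i ^ 2 = 0 := by
    apply RatFunc.algebraMap_injective k
    rw [map_zero, ← mul_zero (algebraMap k[X] (RatFunc k) D ^ 2), ← h, Finset.mul_sum, map_sum]
    refine Finset.sum_congr rfl fun i _ => ?_
    rw [map_mul, map_pow, ← hg, RatFunc.algebraMap_C]; ring
  have h2 := ha.polynomial _ h1
  funext i
  have h3 := hg i
  rw [h2] at h3
  simpa [hD] using h3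

lemma ratFunc_add_X {n : ℕ} {a : Fin n → k} (ha : AnisotropicDiagonal a) {G : Fin n → RatFunc k}
    {c : RatFunc k} (h : ∑ i, RatFunc.C (a i) * G i ^ 2 + RatFunc.X * c ^ 2 = 0) :
    G = 0 ∧ c = 0 := by
  obtain ⟨D, g, hD, hg⟩ := exists_common_denominator (Fin.cons c G : Fin (n + 1) → RatFunc k)
  have hD' : algebraMap k[X] (RatFunc k) D ≠ 0 := by simpa using hD
  have hg0 := hg 0
  have hgs := fun i : Fin n => hg i.succ
  simp only [Fin.cons_zero, Fin.cons_succ] at hg0 hgs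
  have h1 : ∑ i : Fin n, C (a i) * g i.succ ^ 2 + X * g 0 ^ 2 = 0 := by
    apply RatFunc.algebraMap_injective k
    rw [map_zero, ← mul_zero (algebraMap k[X] (RatFunc k) D ^ 2), ← h, mul_add, Finset.mul_sum,
      map_add, map_sum]
    congr 1
    · refine Finset.sum_congr rfl fun i _ => ?_
      rw [map_mul, map_pow, ← hgs, RatFunc.algebraMap_C]; ring
    · rw [map_mul, map_pow, ← hg0, RatFunc.algebraMap_X]; ring
  obtain ⟨h2, h3⟩ := ha.polynomial_add_X h1
  constructor
  · funext i
    have h4 := hgs i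
    rw [show g i.succ = 0 from congrFun h2 i] at h4
    simpa [hD] using h4
  · rw [h3] at hg0
    simpa [hD] using hg0

lemma cassels_pfister_ratFunc {n : ℕ} {a : Fin n → k} (ha : AnisotropicDiagonal a)
    {p : k[X]} {G : Fin n → RatFunc k}
    (h : ∑ i, RatFunc.C (a i) * G i ^ 2 = algebraMap k[X] (RatFunc k) p) :
    ∃ g : Fin n → k[X], ∑ i, C (a i) * g i ^ 2 = p := by
  obtain ⟨D, g, hD, hg⟩ := exists_common_denominator G
  refine ha.cassels_pfister hD (g := g) ?_
  apply RatFunc.algebraMap_injective k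
  rw [map_mul, ← h, mul_comm, map_pow, Finset.mul_sum, map_sum]
  refine Finset.sum_congr rfl fun i _ => ?_
  rw [map_mul, map_pow, ← hg, RatFunc.algebraMap_C]; ring

end AnisotropicDiagonal

namespace AnisotropicDiagonal

open Polynomial

variable {k : Type*} [Field k]

lemma one : AnisotropicDiagonal ![(1 : k)] := by
  intro g h
  funext i
  fin_cases i
  simpa using h

lemma one_X {u : k} (h : AnisotropicDiagonal ![1, u]) :
    AnisotropicDiagonal ![(1 : RatFunc k), RatFunc.C u, RatFunc.X] := by
  intro g hg
  obtain ⟨h1, h2⟩ := h.ratFunc_add_X (G := ![g 0, g 1]) (c := g 2) (by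
    simpa [Fin.sum_univ_succ, add_assoc] using hg)
  funext i
  fin_cases i
  · exact congrFun h1 0
  · exact congrFun h1 1
  · exact h2

lemma one_X_two : AnisotropicDiagonal ![(1 : RatFunc k), RatFunc.X] := by
  intro g hg
  obtain ⟨h1, h2⟩ := one.ratFunc_add_X (G := ![g 0]) (c := g 1) (by
    simpa [Fin.sum_univ_succ, add_assoc] using hg)
  funext i
  fin_cases i
  · exact congrFun h1 0
  · exact h2

lemma ratFunc_three {u v : k} (h : AnisotropicDiagonal ![1, u, v]) :
    AnisotropicDiagonal ![(1 : RatFunc k), RatFunc.C u, RatFunc.C v] := by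
  intro g hg
  exact h.ratFunc (by simpa [Fin.sum_univ_succ] using hg)

lemma skip {u v : k} (h : AnisotropicDiagonal ![1, u, v]) : AnisotropicDiagonal ![1, v] := by
  intro g hg
  have := h ![g 0, 0, g 1] (by simpa [Fin.sum_univ_succ] using hg)
  funext i
  fin_cases i
  · exact congrFun this 0
  · exact congrFun this 2

lemma ne_sq {u v : k} (h : AnisotropicDiagonal ![1, u, v]) (r : k) : r ^ 2 ≠ -v := by
  intro hr
  have := congrFun (h ![r, 0, 1] (by simp [Fin.sum_univ_succ, hr])) 2
  simp at this

end AnisotropicDiagonal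

section tower

open Polynomial

variable {k : Type*} [Field k]

lemma not_isSquare_discriminant (h2 : (2 : k) ≠ 0) {u : k} (hu : u ≠ 0) (h : RatFunc k) :
    h ^ 2 ≠ (RatFunc.X + RatFunc.C u + 1) ^ 2 - 4 * RatFunc.C u := by
  intro hh
  obtain ⟨g, hg⟩ := (AnisotropicDiagonal.one (k := k)).cassels_pfister_ratFunc
    (p := (X + C u + 1) ^ 2 - 4 * C u) (G := ![h]) (by simpa [map_ofNat] using hh)
  simp only [Fin.sum_univ_one, Matrix.cons_val_fin_one, C_1, one_mul] at hg
  have hd : (g 0).natDegree ≤ 1 := by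
    have h1 : (g 0 ^ 2).natDegree ≤ 2 := by rw [hg]; compute_degree
    rw [natDegree_pow] at h1; omega
  rw [eq_X_add_C_of_natDegree_le_one hd] at hg
  set b := (g 0).coeff 1
  set a := (g 0).coeff 0
  have e0 := congrArg (eval 0) hg
  have e1 := congrArg (eval 1) hg
  have e2 := congrArg (eval (-1)) hg
  simp at e0 e1 e2
  -- a² = (u-1)², ab = u+1, b² = 1
  have hab : 2 * (2 * (a * b)) = 2 * (2 * (u + 1)) := by linear_combination e1 - e2
  have hab' := mul_left_cancel₀ h2 (mul_left_cancel₀ h2 hab)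
  have hb : 2 * b ^ 2 = 2 * 1 := by linear_combination e1 + e2 - 2 * e0
  have hb' := mul_left_cancel₀ h2 hb
  have : 2 * (2 * u) = 0 := by
    linear_combination -(a * b + u + 1) * hab' + a ^ 2 * hb' + e0
  simp [h2, hu] at this

lemma exists_sq_of_mem_values (h2 : (2 : k) ≠ 0) {v f : k} (hv : AnisotropicDiagonal ![1, v])
    {A B : RatFunc k}
    (h : 1 + RatFunc.C (v * f) * RatFunc.X ^ 2 = A ^ 2 + RatFunc.C v * B ^ 2) :
    ∃ r : k, r ^ 2 = f := by
  obtain ⟨g, hg⟩ := hv.cassels_pfister_ratFunc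
    (p := 1 + C (v * f) * X ^ 2) (G := ![A, B]) (by simpa [Fin.sum_univ_succ] using h.symm)
  have hd := hv.natDegree_le (g := g) (m := 1) (by rw [hg]; compute_degree)
  simp only [Fin.sum_univ_two, Matrix.cons_val_zero, Matrix.cons_val_one, C_1, one_mul] at hg
  rw [eq_X_add_C_of_natDegree_le_one (hd 0), eq_X_add_C_of_natDegree_le_one (hd 1)] at hg
  set c1 := (g 0).coeff 1
  set c0 := (g 0).coeff 0
  set b1 := (g 1).coeff 1
  set b0 := (g 1).coeff 0
  have e0 := congrArg (eval 0) hg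
  have e1 := congrArg (eval 1) hg
  have e2 := congrArg (eval (-1)) hg
  simp at e0 e1 e2
  have hv0 : v ≠ 0 := by
    rintro rfl
    have := congrFun (hv ![0, 1] (by simp [Fin.sum_univ_succ])) 1
    simp at this
  have h1 : 2 * (2 * (c0 * c1 + v * (b0 * b1))) = 2 * (2 * 0) := by linear_combination e1 - e2
  have h1' := mul_left_cancel₀ h2 (mul_left_cancel₀ h2 h1)
  have h3 : 2 * (c1 ^ 2 + v * b1 ^ 2) = 2 * (v * f) := by linear_combination e1 + e2 - 2 * e0
  have h3' := mul_left_cancel₀ h2 h3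
  refine ⟨c0 * b1 - b0 * c1, mul_left_cancel₀ hv0 ?_⟩
  linear_combination (c0 ^ 2 + v * b0 ^ 2) * h3' + (v * f) * e0
    - (c0 * c1 + v * (b0 * b1)) * h1'

lemma exists_values_of_quadratic (h2 : (2 : k) ≠ 0) {u v w : k}
    (ha : AnisotropicDiagonal ![1, u, v]) {A B D : RatFunc k}
    (h : RatFunc.C u * RatFunc.X ^ 2 + RatFunc.C w =
      A ^ 2 + RatFunc.C u * B ^ 2 + RatFunc.C v * D ^ 2) :
    ∃ a c : k, w = a ^ 2 + v * c ^ 2 := by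
  obtain ⟨g, hg⟩ := ha.cassels_pfister_ratFunc
    (p := C u * X ^ 2 + C w) (G := ![A, B, D]) (by simp [h, Fin.sum_univ_succ, add_assoc])
  have hd := ha.natDegree_le (g := g) (m := 1) (by rw [hg]; compute_degree)
  simp only [Fin.sum_univ_three, Matrix.cons_val_zero, Matrix.cons_val_one, Matrix.cons_val_two,
    C_1, one_mul] at hg
  have key : ∀ c : k, (g 1).eval c ^ 2 = c ^ 2 → ∃ a c : k, w = a ^ 2 + v * c ^ 2 := by
    intro c hc
    have e := congrArg (eval c) hg
    simp at e
    exact ⟨(g 0).eval c, (g 2).eval c, by linear_combination -e + u * hc⟩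
  have h1 := eq_X_add_C_of_natDegree_le_one (hd 1)
  by_cases hb : 1 - (g 1).coeff 1 = 0
  · refine key (-(g 1).coeff 0 / 2) ?_
    rw [h1, ← sub_eq_zero.1 hb]
    simp
    field_simp
    ring
  · refine key ((g 1).coeff 0 / (1 - (g 1).coeff 1)) ?_
    rw [h1]
    simp
    field_simp
    ring

/-- Descent of isotropy from a quadratic extension `k(√(-vg))`. -/
lemma exists_values_of_isotropic_quadraticAlgebra (h2 : (2 : k) ≠ 0) {u v g : k}
    (ha : AnisotropicDiagonal ![1, u, v])
    (h : IsotropicTernary (1 : QuadraticAlgebra k (-(v * g)) 0) (algebraMap k _ u)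
      (algebraMap k _ v)) :
    ∃ A B C : k, u * g = A ^ 2 + u * B ^ 2 + v * C ^ 2 := by
  obtain ⟨⟨a0, a1⟩, ⟨b0, b1⟩, ⟨c0, c1⟩, h0, h⟩ := h
  have hre := congrArg QuadraticAlgebra.re h
  have him := congrArg QuadraticAlgebra.im h
  simp [sq] at hre him
  have hv0 : v ≠ 0 := by
    rintro rfl
    have := congrFun (ha ![0, 0, 1] (by simp [Fin.sum_univ_succ])) 2
    simp at this
  have hB : 2 * (a0 * a1 + u * (b0 * b1) + v * (c0 * c1)) = 2 * 0 := by linear_combination him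
  have hB' := mul_left_cancel₀ h2 hB
  have hzero : ∀ {a b c : k}, a ^ 2 + u * b ^ 2 + v * c ^ 2 = 0 → a = 0 ∧ b = 0 ∧ c = 0 := by
    intro a b c h
    have h1 := ha ![a, b, c] (by simpa [Fin.sum_univ_succ, add_assoc] using h)
    exact ⟨congrFun h1 0, congrFun h1 1, congrFun h1 2⟩
  have hN : a1 ^ 2 + u * b1 ^ 2 + v * c1 ^ 2 ≠ 0 := by
    intro hN
    obtain ⟨rfl, rfl, rfl⟩ := hzero hN
    obtain ⟨rfl, rfl, rfl⟩ := hzero (a := a0) (b := b0) (c := c0) (by linear_combination hre)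
    simp [QuadraticAlgebra.ext_iff] at h0
  obtain ⟨N, hNdef⟩ : ∃ N, N = a1 ^ 2 + u * b1 ^ 2 + v * c1 ^ 2 := ⟨_, rfl⟩
  rw [← hNdef] at hN
  refine ⟨u * (b0 * c1 - c0 * b1) / N, (c0 * a1 - a0 * c1) / N,
    u * (a0 * b1 - b0 * a1) / v / N, ?_⟩
  field_simp
  linear_combination (-u * (a1 ^ 2 + u * b1 ^ 2 + v * c1 ^ 2)) * hre
    + u * (a0 * a1 + u * (b0 * b1) + v * (c0 * c1)) * hB'
    + u * v * g * (N + a1 ^ 2 + u * b1 ^ 2 + v * c1 ^ 2) * hNdef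

end tower

section tower

open Polynomial

lemma exists_ratFunc_extension {R K : Type*} [CommRing R] [Field K] {f : R →+* K}
    (hf : Function.Injective f) :
    ∃ F : R[X] →+* RatFunc K, Function.Injective F ∧ (∀ r, F (C r) = RatFunc.C (f r)) ∧
      F X = RatFunc.X :=
  ⟨(algebraMap K[X] (RatFunc K)).comp (mapRingHom f),
    (RatFunc.algebraMap_injective K).comp (map_injective f hf), by simp, by simp⟩

lemma two_ne_zero_of_ringHom {k K : Type*} [Field k] [Field K] (f : k →+* K) (h : (2 : k) ≠ 0) :
    (2 : K) ≠ 0 := by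
  rw [← map_ofNat f 2]
  exact (_root_.map_ne_zero f).2 h

section

variable {κ K : Type*} [Field κ] [Field K]

/-- The substitution `q, x, y, z ↦ q, uz, vz, z` into `κ[u][v][z][q]`. -/
noncomputable def blowupHomOver {κ A : Type*} [CommRing κ] [CommRing A] (c : κ →+* A) (u v : A) :
    MvPolynomial (Fin 4) κ →+* A[X][X] :=
  MvPolynomial.eval₂Hom (C.comp (C.comp c)) ![X, C X * C (C u), C X * C (C v), C X]

/-- The substitution of `blowupHomOver` with polynomial coefficients over a field. -/
noncomputable def blowupHom (κ : Type*) [CommRing κ] : MvPolynomial (Fin 4) κ →+* κ[X][X][X][X] :=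
  blowupHomOver (A := κ[X][X]) (C.comp C) (C X) X

lemma blowupHom_injective (κ : Type*) [Field κ] : Function.Injective (blowupHom κ) := by
  let P := MvPolynomial (Fin 4) κ
  let j : P →+* FractionRing P := algebraMap P (FractionRing P)
  let q := j (MvPolynomial.X 0)
  let x := j (MvPolynomial.X 1)
  let y := j (MvPolynomial.X 2)
  let z := j (MvPolynomial.X 3)
  let θ1 := eval₂RingHom (j.comp MvPolynomial.C) (x / z)
  let θ2 := eval₂RingHom θ1 (y / z)
  let θ3 := eval₂RingHom θ2 z
  let θ4 := eval₂RingHom θ3 q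
  have hz : z ≠ 0 := by
    simp [z, j, P]
  have hψ : θ4.comp (blowupHom κ) = j := by
    apply MvPolynomial.ringHom_ext
    · intro r; simp [blowupHom, blowupHomOver, θ4, θ3, θ2, θ1]
    · intro i
      fin_cases i
      · simp [blowupHom, blowupHomOver, θ4, q]
      · simp [blowupHom, blowupHomOver, θ4, θ3, θ2, θ1]
        exact mul_div_cancel₀ _ hz
      · simp [blowupHom, blowupHomOver, θ4, θ3, θ2]
        exact mul_div_cancel₀ _ hz
      · simp [blowupHom, blowupHomOver, θ4, θ3, z]
  have : Function.Injective (θ4.comp (blowupHom κ)) := by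
    rw [hψ]; exact IsFractionRing.injective P (FractionRing P)
  exact Function.Injective.of_comp this

end

section

variable {k : Type*} [Field k] {u v f : k}

lemma quadratic_ne_neg_sq (ha : AnisotropicDiagonal ![1, u, v]) (w : RatFunc k)
    (r : RatFunc (RatFunc k)) :
    r ^ 2 ≠ -(RatFunc.C (RatFunc.C v) * (RatFunc.X ^ 2 + RatFunc.C w)) := by
  intro hr
  obtain ⟨h, hh⟩ := (AnisotropicDiagonal.one (k := RatFunc k)).cassels_pfister_ratFunc
    (p := C (-RatFunc.C v) * X ^ 2 + C (-(RatFunc.C v * w)))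
    (G := ![r]) (by simp [hr]; ring)
  have hd := AnisotropicDiagonal.one.natDegree_le (g := h) (m := 1) (by rw [hh]; compute_degree)
  simp only [Fin.sum_univ_one, Matrix.cons_val_fin_one, C_1, one_mul] at hh
  have hc := congrArg (coeff · 2) hh
  rw [eq_X_add_C_of_natDegree_le_one (hd 0)] at hc
  refine ha.ratFunc_three.ne_sq ((h 0).coeff 1) ?_
  have e : (C ((h 0).coeff 1) * X + C ((h 0).coeff 0)) ^ 2 =
    C ((h 0).coeff 1 ^ 2) * X ^ 2 + C (2 * (h 0).coeff 1 * (h 0).coeff 0) * X ^ 1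
     + C ((h 0).coeff 0 ^ 2) := by simp only [map_mul, map_pow, map_ofNat]; ring
  rw [e] at hc
  simp only [coeff_add, coeff_C_mul_X_pow, coeff_C] at hc
  simpa using hc

lemma QuadraticAlgebra.not_isotropicTernary (h2 : (2 : k) ≠ 0)
    (ha : AnisotropicDiagonal ![1, u, v]) (hf : ∀ r, r ^ 2 ≠ f) :
    ¬ IsotropicTernary (1 : QuadraticAlgebra (RatFunc (RatFunc k))
        (-(RatFunc.C (RatFunc.C v) * (RatFunc.X ^ 2 +
          RatFunc.C (RatFunc.C u + RatFunc.C (u * (v * f)) * RatFunc.X ^ 2)))) 0)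
      (algebraMap _ _ (RatFunc.C (RatFunc.C u))) (algebraMap _ _ (RatFunc.C (RatFunc.C v))) := by
  intro hiso
  have a3 := ha.ratFunc_three
  have a4 := a3.ratFunc_three
  have t3 : (2 : RatFunc k) ≠ 0 := two_ne_zero_of_ringHom RatFunc.C h2
  have t4 : (2 : RatFunc (RatFunc k)) ≠ 0 := two_ne_zero_of_ringHom RatFunc.C t3
  have hu : RatFunc.C u ≠ 0 := by
    rw [_root_.map_ne_zero]
    rintro rfl
    simpa using congrFun (ha ![0, 1, 0] (by simp [Fin.sum_univ_succ])) 1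
  obtain ⟨A, B, D, h⟩ := exists_values_of_isotropic_quadraticAlgebra t4 a4 hiso
  obtain ⟨a, c, h⟩ := exists_values_of_quadratic t3
    (w := RatFunc.C u ^ 2 + RatFunc.C (u ^ 2 * (v * f)) * RatFunc.X ^ 2)
    a3 (A := A) (B := B) (D := D) (by
      rw [← h]; simp only [map_add, map_mul, map_pow]; ring)
  obtain ⟨r, hr⟩ := exists_sq_of_mem_values h2 (v := v) (f := f) ha.skip
    (A := a / RatFunc.C u) (B := c / RatFunc.C u) (by
      field_simp
      simp only [map_mul, map_pow] at h ⊢; linear_combination h)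
  exact hf r hr

end

open MvPolynomial in
lemma exists_field_not_isotropicTernary_of_quadraticAlgebra {κ L : Type} [Field κ] [Field L]
    (h2 : (2 : L) ≠ 0) {φ : MvPolynomial (Fin 4) κ →+* L} (hφ : Function.Injective φ) {u v z g : L}
    (hz : z ≠ 0) (x1 : φ (X 1) = z * u) (x2 : φ (X 2) = z * v) (x3 : φ (X 3) = z)
    (hg : g = φ (X 0) ^ 2 + (u + u * (v * ((v + u + 1) ^ 2 - 4 * u)) * z ^ 2))
    (hns : ∀ r, r ^ 2 ≠ -(v * g))
    (hiso : ¬ IsotropicTernary (1 : QuadraticAlgebra L (-(v * g)) 0) (algebraMap _ _ u)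
      (algebraMap _ _ v)) (e : ℕ) :
    ∃ (Λ : Type) (_ : Field Λ) (φ : MvPolynomial (Fin 4) κ →+* Λ) (τ : Λ),
      (∀ a b, φ a + φ b * τ = 0 → a = 0 ∧ b = 0) ∧
      τ ^ 2 = φ (-4 * (X 2 * X 3 ^ (e + 1)) * (X 3 ^ e * (X 1 * X 3 + X 3 ^ 2 * X 0 ^ 2 +
        X 1 * X 2 * ((X 1 + X 2 + X 3) ^ 2 - 4 * X 1 * X 3)))) ∧
      ¬ IsotropicTernary (φ (X 1)) (φ (X 2)) (φ (X 3)) := by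
  obtain ⟨c, hc⟩ : ∃ c, c = 2 * z ^ (e + 2) := ⟨_, rfl⟩
  have hc0 : c ≠ 0 := by rw [hc]; exact mul_ne_zero h2 (pow_ne_zero _ hz)
  have : Fact (∀ r, r ^ 2 ≠ -(v * g) + 0 * r) := ⟨fun r => by simpa using hns r⟩
  refine ⟨QuadraticAlgebra L (-(v * g)) 0, inferInstance,
    (algebraMap _ _).comp φ, algebraMap _ _ c * QuadraticAlgebra.omega, ?_, ?_, ?_⟩
  · intro a b h
    have h1 := congrArg QuadraticAlgebra.re h
    have h2 := congrArg QuadraticAlgebra.im h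
    simp [hc0] at h1 h2
    exact ⟨hφ (by simpa using h1), hφ (by simpa using h2)⟩
  · have hω : (QuadraticAlgebra.omega : QuadraticAlgebra L (-(v * g)) 0) ^ 2 =
        algebraMap _ _ (-(v * g)) := by
      ext <;> simp [sq]
    rw [mul_pow, hω, ← map_pow, ← map_mul, RingHom.comp_apply]
    congr 1
    simp only [map_mul, map_add, map_sub, map_neg, map_pow, map_ofNat, x1, x2, x3, hg, hc]
    ring
  · intro h
    apply hiso
    simp only [RingHom.comp_apply, x1, x2, x3, map_mul] at h
    obtain ⟨A, B, C, h0, h⟩ := h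
    refine IsotropicTernary.mul_left (g := algebraMap _ _ z) (by simpa using hz)
      ⟨C, A, B, by tauto, ?_⟩
    linear_combination h

open MvPolynomial in
lemma exists_field_not_isotropicTernary_of_injective {κ K : Type} [Field κ] [Field K] [CharZero κ]
    {ι : κ[X][X] →+* K} (hι : Function.Injective ι)
    (ha : AnisotropicDiagonal ![1, ι (Polynomial.C Polynomial.X), ι Polynomial.X])
    (hf : ∀ r, r ^ 2 ≠ (ι Polynomial.X + ι (Polynomial.C Polynomial.X) + 1) ^ 2 -
      4 * ι (Polynomial.C Polynomial.X)) (e : ℕ) :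
    ∃ (Λ : Type) (_ : Field Λ) (φ : MvPolynomial (Fin 4) κ →+* Λ) (τ : Λ),
      (∀ a b, φ a + φ b * τ = 0 → a = 0 ∧ b = 0) ∧
      τ ^ 2 = φ (-4 * (X 2 * X 3 ^ (e + 1)) * (X 3 ^ e * (X 1 * X 3 + X 3 ^ 2 * X 0 ^ 2 +
        X 1 * X 2 * ((X 1 + X 2 + X 3) ^ 2 - 4 * X 1 * X 3)))) ∧
      ¬ IsotropicTernary (φ (X 1)) (φ (X 2)) (φ (X 3)) := by
  have t0 : (2 : K) ≠ 0 :=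
    two_ne_zero_of_ringHom (ι.comp (Polynomial.C.comp Polynomial.C)) (two_ne_zero (α := κ))
  have t2 : (2 : RatFunc (RatFunc K)) ≠ 0 :=
    two_ne_zero_of_ringHom RatFunc.C (two_ne_zero_of_ringHom RatFunc.C t0)
  obtain ⟨ι3, h3, hC3, hX3⟩ := exists_ratFunc_extension hι
  obtain ⟨ι4, h4, hC4, hX4⟩ := exists_ratFunc_extension h3
  refine exists_field_not_isotropicTernary_of_quadraticAlgebra t2
    (φ := ι4.comp (blowupHom κ)) (h4.comp (blowupHom_injective κ))
    (z := RatFunc.C RatFunc.X) (by simp [RatFunc.X_ne_zero]) ?_ ?_ ?_ ?_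
    (quadratic_ne_neg_sq ha _)
    (QuadraticAlgebra.not_isotropicTernary t0 ha hf) e
  · simp [blowupHom, blowupHomOver, hC4, hC3, hX3]
  · simp [blowupHom, blowupHomOver, hC4, hC3, hX3]
  · simp [blowupHom, blowupHomOver, hC4, hX3]
  · simp [blowupHom, blowupHomOver, hX4, map_ofNat]

lemma exists_ratFunc_injective {κ k : Type} [Field κ] [Field k] [CharZero κ]
    {ι : κ[X] →+* k} (hι : Function.Injective ι) (ha : AnisotropicDiagonal ![1, ι X]) :
    ∃ (K : Type) (_ : Field K) (F : κ[X][X] →+* K), Function.Injective F ∧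
      AnisotropicDiagonal ![1, F (C X), F X] ∧
      ∀ r, r ^ 2 ≠ (F X + F (C X) + 1) ^ 2 - 4 * F (C X) := by
  obtain ⟨F, hF, hC, hX⟩ := exists_ratFunc_extension hι
  refine ⟨RatFunc k, inferInstance, F, hF, ?_, fun r hr => ?_⟩
  · rw [hC, hX]
    exact ha.one_X
  · rw [hC, hX] at hr
    refine not_isSquare_discriminant (two_ne_zero_of_ringHom (ι.comp C) (two_ne_zero (α := κ)))
      ?_ r hr
    exact (map_ne_zero_iff ι hι).2 X_ne_zero

/-- A model of `κ(u, v)`. -/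
lemma exists_ratFunc_ratFunc (κ : Type) [Field κ] [CharZero κ] :
    ∃ (K : Type) (_ : Field K) (ι : κ[X][X] →+* K), Function.Injective ι ∧
      AnisotropicDiagonal ![1, ι (C X), ι X] ∧
      ∀ r, r ^ 2 ≠ (ι X + ι (C X) + 1) ^ 2 - 4 * ι (C X) := by
  obtain ⟨ι, h, -, hX⟩ := exists_ratFunc_extension (f := RingHom.id κ) Function.injective_id
  exact exists_ratFunc_injective h (hX ▸ AnisotropicDiagonal.one_X_two)

open MvPolynomial in
/-- The residual quadric surface bundle over `ℙ²` together with the non-isotropy of the ternary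
form `⟨x, y, z⟩` over its function field. -/
theorem exists_field_not_isotropicTernary (κ : Type) [Field κ] [CharZero κ] (e : ℕ) :
    ∃ (Λ : Type) (_ : Field Λ) (φ : MvPolynomial (Fin 4) κ →+* Λ) (τ : Λ),
      (∀ a b, φ a + φ b * τ = 0 → a = 0 ∧ b = 0) ∧
      τ ^ 2 = φ (-4 * (X 2 * X 3 ^ (e + 1)) * (X 3 ^ e * (X 1 * X 3 + X 3 ^ 2 * X 0 ^ 2 +
        X 1 * X 2 * ((X 1 + X 2 + X 3) ^ 2 - 4 * X 1 * X 3)))) ∧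
      ¬ IsotropicTernary (φ (X 1)) (φ (X 2)) (φ (X 3)) := by
  obtain ⟨K, _, ι, hι, ha, hf⟩ := exists_ratFunc_ratFunc κ
  exact exists_field_not_isotropicTernary_of_injective hι ha hf e

end tower

section

open Polynomial

section FanoForm

/-- The special form of degree `e + 4` with multiplicity `e + 2` along a plane. -/
noncomputable def specialForm (R : Type*) [CommRing R] (e : ℕ) : MvPolynomial (Fin 6) R :=
  .X 3 * .X 5 ^ (e + 1) * .X 0 ^ 2 + .X 4 * .X 5 ^ (e + 1) * .X 1 ^ 2 + .X 5 ^ (e + 2) * .X 2 ^ 2 +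
    .X 3 * .X 4 * .X 5 ^ e * ((.X 3 + .X 4 + .X 5) ^ 2 - 4 * .X 3 * .X 5)

lemma map_specialForm {R S : Type*} [CommRing R] [CommRing S] (φ : R →+* S) (e : ℕ) :
    MvPolynomial.map φ (specialForm R e) = specialForm S e := by
  simp [specialForm, map_ofNat]

lemma MvPolynomial.eval₂_mul_of_isHomogeneous {R S σ : Type*} [CommRing R] [CommRing S]
    {F : MvPolynomial σ R} {D : ℕ} (hF : F.IsHomogeneous D) (φ : R →+* S) (t : S) (g : σ → S) :
    F.eval₂ φ (fun i => t * g i) = t ^ D * F.eval₂ φ g := by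
  rw [MvPolynomial.eval₂_eq, MvPolynomial.eval₂_eq, Finset.mul_sum]
  refine Finset.sum_congr rfl fun m hm => ?_
  have : ∑ i ∈ m.support, m i = D := by
    have := hF (MvPolynomial.mem_support_iff.1 hm)
    rwa [Finsupp.weight_apply, Finsupp.sum, Finset.sum_congr rfl fun i _ => by
      rw [Pi.one_apply, smul_eq_mul, mul_one]] at this
  rw [← this, ← Finset.prod_pow_eq_pow_sum]
  simp only [mul_pow, Finset.prod_mul_distrib]
  ring

/-- The substitution rescaling the normal coordinates of the plane. -/
noncomputable def blowupVars (R : Type*) [CommRing R] : Fin 6 → MvPolynomial (Fin 7) R :=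
  ![.X 0, .X 1, .X 2, .X 3 * .X 4, .X 3 * .X 5, .X 3 * .X 6]

lemma exists_bind_eq_pow_mul {R : Type*} [CommRing R] {F : MvPolynomial (Fin 6) R} {d : ℕ}
    (hF : ∀ m ∈ F.support, d ≤ m 3 + m 4 + m 5) :
    ∃ Φ : MvPolynomial (Fin 7) R, F.eval₂ MvPolynomial.C (blowupVars R) = .X 3 ^ d * Φ := by
  suffices (.X 3 ^ d : MvPolynomial (Fin 7) R) ∣ F.eval₂ MvPolynomial.C (blowupVars R) from this
  rw [MvPolynomial.eval₂_eq']
  refine Finset.dvd_sum fun m hm => Dvd.dvd.mul_left ?_ _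
  simp only [Fin.prod_univ_six]
  refine (pow_dvd_pow _ (hF m hm)).trans ⟨.X 0 ^ m 0 * .X 1 ^ m 1 * .X 2 ^ m 2 * .X 4 ^ m 3 *
    .X 5 ^ m 4 * .X 6 ^ m 5, ?_⟩
  simp [mul_pow, blowupVars]
  ring

lemma specialForm_relation_of_eval₂_eq_zero {R S T : Type*} [CommRing R] [CommRing S]
    [IsDomain S] [CommRing T] [IsDomain T] {F : MvPolynomial (Fin 6) R} {e : ℕ}
    (hF : ∀ m ∈ F.support, e + 2 ≤ m 3 + m 4 + m 5) (φ : R →+* S) (ρ : S →+* T)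
    (hF0 : MvPolynomial.map (ρ.comp φ) F = specialForm T e) {Z : Fin 4 → S} {b : Fin 3 → S}
    (hZ : Z 3 ≠ 0) (h : F.eval₂ φ ![Z 0, Z 1, Z 2, Z 3 * b 0, Z 3 * b 1, Z 3 * b 2] = 0) :
    ρ (b 2) ^ e * (ρ (b 0) * ρ (b 2) * ρ (Z 0) ^ 2 + ρ (b 1) * ρ (b 2) * ρ (Z 1) ^ 2 +
      ρ (b 2) ^ 2 * ρ (Z 2) ^ 2 + ρ (b 0) * ρ (b 1) *
      ((ρ (b 0) + ρ (b 1) + ρ (b 2)) ^ 2 - 4 * ρ (b 0) * ρ (b 2)) * ρ (Z 3) ^ 2) = 0 := by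
  obtain ⟨Φ, hΦ⟩ := exists_bind_eq_pow_mul hF
  let g : Fin 7 → S := ![Z 0, Z 1, Z 2, Z 3, b 0, b 1, b 2]
  have h1 : Φ.eval₂ φ g = 0 := by
    have h2 := congrArg (MvPolynomial.eval₂Hom φ g) hΦ
    rw [MvPolynomial.hom_eval₂, map_mul, map_pow] at h2
    have h3 : (MvPolynomial.eval₂Hom φ g).comp MvPolynomial.C = φ := by ext; simp
    have h4 : (fun i => MvPolynomial.eval₂Hom φ g (blowupVars R i)) =
        ![Z 0, Z 1, Z 2, Z 3 * b 0, Z 3 * b 1, Z 3 * b 2] := by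
      funext i; fin_cases i <;> simp [g, blowupVars]
    rw [h3, h4, h] at h2
    simpa [g, hZ] using h2.symm
  have h5 : MvPolynomial.map (ρ.comp φ) Φ = .X 4 * .X 6 ^ (e + 1) * .X 0 ^ 2 +
      .X 5 * .X 6 ^ (e + 1) * .X 1 ^ 2 + .X 6 ^ (e + 2) * .X 2 ^ 2 +
      .X 4 * .X 5 * .X 6 ^ e * ((.X 4 + .X 5 + .X 6) ^ 2 - 4 * .X 4 * .X 6) * .X 3 ^ 2 := by
    have h2 := congrArg (MvPolynomial.map (ρ.comp φ)) hΦ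
    rw [MvPolynomial.hom_eval₂, map_mul, map_pow, MvPolynomial.map_X] at h2
    have h3 : (MvPolynomial.map (σ := Fin 7) (ρ.comp φ)).comp MvPolynomial.C =
        MvPolynomial.C.comp (ρ.comp φ) := by ext; simp
    have h4 : (fun i => MvPolynomial.map (ρ.comp φ) (blowupVars R i)) = blowupVars T := by
      funext i; fin_cases i <;> simp [blowupVars]
    rw [h3, h4, ← MvPolynomial.eval₂_map, hF0] at h2
    apply mul_left_cancel₀ (pow_ne_zero (e + 2) (MvPolynomial.X_ne_zero (R := T) (3 : Fin 7)))
    rw [← h2]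
    simp [specialForm, blowupVars]
    ring
  have h6 := congrArg ρ h1
  rw [MvPolynomial.hom_eval₂, map_zero, MvPolynomial.eval₂_eq_eval_map, h5] at h6
  simp [g, map_ofNat] at h6
  linear_combination h6

end FanoForm

end

section

open Polynomial

section Reduction

variable {M Λ : Type*} [Field M] [Field Λ] {W : ValuationSubring M} {r : W →+* Λ}

lemma exists_map_subtype_eq {P : M[X]} (hP : ∀ j, W.valuation (P.coeff j) ≤ 1) :
    ∃ Q : W[X], Q.map W.subtype = P := by
  have : P ∈ Polynomial.lifts W.subtype := by
    rw [Polynomial.lifts_iff_coeff_lifts]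
    exact fun j => ⟨⟨P.coeff j, (W.valuation_le_one_iff _).1 (hP j)⟩, rfl⟩
  exact (Polynomial.mem_lifts _).1 this

lemma reduction_ne_zero {w : W} (hw : W.valuation w = 1) : r w ≠ 0 :=
  (((W.valuation_eq_one_iff w).2 hw).map r).ne_zero

lemma valuation_eq_one_of_reduction_ne_zero (hr : ∀ w : W, W.valuation w < 1 → r w = 0) {w : W}
    (hw : r w ≠ 0) : W.valuation w = 1 :=
  (W.valuation_le_one w).antisymm (not_lt.1 fun h => hw (hr w h))

lemma exists_primitive_scaling {n : ℕ} {P : Fin n → M[X]} (hP : ∃ i, P i ≠ 0) :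
    ∃ ν : M, ν ≠ 0 ∧ ∃ Q : Fin n → W[X], (∀ i, (Q i).map W.subtype = C ν * P i) ∧
      ∃ i, (Q i).map r ≠ 0 := by
  let N := Finset.univ.sup fun i => (P i).natDegree
  have hN (i) : (P i).natDegree ≤ N := Finset.le_sup (f := fun i => (P i).natDegree) (Finset.mem_univ i)
  let s : Finset (Fin n × ℕ) := Finset.univ ×ˢ Finset.range (N + 1)
  have hmem (i j) (h : (P i).coeff j ≠ 0) : (i, j) ∈ s := by
    simp only [s, Finset.mem_product, Finset.mem_univ, Finset.mem_range, true_and]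
    exact Nat.lt_succ_of_le ((le_natDegree_of_ne_zero h).trans (hN i))
  obtain ⟨i, hi⟩ := hP
  have hi' : (P i).coeff (P i).natDegree ≠ 0 := by simpa using hi
  obtain ⟨⟨i₀, j₀⟩, -, hmax⟩ := s.exists_max_image
    (fun ij => W.valuation ((P ij.1).coeff ij.2)) ⟨_, hmem _ _ hi'⟩
  have hmax' (i j) : W.valuation ((P i).coeff j) ≤ W.valuation ((P i₀).coeff j₀) := by
    by_cases h : (P i).coeff j = 0
    · simp [h]
    · exact hmax _ (hmem i j h)
  have h0 : (P i₀).coeff j₀ ≠ 0 := by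
    intro h
    have := hmax' i (P i).natDegree
    rw [h, map_zero, le_zero_iff, map_eq_zero] at this
    exact hi' this
  have hv0 : W.valuation ((P i₀).coeff j₀) ≠ 0 := by simpa using h0
  have hQ (i) : ∃ Q : W[X], Q.map W.subtype = C ((P i₀).coeff j₀)⁻¹ * P i := by
    refine exists_map_subtype_eq fun j => ?_
    rw [coeff_C_mul, map_mul, map_inv₀]
    exact inv_mul_le_one_of_le₀ (hmax' i j) zero_le
  choose Q hQ using hQ
  refine ⟨_, inv_ne_zero h0, Q, hQ, i₀, fun h => ?_⟩
  have h1 := congrArg (coeff · j₀) (hQ i₀)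
  simp only [coeff_map, coeff_C_mul, inv_mul_cancel₀ h0] at h1
  have h2 := congrArg (coeff · j₀) h
  rw [coeff_map, coeff_zero] at h2
  refine reduction_ne_zero ?_ h2
  rw [show (((Q i₀).coeff j₀ : W) : M) = 1 from h1, map_one]

variable (r) in
/-- The reduction of any primitive multiple of `u` defines an isotropic ternary form. -/
def ReducesToIsotropic (u : Fin 3 → M) : Prop :=
  ∀ (ν : M) (Q : Fin 3 → W), (∀ i, (Q i : M) = ν * u i) → (∃ i, r (Q i) ≠ 0) →
    IsotropicTernary (r (Q 0)) (r (Q 1)) (r (Q 2))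

lemma ReducesToIsotropic.of_normalized (hr : ∀ w : W, W.valuation w < 1 → r w = 0)
    {u : Fin 3 → M} {ν : M} {Q : Fin 3 → W} (hQ : ∀ i, (Q i : M) = ν * u i)
    (hne : ∃ i, r (Q i) ≠ 0) (h : IsotropicTernary (r (Q 0)) (r (Q 1)) (r (Q 2))) :
    ReducesToIsotropic r u := by
  intro ν' Q' hQ' ⟨i', hi'⟩
  obtain ⟨i, hi⟩ := hne
  have hν : ν ≠ 0 := by
    rintro rfl
    exact hi (by rw [show Q i = 0 from Subtype.ext (by simpa using hQ i), map_zero])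
  have e1 (l) : (Q' l : M) = ν' / ν * Q l := by
    rw [hQ, hQ', ← mul_assoc, div_mul_cancel₀ _ hν]
  have v1 := valuation_eq_one_of_reduction_ne_zero hr hi
  have v2 := valuation_eq_one_of_reduction_ne_zero hr hi'
  have ht : W.valuation (ν' / ν) = 1 := by
    apply le_antisymm
    · have := W.valuation_le_one (Q' i)
      rwa [e1, map_mul, v1, mul_one] at this
    · rw [e1, map_mul] at v2
      rw [← v2]
      exact mul_le_of_le_one_right' (W.valuation_le_one _)
  let t : W := ⟨ν' / ν, (W.valuation_le_one_iff _).1 ht.le⟩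
  have e2 (l) : r (Q' l) = r t * r (Q l) := by
    rw [← map_mul]; congr 1; exact Subtype.ext (e1 l)
  rw [e2, e2, e2]
  exact h.left_mul _

lemma exists_pfister_relation {R : Type*} [CommRing R] {F : MvPolynomial (Fin 6) R} {D e : ℕ}
    (hF : ∀ m ∈ F.support, e + 2 ≤ m 3 + m 4 + m 5) (hhom : F.IsHomogeneous D) (φ : R →+* W)
    (hF0 : MvPolynomial.map (r.comp φ) F = specialForm Λ e) {G b : Fin 3 → M[X]}
    (h : F.eval₂ (C.comp (W.subtype.comp φ)) ![G 0, G 1, G 2, b 0, b 1, b 2] = 0) {μ : M}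
    (hμ : μ ≠ 0) (a : M) {B : Fin 3 → W[X]}
    (hB : ∀ i, (B i).map W.subtype = C μ * (b i).comp (C a * X)) {x y z : Λ[X]}
    (hx : (B 0).map r = x) (hy : (B 1).map r = y) (hz : (B 2).map r = z) :
    ∃ A₁ A₂ A₃ A₄ : Λ[X], (A₁ ≠ 0 ∨ A₂ ≠ 0 ∨ A₃ ≠ 0 ∨ A₄ ≠ 0) ∧ (x * y * z ≠ 0 →
      x * A₁ ^ 2 + y * A₂ ^ 2 + z * A₃ ^ 2 + x * y * z * ((x + y + z) ^ 2 - 4 * x * z) * A₄ ^ 2 =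
        0) := by
  by_cases hz0 : z = 0
  · exact ⟨1, 0, 0, 0, by simp, by simp [hz0]⟩
  let P : Fin 4 → M[X] := ![(G 0).comp (C a * X), (G 1).comp (C a * X), (G 2).comp (C a * X),
    C μ⁻¹]
  obtain ⟨ν, hν, Z, hZ, i, hi⟩ := exists_primitive_scaling (r := r) (P := P) ⟨3, by simp [P, hμ]⟩
  have hinj : Function.Injective (mapRingHom W.subtype) :=
    Polynomial.map_injective _ Subtype.val_injective
  have hZ3 : Z 3 ≠ 0 := by
    intro h0
    have := hZ 3
    simp [h0, P, hμ, hν] at this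
  have hrel : F.eval₂ (C.comp φ) ![Z 0, Z 1, Z 2, Z 3 * B 0, Z 3 * B 1, Z 3 * B 2] = 0 := by
    apply hinj
    rw [MvPolynomial.hom_eval₂, map_zero]
    have e1 : (mapRingHom W.subtype).comp (C.comp φ) = C.comp (W.subtype.comp φ) := by
      ext; simp
    have e2 : (fun i => mapRingHom W.subtype
        ((![Z 0, Z 1, Z 2, Z 3 * B 0, Z 3 * B 1, Z 3 * B 2] : Fin 6 → W[X]) i)) =
        fun i => C ν * compRingHom (C a * X)
          ((![G 0, G 1, G 2, b 0, b 1, b 2] : Fin 6 → M[X]) i) := by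
      have hc : (C μ⁻¹ * C μ : M[X]) = 1 := by rw [← C_mul, inv_mul_cancel₀ hμ, C_1]
      funext i
      fin_cases i
      · simp [hZ, P]
      · simp [hZ, P]
      · simp [hZ, P]
      · simp [hZ, hB, P]; linear_combination C ν * (b 0).comp (C a * X) * hc
      · simp [hZ, hB, P]; linear_combination C ν * (b 1).comp (C a * X) * hc
      · simp [hZ, hB, P]; linear_combination C ν * (b 2).comp (C a * X) * hc
    have e3 : (compRingHom (C a * X)).comp (C.comp (W.subtype.comp φ)) =
        C.comp (W.subtype.comp φ) := by ext; simp
    rw [e1, e2, MvPolynomial.eval₂_mul_of_isHomogeneous hhom]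
    nth_rw 1 [← e3]
    rw [← MvPolynomial.hom_eval₂, h, map_zero, mul_zero]
  have hspec : MvPolynomial.map ((mapRingHom r).comp (C.comp φ)) F = specialForm Λ[X] e := by
    have e1 : (mapRingHom r).comp (C.comp φ) = C.comp (r.comp φ) := by ext; simp
    rw [e1, ← map_specialForm C, ← hF0, MvPolynomial.map_map]
  have key := specialForm_relation_of_eval₂_eq_zero hF (C.comp φ) (mapRingHom r) hspec hZ3 hrel
  simp only [coe_mapRingHom, hx, hy, hz] at key
  have key' := (mul_eq_zero.1 key).resolve_left (pow_ne_zero _ hz0)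
  refine ⟨z * (Z 0).map r, z * (Z 1).map r, z * (Z 2).map r, (Z 3).map r, ?_, fun _ => by
    linear_combination z * key'⟩
  fin_cases i
  · exact Or.inl (mul_ne_zero hz0 hi)
  · exact Or.inr (Or.inl (mul_ne_zero hz0 hi))
  · exact Or.inr (Or.inr (Or.inl (mul_ne_zero hz0 hi)))
  · exact Or.inr (Or.inr (Or.inr hi))

end Reduction

end

section

open Polynomial

lemma exists_newton_slope {Γ : Type*} [LinearOrderedCommGroupWithZero Γ] {V : ℕ → Γ} {k N : ℕ}
    (hkN : k < N) (hk : V k ≠ 0) (hN : V N ≠ 0)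
    (hVN : ∀ j > N, V j = 0)
    (hα : 0 < k → ∃ α, α ≠ 0 ∧ (∀ j, V j * α ^ j ≤ V k * α ^ k) ∧
      ∀ j > k, V j * α ^ j < V k * α ^ k)
    {Γ' : Set Γ} (hroot : ∀ j > k, V j ≠ 0 → ∃ ρ ∈ Γ', V j * ρ ^ (j - k) = V k) :
    ∃ α' ∈ Γ', α' ≠ 0 ∧ ∃ k' > k, k' ≤ N ∧ (∀ j < k, V j * α' ^ j < V k * α' ^ k) ∧
      (∀ j, V j * α' ^ j ≤ V k * α' ^ k) ∧ V k' * α' ^ k' = V k * α' ^ k ∧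
      ∀ j > k', V j * α' ^ j < V k * α' ^ k := by
  classical
  choose! ρ hρmem hρ using hroot
  let S := (Finset.Ioc k N).filter fun j => V j ≠ 0
  have hS (j) : j ∈ S ↔ (k < j ∧ j ≤ N) ∧ V j ≠ 0 := by simp [S]
  obtain ⟨j₀, hj₀, hmin⟩ := S.exists_min_image ρ ⟨N, (hS N).2 ⟨⟨hkN, le_rfl⟩, hN⟩⟩
  obtain ⟨⟨hkj₀, hj₀N⟩, hV₀⟩ := (hS j₀).1 hj₀
  have hρ0 (j) (hj : k < j) (h0 : V j ≠ 0) : ρ j ≠ 0 := by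
    intro h
    have := hρ j hj h0
    rw [h, zero_pow (by omega), mul_zero] at this
    exact hk this.symm
  set β := ρ j₀ with hβ
  have hβ0 : β ≠ 0 := hρ0 _ hkj₀ hV₀
  have split {j : ℕ} (hj : k < j) (γ : Γ) : V j * γ ^ j = V j * γ ^ (j - k) * γ ^ k := by
    rw [mul_assoc, ← pow_add, Nat.sub_add_cancel hj.le]
  have hlow : ∀ j < k, V j * β ^ j < V k * β ^ k := by
    intro j hj
    obtain ⟨α, hα0, hle, hlt⟩ := hα (by omega)
    have hαβ : α < β := by
      have h1 := hlt j₀ hkj₀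
      rw [split hkj₀, mul_lt_mul_iff_left₀ (zero_lt_iff.2 (pow_ne_zero _ hα0)), ← hρ j₀ hkj₀ hV₀,
        mul_lt_mul_iff_right₀ (zero_lt_iff.2 hV₀)] at h1
      exact lt_of_pow_lt_pow_left₀ _ zero_le h1
    obtain ⟨i, rfl⟩ := Nat.exists_eq_add_of_lt hj
    have h1 := hle j
    rw [add_assoc, pow_add, mul_comm (α ^ j), ← mul_assoc,
      mul_le_mul_iff_left₀ (zero_lt_iff.2 (pow_ne_zero _ hα0))] at h1
    rw [add_assoc, pow_add, mul_comm (β ^ j), ← mul_assoc,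
      mul_lt_mul_iff_left₀ (zero_lt_iff.2 (pow_ne_zero _ hβ0))]
    refine h1.trans_lt ?_
    exact (mul_lt_mul_iff_right₀ (zero_lt_iff.2 hk)).2 (pow_lt_pow_left₀ hαβ zero_le (by omega))
  have hpos : 0 < V k * β ^ k := zero_lt_iff.2 (mul_ne_zero hk (pow_ne_zero _ hβ0))
  have hle_N (j) (h0 : V j ≠ 0) : j ≤ N := not_lt.1 fun h => h0 (hVN j h)
  have hhigh : ∀ j, V j * β ^ j ≤ V k * β ^ k := by
    intro j
    rcases lt_trichotomy j k with h | rfl | h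
    · exact (hlow j h).le
    · exact le_rfl
    · by_cases h0 : V j = 0
      · rw [h0, zero_mul]; exact hpos.le
      · rw [split h, mul_le_mul_iff_left₀ (zero_lt_iff.2 (pow_ne_zero _ hβ0)), ← hρ j h h0]
        exact mul_le_mul_right (pow_le_pow_left₀ zero_le (hmin j ((hS j).2 ⟨⟨h, hle_N j h0⟩, h0⟩)) _) _
  let T := S.filter fun j => V j * β ^ j = V k * β ^ k
  have hT (j) : j ∈ T ↔ j ∈ S ∧ V j * β ^ j = V k * β ^ k := by simp [T]
  obtain ⟨k', hk', hmax⟩ := T.exists_max_image id ⟨j₀, (hT _).2 ⟨hj₀, by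
    rw [split hkj₀, hρ j₀ hkj₀ hV₀]⟩⟩
  obtain ⟨hk'S, hk'e⟩ := (hT _).1 hk'
  obtain ⟨⟨hk1, hk2⟩, hk3⟩ := (hS _).1 hk'S
  refine ⟨β, hρmem _ hkj₀ hV₀, hβ0, k', hk1, hk2, hlow, hhigh, hk'e, fun j hjk => ?_⟩
  refine lt_of_le_of_ne (hhigh j) fun he => ?_
  have hVj : V j ≠ 0 := by
    intro h0
    rw [h0, zero_mul] at he
    exact hpos.ne he
  exact absurd (hmax j ((hT j).2 ⟨(hS j).2 ⟨⟨hk1.trans hjk, hle_N j hVj⟩, hVj⟩, he⟩)) (not_le.2 hjk)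

section Newton

variable {k M Λ : Type*} [Field k] [IsAlgClosed k] [Field M] [Field Λ] [CharZero Λ]
  {W : ValuationSubring M} {r : W →+* Λ}

lemma exists_vector_valuation (W : ValuationSubring M) (u : Fin 3 → M) :
    ∃ V : W.ValueGroup, (∀ i, W.valuation (u i) ≤ V) ∧ ∃ i, W.valuation (u i) = V := by
  obtain ⟨i, -, hi⟩ := Finset.univ.exists_max_image (fun i => W.valuation (u i)) ⟨0, by simp⟩
  exact ⟨_, fun j => hi j (Finset.mem_univ j), i, rfl⟩

lemma exists_valuation_root {ι : k →+* M}
    (hv : ∀ m : M, m ≠ 0 → ∃ c : k, W.valuation (ι c) = W.valuation m) {g h : W.ValueGroup}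
    (hg : g ≠ 0) {n : ℕ} (hn : 0 < n) :
    ∃ ρ ∈ Set.range fun c => W.valuation (ι c), g * ρ ^ n = h := by
  obtain ⟨m, hm⟩ := W.valuation_surjective (g⁻¹ * h)
  have : ∃ c, W.valuation (ι c) = g⁻¹ * h := by
    by_cases h0 : m = 0
    · exact ⟨0, by rw [← hm, h0, map_zero, map_zero]⟩
    · rw [← hm]; exact hv m h0
  obtain ⟨c, hc⟩ := this
  obtain ⟨s, rfl⟩ := IsAlgClosed.exists_pow_nat_eq c hn
  exact ⟨_, ⟨s, rfl⟩, by simp only; rw [← map_pow, ← map_pow, hc, mul_inv_cancel_left₀ hg]⟩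

lemma reducesToIsotropic_step (hr : ∀ w : W, W.valuation w < 1 → r w = 0)
    (hi : IsSquare (-1 : Λ)) {R : Type*} [CommRing R] {F : MvPolynomial (Fin 6) R} {D e : ℕ}
    (hF : ∀ m ∈ F.support, e + 2 ≤ m 3 + m 4 + m 5) (hhom : F.IsHomogeneous D) (φ : R →+* W)
    (hF0 : MvPolynomial.map (r.comp φ) F = specialForm Λ e) {G b : Fin 3 → M[X]}
    (h : F.eval₂ (C.comp (W.subtype.comp φ)) ![G 0, G 1, G 2, b 0, b 1, b 2] = 0)
    {V : ℕ → W.ValueGroup} (hV : ∀ j i, W.valuation ((b i).coeff j) ≤ V j)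
    (hV' : ∀ j, ∃ i, W.valuation ((b i).coeff j) = V j) {a : M} (ha : a ≠ 0) {m n : ℕ}
    (hm : V m ≠ 0) (hlow : ∀ j < m, V j * W.valuation a ^ j < V m * W.valuation a ^ m)
    (hle : ∀ j, V j * W.valuation a ^ j ≤ V m * W.valuation a ^ m)
    (hmn : V n * W.valuation a ^ n = V m * W.valuation a ^ m)
    (hhigh : ∀ j > n, V j * W.valuation a ^ j < V m * W.valuation a ^ m)
    (hiso : ReducesToIsotropic r fun i => (b i).coeff m) :
    ReducesToIsotropic r fun i => (b i).coeff n := by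
  obtain ⟨μ, hμ⟩ := W.valuation_surjective (V m * W.valuation a ^ m)⁻¹
  have hva : W.valuation a ≠ 0 := by simpa using ha
  have hne : V m * W.valuation a ^ m ≠ 0 := mul_ne_zero hm (pow_ne_zero _ hva)
  have hμ0 : μ ≠ 0 := by
    rintro rfl
    rw [map_zero] at hμ
    exact inv_ne_zero hne hμ.symm
  have hcoeff (i j) : (C μ * (b i).comp (C a * X)).coeff j = μ * a ^ j * (b i).coeff j := by
    rw [coeff_C_mul, comp_C_mul_X_coeff]; ring
  have hval (i j) : W.valuation (μ * a ^ j * (b i).coeff j) ≤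
      (V m * W.valuation a ^ m)⁻¹ * (V j * W.valuation a ^ j) := by
    rw [map_mul, map_mul, hμ, map_pow, mul_assoc, mul_comm (_ ^ j)]
    gcongr
    exact hV j i
  have hB (i) : ∃ B : W[X], B.map W.subtype = C μ * (b i).comp (C a * X) := by
    refine exists_map_subtype_eq fun j => ?_
    rw [hcoeff]
    exact (hval i j).trans (inv_mul_le_one_of_le₀ (hle j) zero_le)
  choose B hB using hB
  have hBc (i j) : ((B i).coeff j : M) = μ * a ^ j * (b i).coeff j := by
    rw [← hcoeff, ← hB, coeff_map]; rfl
  have hzero (j) (hj : V j * W.valuation a ^ j < V m * W.valuation a ^ m) (i) :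
      ((B i).map r).coeff j = 0 := by
    rw [coeff_map]
    apply hr
    rw [hBc]
    refine (hval i j).trans_lt ?_
    rwa [inv_mul_lt_iff₀ (zero_lt_iff.2 hne), mul_one]
  have hnonzero (j) (hj : V j * W.valuation a ^ j = V m * W.valuation a ^ m) :
      ∃ i, r ((B i).coeff j) ≠ 0 := by
    obtain ⟨i, hi⟩ := hV' j
    refine ⟨i, reduction_ne_zero ?_⟩
    rw [hBc, map_mul, map_mul, hμ, map_pow, mul_assoc, mul_comm (_ ^ j), hi, hj,
      inv_mul_cancel₀ hne]
  obtain ⟨A₁, A₂, A₃, A₄, h0, hrel⟩ := exists_pfister_relation hF hhom φ hF0 h hμ0 a hB rfl rfl rfl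
  have hm' := hnonzero m rfl
  have hfin := isotropicTernary_coeff_of_isotropic hi h0 hrel (m := m) (N := n)
    (fun j hj => ⟨hzero j (hlow j hj) 0, hzero j (hlow j hj) 1, hzero j (hlow j hj) 2⟩)
    (by
      obtain ⟨i, hi⟩ := hm'
      simp only [coeff_map]
      fin_cases i
      · exact Or.inl hi
      · exact Or.inr (Or.inl hi)
      · exact Or.inr (Or.inr hi))
    (fun j hj => ⟨hzero j (hhigh j hj) 0, hzero j (hhigh j hj) 1, hzero j (hhigh j hj) 2⟩)
    (by
      simp only [coeff_map]
      exact hiso (μ * a ^ m) (fun i => (B i).coeff m) (fun i => hBc i m) hm')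
  simp only [coeff_map] at hfin
  exact .of_normalized hr (ν := μ * a ^ n) (Q := fun i => (B i).coeff n) (fun i => hBc i n)
    (hnonzero n hmn) hfin

lemma reducesToIsotropic_of_constants (hr : ∀ w : W, W.valuation w < 1 → r w = 0)
    (hi : IsSquare (-1 : Λ)) (ι : k →+* M) {c : Fin 3 → k} (hc : ∃ i, c i ≠ 0) :
    ReducesToIsotropic r fun i => ι (c i) := by
  obtain ⟨i₀, -, hmax⟩ := Finset.univ.exists_max_image (fun i => W.valuation (ι (c i)))
    ⟨0, by simp⟩
  have h0 : c i₀ ≠ 0 := by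
    obtain ⟨i, hi⟩ := hc
    intro h
    have := hmax i (Finset.mem_univ i)
    rw [h, map_zero, map_zero, le_zero_iff, map_eq_zero, map_eq_zero] at this
    exact hi this
  have h0' : ι (c i₀) ≠ 0 := by simpa using h0
  choose s hs using fun i => IsAlgClosed.exists_pow_nat_eq (c i / c i₀) (n := 2) two_pos
  have hs' (i) : ι (s i) ^ 2 = (ι (c i₀))⁻¹ * ι (c i) := by
    rw [← map_pow, hs, map_div₀, div_eq_inv_mul]
  have hle (i) : ι (s i) ∈ W := by
    rw [← W.valuation_le_one_iff, ← pow_le_one_iff_of_nonneg zero_le two_ne_zero, ← map_pow, hs',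
      map_mul, map_inv₀]
    exact inv_mul_le_one_of_le₀ (hmax i (Finset.mem_univ i)) zero_le
  let S : Fin 3 → W := fun i => ⟨ι (s i), hle i⟩
  refine .of_normalized hr (ν := (ι (c i₀))⁻¹) (Q := fun i => S i ^ 2) (fun i => hs' i)
    ⟨i₀, reduction_ne_zero ?_⟩ ?_
  · change W.valuation (ι (s i₀) ^ 2) = 1
    rw [hs', inv_mul_cancel₀ h0', map_one]
  · simp only [map_pow]
    obtain ⟨j, hj⟩ := hi
    by_cases h : r (S 0) = 0
    · exact .of_exists_mul_eq (Or.inl (by simp [h]))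
    · exact ⟨r (S 1), j * r (S 0), 0, Or.inr (Or.inl (mul_ne_zero (by rintro rfl; simp at hj) h)),
        by linear_combination - r (S 0) ^ 2 * r (S 1) ^ 2 * hj⟩

theorem reducesToIsotropic_of_relation {ι : k →+* M}
    (hv : ∀ m : M, m ≠ 0 → ∃ c : k, W.valuation (ι c) = W.valuation m)
    (hr : ∀ w : W, W.valuation w < 1 → r w = 0)
    (hi : IsSquare (-1 : Λ)) {R : Type*} [CommRing R] {F : MvPolynomial (Fin 6) R} {D e : ℕ}
    (hF : ∀ m ∈ F.support, e + 2 ≤ m 3 + m 4 + m 5) (hhom : F.IsHomogeneous D) (φ : R →+* W)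
    (hF0 : MvPolynomial.map (r.comp φ) F = specialForm Λ e) {G b : Fin 3 → M[X]}
    (h : F.eval₂ (C.comp (W.subtype.comp φ)) ![G 0, G 1, G 2, b 0, b 1, b 2] = 0)
    {N : ℕ} (hN : ∀ i, (b i).natDegree ≤ N) (hbN : ∃ i, (b i).coeff N ≠ 0) {c : Fin 3 → k}
    (hc : ∃ i, c i ≠ 0) (hb0 : ∀ i, (b i).coeff 0 = ι (c i)) :
    ReducesToIsotropic r fun i => (b i).coeff N := by
  choose V hV hV' using fun j => exists_vector_valuation W fun i => (b i).coeff j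
  have hV0 (j) : V j ≠ 0 ↔ ∃ i, (b i).coeff j ≠ 0 := by
    constructor
    · intro h
      obtain ⟨i, hi⟩ := hV' j
      exact ⟨i, fun h' => h (by rw [← hi, h', map_zero])⟩
    · rintro ⟨i, hi⟩ h0
      have := hV j i
      rw [h0, le_zero_iff, map_eq_zero] at this
      exact hi this
  have hVN : ∀ j > N, V j = 0 := by
    intro j hj
    by_contra hne
    obtain ⟨i, hi⟩ := (hV0 j).1 hne
    exact hi (coeff_eq_zero_of_natDegree_lt ((hN i).trans_lt hj))
  have main : ∀ l m, m + l = N → V m ≠ 0 → (0 < m → ∃ α, α ≠ 0 ∧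
      (∀ j, V j * α ^ j ≤ V m * α ^ m) ∧ ∀ j > m, V j * α ^ j < V m * α ^ m) →
      (ReducesToIsotropic r fun i => (b i).coeff m) →
      ReducesToIsotropic r fun i => (b i).coeff N := by
    intro l
    induction l using Nat.strong_induction_on with
    | _ l ih =>
      intro m hml hm hα hE
      rcases Nat.eq_zero_or_pos l with rfl | hl
      · simpa using hml ▸ hE
      obtain ⟨_, ⟨a, rfl⟩, ha, n, hmn, hnN, h1, h2, h3, h4⟩ := exists_newton_slope (k := m) (N := N)
        (by omega) hm ((hV0 N).2 hbN) hVN hα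
        (fun j hj h0 => exists_valuation_root hv h0 (Nat.sub_pos_of_lt hj))
      have ha0 : ι a ≠ 0 := by simpa using ha
      have hn0 : V n ≠ 0 := fun h0 => by
        rw [h0, zero_mul] at h3
        exact mul_ne_zero hm (pow_ne_zero m ha) h3.symm
      exact ih (N - n) (by omega) n (by omega) hn0 (fun _ => ⟨_, ha, by rwa [h3], by rwa [h3]⟩)
        (reducesToIsotropic_step hr hi hF hhom φ hF0 h hV hV' ha0 hm h1 h2 h3 h4 hE)
  refine main N 0 (zero_add N) ?_ (fun h => absurd h (lt_irrefl 0)) ?_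
  · obtain ⟨i, hi⟩ := hc
    exact (hV0 0).2 ⟨i, by rw [hb0]; simpa using hi⟩
  · simp only [hb0]
    exact reducesToIsotropic_of_constants hr hi ι hc

end Newton

end

section

open Polynomial

lemma Polynomial.coeff_taylor_of_natDegree_le {R : Type*} [CommRing R] {f : R[X]} {N : ℕ}
    (hf : f.natDegree ≤ N) (a : R) : (taylor a f).coeff N = f.coeff N := by
  rcases hf.eq_or_lt with h | h
  · rw [← h]; exact coeff_taylor_natDegree ..
  · rw [coeff_eq_zero_of_natDegree_lt h, coeff_eq_zero_of_natDegree_lt (by rwa [natDegree_taylor])]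

lemma MvPolynomial.eval₂_reflect {R M σ : Type*} [CommRing R] [Field M] {F : MvPolynomial σ R}
    {D : ℕ} (hF : F.IsHomogeneous D) (φ : R →+* M) {g : σ → M[X]} {N : ℕ}
    (hN : ∀ i, (g i).natDegree ≤ N) (h : F.eval₂ (Polynomial.C.comp φ) g = 0) :
    F.eval₂ (Polynomial.C.comp φ) (fun i => (g i).reflect N) = 0 := by
  let K := FractionRing M[X]
  let alg : M[X] →+* K := algebraMap M[X] K
  have hinj : Function.Injective alg := IsFractionRing.injective M[X] K
  let x : K := alg Polynomial.X
  have hx : x ≠ 0 := by simp [x, alg, K]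
  let θ : M[X] →+* K := Polynomial.eval₂RingHom (alg.comp Polynomial.C) x⁻¹
  have key (i) : alg ((g i).reflect N) = x ^ N * θ (g i) := by
    let _ : Invertible x⁻¹ := ⟨x, mul_inv_cancel₀ hx, inv_mul_cancel₀ hx⟩
    have h1 := Polynomial.eval₂_reflect_mul_pow (alg.comp Polynomial.C) x⁻¹ N (g i) (hN i)
    have h2 : Polynomial.eval₂ (alg.comp Polynomial.C) x ((g i).reflect N) =
        alg ((g i).reflect N) := by
      rw [← Polynomial.hom_eval₂, Polynomial.eval₂_C_X]
    change _ = x ^ N * Polynomial.eval₂ (alg.comp Polynomial.C) x⁻¹ (g i)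
    rw [← h1, ← h2]
    change _ = x ^ N * (Polynomial.eval₂ (alg.comp Polynomial.C) x _ * _)
    rw [mul_left_comm, ← mul_pow, mul_inv_cancel₀ hx, one_pow, mul_one]
  apply hinj
  have e : θ.comp (Polynomial.C.comp φ) = alg.comp (Polynomial.C.comp φ) := by ext; simp [θ]
  rw [MvPolynomial.hom_eval₂, map_zero]
  simp only [key]
  rw [MvPolynomial.eval₂_mul_of_isHomogeneous hF, ← e, ← MvPolynomial.hom_eval₂, h, map_zero,
    mul_zero]

section

variable {k M Λ : Type*} [Field k] [IsAlgClosed k] [Field M] [Field Λ] [CharZero Λ]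
  {W : ValuationSubring M} {r : W →+* Λ}

theorem isotropicTernary_of_parametrization {ι : k →+* M}
    (hv : ∀ m : M, m ≠ 0 → ∃ c : k, W.valuation (ι c) = W.valuation m)
    (hr : ∀ w : W, W.valuation w < 1 → r w = 0)
    (hi : IsSquare (-1 : Λ)) {R : Type*} [CommRing R] {F : MvPolynomial (Fin 6) R} {D e : ℕ}
    (hF : ∀ m ∈ F.support, e + 2 ≤ m 3 + m 4 + m 5) (hhom : F.IsHomogeneous D) (φ : R →+* W)
    (hF0 : MvPolynomial.map (r.comp φ) F = specialForm Λ e) {ψ : R →+* k}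
    (hψ : ι.comp ψ = W.subtype.comp φ) {n : ℕ} {P : Fin 6 → MvPolynomial (Fin n) k}
    (hP : F.eval₂ (MvPolynomial.C.comp ψ) P = 0) (ζ : Fin n → M) {l : M} (hl : l ≠ 0)
    {w₀ w₁ w₂ : W} (h₀ : (P 3).eval₂ ι ζ = l * w₀) (h₁ : (P 4).eval₂ ι ζ = l * w₁)
    (h₂ : (P 5).eval₂ ι ζ = l * w₂) : IsotropicTernary (r w₀) (r w₁) (r w₂) := by
  by_cases hr0 : r w₀ = 0
  · exact .of_exists_mul_eq (Or.inl hr0)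
  have hP3 : P 3 ≠ 0 := by
    intro h
    rw [h, MvPolynomial.eval₂_zero] at h₀
    have : w₀ = 0 := Subtype.ext ((mul_eq_zero.1 h₀.symm).resolve_left hl)
    exact hr0 (by rw [this, map_zero])
  obtain ⟨c, hc⟩ : ∃ c, (P 3).eval c ≠ 0 := by
    by_contra! h
    exact hP3 (MvPolynomial.funext fun x => by rw [h, map_zero])
  let θ : MvPolynomial (Fin n) k →+* M[X] :=
    MvPolynomial.eval₂Hom (C.comp ι) fun j => C (ζ j) + X * C (ι (c j) - ζ j)
  have hθ0 (p) : (θ p).coeff 0 = p.eval₂ ι ζ := by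
    have : (constantCoeff.comp θ) = MvPolynomial.eval₂Hom ι ζ := by
      ext <;> simp [θ]
    exact congrArg (fun f : _ →+* _ => f p) this
  have hθ1 (p) : (θ p).eval 1 = ι (p.eval c) := by
    have : ((evalRingHom 1).comp θ) = ι.comp (MvPolynomial.eval c) := by
      ext <;> simp [θ]
    exact congrArg (fun f : _ →+* _ => f p) this
  let N := Finset.univ.sup fun i => (θ (P i)).natDegree
  have hN (i) : (θ (P i)).natDegree ≤ N :=
    Finset.le_sup (f := fun i => (θ (P i)).natDegree) (Finset.mem_univ i)
  have hθF : F.eval₂ (C.comp (W.subtype.comp φ)) (fun i => θ (P i)) = 0 := by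
    have : θ.comp (MvPolynomial.C.comp ψ) = C.comp (W.subtype.comp φ) := by
      rw [← hψ]; ext; simp [θ]
    rw [← this, ← MvPolynomial.hom_eval₂, hP, map_zero]
  have hrefl := MvPolynomial.eval₂_reflect hhom (W.subtype.comp φ) hN hθF
  let H : Fin 6 → M[X] := fun i => taylor 1 ((θ (P i)).reflect N)
  have hdeg (i) : ((θ (P i)).reflect N).natDegree ≤ N :=
    (natDegree_reflect_le).trans (max_le le_rfl (hN i))
  have hH0 (i) : (H i).coeff 0 = ι ((P i).eval c) := by
    let _ : Invertible (1 : M) := invertibleOne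
    have h1 := eval₂_reflect_mul_pow (RingHom.id M) 1 N (θ (P i)) (hN i)
    rw [invOf_one, one_pow, mul_one] at h1
    rw [taylor_coeff_zero, ← hθ1]
    exact h1
  have hHN (i) : (H i).coeff N = (P i).eval₂ ι ζ := by
    rw [coeff_taylor_of_natDegree_le (hdeg i), coeff_reflect, ← hθ0]
    simp [revAt_le]
  have hHF : F.eval₂ (C.comp (W.subtype.comp φ)) H = 0 := by
    have := congrArg (compRingHom (X + C 1)) hrefl
    rw [MvPolynomial.hom_eval₂, map_zero] at this
    have e : (compRingHom (X + C 1)).comp (C.comp (W.subtype.comp φ)) =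
      C.comp (W.subtype.comp φ) := by ext; simp
    rwa [e] at this
  have hHF' : F.eval₂ (C.comp (W.subtype.comp φ)) ![H 0, H 1, H 2, H 3, H 4, H 5] = 0 := by
    convert hHF using 2
    funext i; fin_cases i <;> rfl
  have key := reducesToIsotropic_of_relation hv hr hi hF hhom φ hF0 (G := ![H 0, H 1, H 2])
    (b := ![H 3, H 4, H 5]) hHF' (N := N) (c := ![(P 3).eval c, (P 4).eval c, (P 5).eval c])
    (fun i => by fin_cases i <;> simp [H, natDegree_taylor, hdeg])
    ⟨0, by
      change (H 3).coeff N ≠ 0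
      rw [hHN, h₀]
      refine mul_ne_zero hl fun h => hr0 ?_
      rw [show w₀ = 0 from Subtype.ext h, map_zero]⟩
    ⟨0, hc⟩ (fun i => by fin_cases i <;> simp [hH0])
  refine key l⁻¹ ![w₀, w₁, w₂] (fun i => ?_) ⟨0, hr0⟩
  fin_cases i <;> simp [hHN, h₀, h₁, h₂, hl]

end

end

section GaussExtension

variable {k A S Λ : Type*} [Field k] [CommRing A] [CommRing S] [Field Λ] {O : ValuationSubring k}
  {ι : S →+* A} {r : S →+* Λ} {α : k →+* A}

lemma isDomain_of_scaling [Nontrivial A] (hι : Function.Injective ι)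
    (hs : ∀ a : A, a ≠ 0 → ∃ c : k, c ≠ 0 ∧ ∃ s : S, α c * a = ι s ∧ r s ≠ 0) : IsDomain A := by
  have : NoZeroDivisors A := ⟨fun {a b} hab => by
    by_contra! h
    obtain ⟨c, -, s, hcs, hrs⟩ := hs a h.1
    obtain ⟨c', -, s', hcs', hrs'⟩ := hs b h.2
    have h1 : ι (s * s') = ι 0 := by
      rw [map_mul, ← hcs, ← hcs', map_zero]
      linear_combination α c * α c' * hab
    have h2 := hι h1
    exact mul_ne_zero hrs hrs' (by rw [← map_mul, h2, map_zero])⟩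
  exact NoZeroDivisors.to_isDomain A

theorem exists_gauss_extension {M : Type*} [Field M] {j : A →+* M} (hj : Function.Injective j)
    (hfrac : ∀ m : M, ∃ a b : A, b ≠ 0 ∧ m = j a / j b)
    (hι : Function.Injective ι) {o : O →+* S} (ho : ∀ c : O, ι (o c) = α c)
    (hs : ∀ a : A, a ≠ 0 → ∃ c : k, c ≠ 0 ∧ ∃ s : S, α c * a = ι s ∧ r s ≠ 0) :
    ∃ (W : ValuationSubring M) (rW : W →+* Λ) (φ : S →+* W),
      (∀ s, (φ s : M) = j (ι s)) ∧ (∀ s, rW (φ s) = r s) ∧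
      (∀ w : W, W.valuation w < 1 → rW w = 0) ∧
      ∀ m : M, m ≠ 0 → ∃ c : k, W.valuation (j (α c)) = W.valuation m := by
  let i : S →+* M := j.comp ι
  have hi : Function.Injective i := hj.comp hι
  have hi0 {b : S} (hb : r b ≠ 0) : i b ≠ 0 := by
    rw [Ne, map_eq_zero_iff i hi]
    rintro rfl
    exact hb (map_zero r)
  have hα0 {c : k} (hc : c ≠ 0) : j (α c) ≠ 0 := by
    exact (map_ne_zero (j.comp α)).2 hc
  have hrep (m : M) (hm : m ≠ 0) : ∃ (c : k) (s t : S), c ≠ 0 ∧ r s ≠ 0 ∧ r t ≠ 0 ∧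
      m = j (α c) * (i s / i t) := by
    obtain ⟨a, b, hb, rfl⟩ := hfrac m
    have ha : a ≠ 0 := by rintro rfl; simp at hm
    obtain ⟨c, hc, s, hcs, hrs⟩ := hs a ha
    obtain ⟨c', hc', s', hcs', hrs'⟩ := hs b hb
    refine ⟨c' / c, s, s', div_ne_zero hc' hc, hrs, hrs', ?_⟩
    have hjb : j b ≠ 0 := by rwa [Ne, map_eq_zero_iff j hj]
    have h1 : i s = j (α c) * j a := by rw [← map_mul, hcs]; rfl
    have h2 : i s' = j (α c') * j b := by rw [← map_mul, hcs']; rfl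
    have h3 : j (α (c' / c)) = j (α c') / j (α c) := map_div₀ (j.comp α) c' c
    have := hα0 hc
    have := hα0 hc'
    rw [h1, h2, h3]
    field_simp
  let W : ValuationSubring M :=
    { carrier := {m | ∃ a b, r b ≠ 0 ∧ m = i a / i b}
      mul_mem' := by
        rintro _ _ ⟨a, b, hb, rfl⟩ ⟨a', b', hb', rfl⟩
        exact ⟨a * a', b * b', by simp [hb, hb'], by rw [map_mul, map_mul, div_mul_div_comm]⟩
      one_mem' := ⟨1, 1, by simp, by simp⟩
      add_mem' := by
        rintro _ _ ⟨a, b, hb, rfl⟩ ⟨a', b', hb', rfl⟩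
        exact ⟨a * b' + b * a', b * b', by simp [hb, hb'], by
          rw [map_mul, map_add, map_mul, map_mul, div_add_div _ _ (hi0 hb) (hi0 hb')]⟩
      zero_mem' := ⟨0, 1, by simp, by simp⟩
      neg_mem' := by
        rintro _ ⟨a, b, hb, rfl⟩
        exact ⟨-a, b, hb, by rw [map_neg, neg_div]⟩
      mem_or_inv_mem' := by
        intro m
        by_cases hm : m = 0
        · exact Or.inl ⟨0, 1, by simp, by simp [hm]⟩
        obtain ⟨c, s, t, hc, hrs, hrt, rfl⟩ := hrep m hm
        rcases O.mem_or_inv_mem c with h | h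
        · refine Or.inl ⟨o ⟨c, h⟩ * s, t, hrt, ?_⟩
          rw [map_mul, ← mul_div_assoc]
          congr 2
          exact congrArg j (ho ⟨c, h⟩).symm
        · refine Or.inr ⟨o ⟨c⁻¹, h⟩ * t, s, hrs, ?_⟩
          have : i (o ⟨c⁻¹, h⟩) = (j (α c))⁻¹ := by
            exact (congrArg j (ho ⟨c⁻¹, h⟩)).trans (map_inv₀ (j.comp α) c)
          rw [map_mul, this, mul_inv, inv_div, mul_div_assoc] }
  have hW (m : M) : m ∈ W ↔ ∃ a b, r b ≠ 0 ∧ m = i a / i b := Iff.rfl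
  choose a b hb hab using fun w : W => (hW w).1 w.2
  have key (w : W) (a' b' : S) (hb' : r b' ≠ 0) (h : (w : M) = i a' / i b') :
      r (a w) / r (b w) = r a' / r b' := by
    rw [hab w, div_eq_div_iff (hi0 (hb w)) (hi0 hb'), ← map_mul, ← map_mul] at h
    rw [div_eq_div_iff (hb w) hb', ← map_mul, ← map_mul, hi h]
  let rW : W →+* Λ :=
    { toFun := fun w => r (a w) / r (b w)
      map_one' := by rw [key 1 1 1 (by simp) (by simp)]; simp
      map_zero' := by rw [key 0 0 1 (by simp) (by simp)]; simp
      map_mul' := fun w w' => by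
        rw [key (w * w') (a w * a w') (b w * b w') (by simp [hb]) (by
          rw [map_mul, map_mul, ← div_mul_div_comm, ← hab, ← hab]; rfl), map_mul, map_mul,
          div_mul_div_comm]
      map_add' := fun w w' => by
        rw [key (w + w') (a w * b w' + b w * a w') (b w * b w') (by simp [hb]) (by
          rw [map_mul, map_add, map_mul, map_mul, ← div_add_div _ _ (hi0 (hb w)) (hi0 (hb w')),
            ← hab, ← hab]; rfl), map_mul, map_add, map_mul, map_mul,
          div_add_div _ _ (hb w) (hb w')] }
  have hval {s t : S} (hrs : r s ≠ 0) (hrt : r t ≠ 0) : W.valuation (i s / i t) = 1 := by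
    have h1 : i s / i t ∈ W := ⟨s, t, hrt, rfl⟩
    have h2 : (i s / i t)⁻¹ ∈ W := ⟨t, s, hrs, by rw [inv_div]⟩
    apply le_antisymm ((W.valuation_le_one_iff _).2 h1)
    have := (W.valuation_le_one_iff _).2 h2
    rwa [map_inv₀, inv_le_one₀ (zero_lt_iff.2 (by
      rw [Ne, map_eq_zero]; exact div_ne_zero (hi0 hrs) (hi0 hrt)))] at this
  let φ : S →+* W := i.codRestrict W.toSubring fun s => ⟨s, 1, by simp, by simp⟩
  refine ⟨W, rW, φ, fun s => rfl, fun s => ?_, fun w hw => ?_, fun m hm => ?_⟩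
  · change r (a (φ s)) / r (b (φ s)) = _
    rw [key (φ s) s 1 (by simp) (by simp only [map_one, div_one]; rfl), map_one, div_one]
  · change r (a w) / r (b w) = 0
    rw [div_eq_zero_iff]
    by_contra! h
    rw [hab w, hval h.1 h.2] at hw
    exact lt_irrefl _ hw
  · obtain ⟨c, s, t, hc, hrs, hrt, rfl⟩ := hrep m hm
    exact ⟨c, by rw [map_mul, hval hrs hrt, mul_one]⟩

end GaussExtension

section QuadraticExtension

/-- The ring homomorphism out of `R[ω]/(ω² - a)` determined by a square root of the image of `a`. -/
def QuadraticAlgebra.liftRingHom {R T : Type*} [CommRing R] [CommRing T] {a : R} (g : R →+* T)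
    (t : T) (h : t ^ 2 = g a) : QuadraticAlgebra R a 0 →+* T where
  toFun s := g s.re + g s.im * t
  map_one' := by simp [QuadraticAlgebra.re_one, QuadraticAlgebra.im_one]
  map_zero' := by simp
  map_add' x y := by simp only [QuadraticAlgebra.re_add, QuadraticAlgebra.im_add, map_add]; ring
  map_mul' x y := by
    simp only [QuadraticAlgebra.re_mul, QuadraticAlgebra.im_mul, map_add, map_mul, map_zero, ← h]
    ring

lemma QuadraticAlgebra.sq_mk_zero_one {R : Type*} [CommRing R] (a : R) :
    (⟨0, 1⟩ : QuadraticAlgebra R a 0) ^ 2 = algebraMap R _ a := by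
  refine QuadraticAlgebra.ext ?_ ?_ <;>
    simp [pow_two, QuadraticAlgebra.algebraMap_re, QuadraticAlgebra.algebraMap_im]

lemma QuadraticAlgebra.algebraMap_add_algebraMap_mul {R : Type*} [CommRing R] {a : R} (u v : R) :
    algebraMap R (QuadraticAlgebra R a 0) u + algebraMap R _ v * ⟨0, 1⟩ = ⟨u, v⟩ := by
  refine QuadraticAlgebra.ext ?_ ?_ <;>
    simp [QuadraticAlgebra.algebraMap_re, QuadraticAlgebra.algebraMap_im]

lemma QuadraticAlgebra.algebraMap_mul_mk {R : Type*} [CommRing R] {a : R} (c u v : R) :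
    algebraMap R (QuadraticAlgebra R a 0) c * ⟨u, v⟩ = ⟨c * u, c * v⟩ := by
  refine QuadraticAlgebra.ext ?_ ?_ <;>
    simp [QuadraticAlgebra.algebraMap_re, QuadraticAlgebra.algebraMap_im]

variable {k : Type*} [Field k] {O : ValuationSubring k}

lemma ValuationSubring.exists_scaling {ι : Type*} (s : Finset ι) (f : ι → k)
    (hf : ∃ i ∈ s, f i ≠ 0) :
    ∃ c : k, c ≠ 0 ∧ (∀ i ∈ s, c * f i ∈ O) ∧ ∃ i ∈ s, ∃ h : c * f i ∈ O,
      IsUnit (⟨c * f i, h⟩ : O) := by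
  obtain ⟨i₀, hi₀, hfi₀⟩ := hf
  obtain ⟨i, hi, hmax⟩ := s.exists_max_image (fun i => O.valuation (f i)) ⟨i₀, hi₀⟩
  have hfi : f i ≠ 0 := by
    intro h
    have := hmax i₀ hi₀
    rw [h, map_zero, le_zero_iff, map_eq_zero] at this
    exact hfi₀ this
  refine ⟨(f i)⁻¹, inv_ne_zero hfi, fun l hl => ?_, i, hi, ?_⟩
  · rw [← ValuationSubring.valuation_le_one_iff, map_mul, map_inv₀]
    refine (mul_le_mul_right (hmax l hl) _).trans_eq ?_
    exact inv_mul_cancel₀ ((map_ne_zero _).2 hfi)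
  · have h1 : (f i)⁻¹ * f i = 1 := inv_mul_cancel₀ hfi
    refine ⟨h1 ▸ O.one_mem, ?_⟩
    have : (⟨(f i)⁻¹ * f i, h1 ▸ O.one_mem⟩ : O) = 1 := Subtype.ext h1
    rw [this]
    exact isUnit_one

variable {σ : Type*}

lemma MvPolynomial.exists_map_subtype_eq {p : MvPolynomial σ k} (h : ∀ m, p.coeff m ∈ O) :
    ∃ q : MvPolynomial σ O, MvPolynomial.map O.subtype q = p := by
  have : p ∈ Set.range (MvPolynomial.map (σ := σ) O.subtype) := by
    rw [MvPolynomial.mem_range_map_iff_coeffs_subset]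
    intro c hc
    obtain ⟨m, -, rfl⟩ := MvPolynomial.mem_coeffs_iff.1 hc
    exact ⟨⟨_, h m⟩, rfl⟩
  exact this

theorem exists_quadratic_gauss_extension {k κ Λ σ : Type} [Field k] [Field κ] [Field Λ]
    {O : ValuationSubring k} (ρ : O →+* κ) (D : MvPolynomial σ O) (φ : MvPolynomial σ κ →+* Λ)
    (τ : Λ) (hτ : τ ^ 2 = φ (MvPolynomial.map ρ D))
    (hind : ∀ a b, φ a + φ b * τ = 0 → a = 0 ∧ b = 0) :
    ∃ (M : Type) (_ : Field M) (j : MvPolynomial σ k →+* M) (ω : M),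
      ω ^ 2 = j (MvPolynomial.map O.subtype D) ∧
      (∀ a b, j a + j b * ω = 0 → a = 0 ∧ b = 0) ∧
      ∃ (W : ValuationSubring M) (r : W →+* Λ) (φS : MvPolynomial σ O →+* W),
        (∀ s, (φS s : M) = j (MvPolynomial.map O.subtype s)) ∧
        (∀ s, r (φS s) = φ (MvPolynomial.map ρ s)) ∧
        (∀ w : W, W.valuation w < 1 → r w = 0) ∧
        ∀ m : M, m ≠ 0 → ∃ c : k, W.valuation (j (MvPolynomial.C c)) = W.valuation m := by
  let B := MvPolynomial σ k
  let D' : B := MvPolynomial.map O.subtype D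
  let A := QuadraticAlgebra B D' 0
  let S := QuadraticAlgebra (MvPolynomial σ O) D 0
  let ω : A := ⟨0, 1⟩
  have hω : ω ^ 2 = algebraMap B A D' := QuadraticAlgebra.sq_mk_zero_one D'
  let ι : S →+* A :=
    QuadraticAlgebra.liftRingHom ((algebraMap B A).comp (MvPolynomial.map O.subtype)) ω hω
  have hιmk (s : S) : ι s =
      ⟨MvPolynomial.map O.subtype s.re, MvPolynomial.map O.subtype s.im⟩ :=
    QuadraticAlgebra.algebraMap_add_algebraMap_mul (R := B) _ _
  have hιre (s : S) : (ι s).re = MvPolynomial.map O.subtype s.re :=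
    congrArg QuadraticAlgebra.re (hιmk s)
  have hιim (s : S) : (ι s).im = MvPolynomial.map O.subtype s.im :=
    congrArg QuadraticAlgebra.im (hιmk s)
  have hmap : Function.Injective (MvPolynomial.map (σ := σ) O.subtype) :=
    MvPolynomial.map_injective _ Subtype.val_injective
  have hι : Function.Injective ι := fun s t h => by
    refine QuadraticAlgebra.ext (hmap ?_) (hmap ?_)
    · rw [← hιre, h, hιre]
    · rw [← hιim, h, hιim]
  let r : S →+* Λ := QuadraticAlgebra.liftRingHom (φ.comp (MvPolynomial.map ρ)) τ hτ
  let α : k →+* A := (algebraMap B A).comp MvPolynomial.C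
  have hs (a : A) (ha : a ≠ 0) : ∃ c : k, c ≠ 0 ∧ ∃ s : S, α c * a = ι s ∧ r s ≠ 0 := by
    classical
    let f : (σ →₀ ℕ) ⊕ (σ →₀ ℕ) → k := Sum.elim (fun m => a.re.coeff m) (fun m => a.im.coeff m)
    obtain ⟨c, hc, hcO, i, hi, hiO, hunit⟩ := ValuationSubring.exists_scaling (O := O)
      (a.re.support.disjSum a.im.support) f (by
        by_contra! h
        refine ha (QuadraticAlgebra.ext ?_ ?_)
        · ext m
          by_contra hm
          exact hm (h (Sum.inl m) (by simpa using hm))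
        · ext m
          by_contra hm
          exact hm (h (Sum.inr m) (by simpa using hm)))
    have hO0 (x : σ →₀ ℕ) (p : B) (h : x ∉ p.support) : c * p.coeff x ∈ O := by
      rw [MvPolynomial.notMem_support_iff.1 h, mul_zero]; exact O.zero_mem
    obtain ⟨u, hu⟩ := MvPolynomial.exists_map_subtype_eq (O := O)
        (p := MvPolynomial.C c * a.re) fun m => by
      rw [MvPolynomial.coeff_C_mul]
      by_cases hm : m ∈ a.re.support
      · exact hcO (Sum.inl m) (by simpa using hm)
      · exact hO0 _ _ hm
    obtain ⟨v, hv⟩ := MvPolynomial.exists_map_subtype_eq (O := O)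
        (p := MvPolynomial.C c * a.im) fun m => by
      rw [MvPolynomial.coeff_C_mul]
      by_cases hm : m ∈ a.im.support
      · exact hcO (Sum.inr m) (by simpa using hm)
      · exact hO0 _ _ hm
    refine ⟨c, hc, ⟨u, v⟩, ?_, fun h0 => ?_⟩
    · rw [hιmk, hu, hv]
      exact QuadraticAlgebra.algebraMap_mul_mk (R := B) _ _ _
    · obtain ⟨h1, h2⟩ := hind _ _ h0
      have hne : ρ ⟨_, hiO⟩ ≠ 0 := (hunit.map ρ).ne_zero
      rcases i with m | m
      · apply hne
        have h3 := congrArg (MvPolynomial.coeff m) h1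
        rw [MvPolynomial.coeff_map, MvPolynomial.coeff_zero] at h3
        rw [← h3]
        congr 1
        apply Subtype.ext
        have := congrArg (MvPolynomial.coeff m) hu
        rw [MvPolynomial.coeff_map, MvPolynomial.coeff_C_mul] at this
        exact this.symm
      · apply hne
        have h3 := congrArg (MvPolynomial.coeff m) h2
        rw [MvPolynomial.coeff_map, MvPolynomial.coeff_zero] at h3
        rw [← h3]
        congr 1
        apply Subtype.ext
        have := congrArg (MvPolynomial.coeff m) hv
        rw [MvPolynomial.coeff_map, MvPolynomial.coeff_C_mul] at this
        exact this.symm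
  have : IsDomain A := isDomain_of_scaling hι hs
  let M := FractionRing A
  let j : A →+* M := algebraMap A M
  have hj : Function.Injective j := IsFractionRing.injective A M
  let o : O →+* S := (algebraMap (MvPolynomial σ O) S).comp MvPolynomial.C
  obtain ⟨W, rW, φW, h1, h2, h3, h4⟩ := exists_gauss_extension (O := O) (α := α) (o := o) hj
    (fun m => by
      obtain ⟨a, b, hb, rfl⟩ := IsFractionRing.div_surjective (A := A) m
      exact ⟨a, b, nonZeroDivisors.ne_zero hb, rfl⟩) hι
    (fun c => by
      rw [hιmk]
      refine QuadraticAlgebra.ext ?_ (map_zero _)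
      exact MvPolynomial.map_C _ _) hs
  refine ⟨M, inferInstance, j.comp (algebraMap B A), j ω, ?_, fun a b hab => ?_, W, rW,
    φW.comp (algebraMap (MvPolynomial σ O) S), fun s => ?_, fun s => ?_, h3, h4⟩
  · rw [← map_pow, hω]; rfl
  · have h5 : algebraMap B A a + algebraMap B A b * ω = 0 := hj (by
      rw [map_add, map_mul, map_zero]; exact hab)
    have h6 := (QuadraticAlgebra.algebraMap_add_algebraMap_mul (R := B) a b).symm.trans h5
    exact ⟨congrArg QuadraticAlgebra.re h6, congrArg QuadraticAlgebra.im h6⟩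
  · rw [RingHom.comp_apply, h1]
    rw [hιmk]
    exact congrArg j (QuadraticAlgebra.ext rfl (map_zero _))
  · rw [RingHom.comp_apply, h2]
    change φ (MvPolynomial.map ρ s) + φ (MvPolynomial.map ρ 0) * τ = _
    simp

end QuadraticExtension

section

open Polynomial

section QuadraticRoot

variable {B : Type*} [CommRing B]

lemma Polynomial.exists_pow_mul_eq_mul_add_of_natDegree_le_two {f : B[X]} (hf : f.natDegree ≤ 2)
    (g : B[X]) : ∃ (n : ℕ) (q : B[X]) (u v : B),
      C (f.coeff 2 ^ n) * g = q * f + C u * X + C v := by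
  have hf' : f = C (f.coeff 2) * X ^ 2 + C (f.coeff 1) * X + C (f.coeff 0) := by
    conv_lhs => rw [f.as_sum_range_C_mul_X_pow' (n := 3) (by omega)]
    simp [Finset.sum_range_succ]
    ring
  induction g using Polynomial.induction_on with
  | C a => exact ⟨0, 0, 0, a, by simp⟩
  | add g h hg hh =>
    obtain ⟨n, q, u, v, h1⟩ := hg
    obtain ⟨n', q', u', v', h2⟩ := hh
    refine ⟨n + n', C (f.coeff 2) ^ n' * q + C (f.coeff 2) ^ n * q',
      f.coeff 2 ^ n' * u + f.coeff 2 ^ n * u', f.coeff 2 ^ n' * v + f.coeff 2 ^ n * v', ?_⟩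
    simp only [map_pow, map_add, map_mul] at *
    linear_combination C (f.coeff 2) ^ n' * h1 + C (f.coeff 2) ^ n * h2
  | monomial m a ih =>
    obtain ⟨n, q, u, v, h1⟩ := ih
    refine ⟨n + 1, C (f.coeff 2) * q * X + C u, f.coeff 2 * v - u * f.coeff 1,
      - u * f.coeff 0, ?_⟩
    simp only [map_pow, map_add, map_mul, map_sub, map_neg] at *
    linear_combination C (f.coeff 2) * X * h1 - C u * hf'

variable [IsDomain B] {M : Type*} [Field M] {j : B →+* M} {ω : M}

theorem Polynomial.ker_eval₂_quadratic_root {f : B[X]} (hf : f.natDegree ≤ 2)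
    (hf2 : f.coeff 2 ≠ 0) (h2 : (2 : M) ≠ 0)
    (hω : ω ^ 2 = j (f.coeff 1 ^ 2 - 4 * f.coeff 2 * f.coeff 0))
    (hind : ∀ a b, j a + j b * ω = 0 → a = 0 ∧ b = 0) (hprime : (Ideal.span {f}).IsPrime) :
    RingHom.ker (eval₂RingHom j ((ω - j (f.coeff 1)) / (2 * j (f.coeff 2)))) = Ideal.span {f} := by
  have hj {b : B} (hb : b ≠ 0) : j b ≠ 0 := fun h => hb (hind b 0 (by simp [h])).1
  set t := (ω - j (f.coeff 1)) / (2 * j (f.coeff 2)) with ht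
  have htω : 2 * j (f.coeff 2) * t = ω - j (f.coeff 1) := by
    rw [ht]; have := hj hf2; field_simp
  have hf' : f = C (f.coeff 2) * X ^ 2 + C (f.coeff 1) * X + C (f.coeff 0) := by
    conv_lhs => rw [f.as_sum_range_C_mul_X_pow' (n := 3) (by omega)]
    simp [Finset.sum_range_succ]
    ring
  have hroot : eval₂RingHom j t f = 0 := by
    rw [hf']
    simp only [coe_eval₂RingHom, eval₂_add, eval₂_mul, eval₂_C, eval₂_X_pow, eval₂_X]
    have h4 : (4 * j (f.coeff 2)) ≠ 0 := by
      have := hj hf2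
      rw [show (4 : M) = 2 * 2 by norm_num]
      positivity
    apply mul_left_cancel₀ h4
    simp only [map_sub, map_mul, map_pow, map_ofNat] at hω
    linear_combination (2 * j (f.coeff 2) * t + ω + j (f.coeff 1)) * htω + hω
  refine le_antisymm (fun g hg => ?_) ?_
  · rw [RingHom.mem_ker] at hg
    obtain ⟨n, q, u, v, h⟩ := exists_pow_mul_eq_mul_add_of_natDegree_le_two hf g
    have h1 := congrArg (eval₂RingHom j t) h
    rw [map_add, map_add, map_mul, map_mul, hg, hroot, mul_zero, mul_zero, zero_add] at h1
    simp only [coe_eval₂RingHom, eval₂_mul, eval₂_C, eval₂_X] at h1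
    obtain ⟨h3, h4⟩ := hind (2 * f.coeff 2 * v - u * f.coeff 1) u (by
      simp only [map_sub, map_mul, map_ofNat]
      linear_combination -2 * j (f.coeff 2) * h1 - j u * htω)
    have hv : v = 0 := by
      rw [h4, zero_mul, sub_zero] at h3
      have h22 : (2 : B) ≠ 0 := by
        intro h0
        apply h2
        rw [← map_ofNat j 2, h0, map_zero]
      simpa [hf2, h22] using h3
    have h5 : C (f.coeff 2 ^ n) * g ∈ Ideal.span {f} :=
      Ideal.mem_span_singleton'.2 ⟨q, by rw [h, h4, hv]; simp⟩
    refine (hprime.mem_or_mem h5).resolve_left fun h6 => ?_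
    obtain ⟨p, hp⟩ := Ideal.mem_span_singleton.1 h6
    have hC : (C (f.coeff 2 ^ n) : B[X]) ≠ 0 := by simp [hf2]
    have hf0 : f ≠ 0 := by rintro rfl; simp at hf2
    have hp0 : p ≠ 0 := by rintro rfl; simp [hf2] at hp
    have h7 := congrArg natDegree hp
    rw [natDegree_C, natDegree_mul hf0 hp0] at h7
    exact hf2 (coeff_eq_zero_of_natDegree_lt (by omega))
  · rw [Ideal.span_singleton_le_iff_mem]
    exact hroot

end QuadraticRoot

end

section Specialization

lemma exists_specialization {L : Type} [Field L] [Infinite L] {n : ℕ}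
    (s : Finset (FractionRing (MvPolynomial (Fin n) L))) :
    ∃ (A : Type) (_ : CommRing A) (i : A →+* FractionRing (MvPolynomial (Fin n) L))
      (ev : A →+* L) (c : L →+* A), Function.Injective i ∧ (∀ x, ev (c x) = x) ∧
      (∀ x, i (c x) = algebraMap (MvPolynomial (Fin n) L) _ (MvPolynomial.C x)) ∧
      ∀ y ∈ s, ∃ a, i a = y := by
  let B := MvPolynomial (Fin n) L
  let E := FractionRing B
  obtain ⟨⟨h, hh⟩, hs⟩ := IsLocalization.exist_integer_multiples_of_finset (nonZeroDivisors B) s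
  have hh0 : h ≠ 0 := nonZeroDivisors.ne_zero hh
  obtain ⟨τ, hτ⟩ : ∃ τ : Fin n → L, MvPolynomial.eval τ h ≠ 0 := by
    by_contra! H
    exact hh0 (MvPolynomial.funext fun τ => by rw [H, map_zero])
  let A := Localization.Away h
  have hE : IsUnit (algebraMap B E h) := by
    rw [isUnit_iff_ne_zero, Ne, FaithfulSMul.algebraMap_eq_zero_iff]
    exact hh0
  let i : A →+* E := IsLocalization.Away.lift h hE
  have hi (b : B) : i (algebraMap B A b) = algebraMap B E b := IsLocalization.Away.lift_eq h hE b
  let ev : A →+* L := IsLocalization.Away.lift (g := MvPolynomial.eval τ) h (isUnit_iff_ne_zero.2 hτ)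
  have hev (b : B) : ev (algebraMap B A b) = MvPolynomial.eval τ b :=
    IsLocalization.Away.lift_eq h _ b
  have hu : IsUnit (algebraMap B A h) := IsLocalization.Away.algebraMap_isUnit h
  refine ⟨A, inferInstance, i, ev, (algebraMap B A).comp MvPolynomial.C, ?_, fun x => ?_,
    fun x => hi _, fun y hy => ?_⟩
  · rw [injective_iff_map_eq_zero]
    intro a ha
    obtain ⟨m, b, hb⟩ := IsLocalization.Away.surj h a
    have h1 := congrArg i hb
    rw [map_mul, ha, zero_mul, hi, eq_comm, FaithfulSMul.algebraMap_eq_zero_iff] at h1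
    rw [h1, map_zero] at hb
    exact ((hu.pow m).mul_left_eq_zero).1 hb
  · rw [RingHom.comp_apply, hev, MvPolynomial.eval_C]
  · obtain ⟨b, hb⟩ := hs y hy
    obtain ⟨v, hv⟩ := hu.exists_right_inv
    refine ⟨algebraMap B A b * v, hE.mul_left_cancel ?_⟩
    rw [← hi h, map_mul, mul_left_comm, ← map_mul i, hv, map_one, mul_one, hi, hi, hb]
    exact Algebra.smul_def ..

theorem exists_retract_of_isStablyRational {k L : Type} [Field k] [Field L] [Infinite L]
    {c : k →+* L} (h : IsStablyRationalFunctionField c) {N : ℕ} (x : Fin N → L) :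
    ∃ (n : ℕ) (P : Fin N → MvPolynomial (Fin n) k) (Q : MvPolynomial (Fin n) k) (ζ : Fin n → L),
      Q.eval₂ c ζ ≠ 0 ∧ (∀ i, Q.eval₂ c ζ * x i = (P i).eval₂ c ζ) ∧
      ∀ (D : ℕ) (F : MvPolynomial (Fin (N + 1)) k), F.IsHomogeneous D →
        F.eval₂ c (Fin.cons 1 x : Fin (N + 1) → L) = 0 →
        F.eval₂ MvPolynomial.C (Fin.cons Q P : Fin (N + 1) → MvPolynomial (Fin n) k) = 0 := by
  obtain ⟨m, n, e, he⟩ := h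
  let B := MvPolynomial (Fin n) k
  let K := FractionRing B
  let E := FractionRing (MvPolynomial (Fin m) L)
  let a : L →+* E := (algebraMap (MvPolynomial (Fin m) L) E).comp MvPolynomial.C
  let e' : E ≃+* K := e
  have he' (u : k) : e' (a (c u)) = algebraMap B K (MvPolynomial.C u) := congrArg (· u) he
  let y : Fin N → K := fun i => e' (a (x i))
  obtain ⟨⟨Q, hQ⟩, hQP⟩ := IsLocalization.exist_integer_multiples_of_finite (nonZeroDivisors B) y
  choose P hP using hQP
  replace hP (i) : algebraMap B K (P i) = algebraMap B K Q * y i :=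
    (hP i).trans (Algebra.smul_def ..)
  have hQ0 : Q ≠ 0 := nonZeroDivisors.ne_zero hQ
  have hK : Function.Injective (algebraMap B K) := IsFractionRing.injective B K
  let b : B →+* E := (e'.symm : K →+* E).comp (algebraMap B K)
  have hb (p : B) : b p = p.eval₂ (a.comp c) (fun j => b (.X j)) := by
    have : b = MvPolynomial.eval₂Hom (a.comp c) (fun j => b (.X j)) := by
      apply MvPolynomial.ringHom_ext
      · intro u
        simp only [MvPolynomial.eval₂Hom_C, RingHom.comp_apply]
        change e'.symm (algebraMap B K (MvPolynomial.C u)) = _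
        rw [← he', e'.symm_apply_apply]
      · simp
    exact congrArg (· p) this
  have hbQ : b Q ≠ 0 := by
    change e'.symm (algebraMap B K Q) ≠ 0
    rw [Ne, map_eq_zero_iff _ e'.symm.injective, map_eq_zero_iff _ hK]
    exact hQ0
  have hbx (i) : b Q * a (x i) = b (P i) := by
    change e'.symm (algebraMap B K Q) * a (x i) = e'.symm (algebraMap B K (P i))
    rw [hP, map_mul, e'.symm_apply_apply]
  classical
  obtain ⟨A, _, i, ev, cA, hi, hev, hic, hs⟩ := exists_specialization
    (insert (b Q)⁻¹ (Finset.univ.image fun j => b (.X j)))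
  obtain ⟨v, hv⟩ := hs _ (Finset.mem_insert_self ..)
  have hz (j) : ∃ z, i z = b (.X j) :=
    hs _ (Finset.mem_insert_of_mem (Finset.mem_image_of_mem _ (Finset.mem_univ j)))
  choose z hz using hz
  have hbA (p : B) : i (p.eval₂ (cA.comp c) z) = b p := by
    rw [hb, MvPolynomial.hom_eval₂]
    congr 1
    · ext u; exact hic _
    · funext j; exact hz j
  have hevA (p : B) : ev (p.eval₂ (cA.comp c) z) = p.eval₂ c (fun j => ev (z j)) := by
    rw [MvPolynomial.hom_eval₂]
    congr 1
    ext u; exact hev _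
  refine ⟨n, P, Q, fun j => ev (z j), ?_, fun j => ?_, fun D F hF hF0 => ?_⟩
  · have : Q.eval₂ (cA.comp c) z * v = 1 := hi (by
      rw [map_mul, hbA, hv, map_one, mul_inv_cancel₀ hbQ])
    have := congrArg ev this
    rw [map_mul, hevA, map_one] at this
    exact left_ne_zero_of_mul_eq_one this
  · have : Q.eval₂ (cA.comp c) z * cA (x j) = (P j).eval₂ (cA.comp c) z := hi (by
      rw [map_mul, hbA, hbA, hic, ← hbx]; rfl)
    have := congrArg ev this
    rwa [map_mul, hevA, hevA, hev] at this
  · apply hK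
    rw [MvPolynomial.hom_eval₂, map_zero]
    have h1 : (fun j => algebraMap B K ((Fin.cons Q P : Fin (N + 1) → B) j)) =
        fun j => algebraMap B K Q * e' (a ((Fin.cons 1 x : Fin (N + 1) → L) j)) := by
      funext j
      refine Fin.cases ?_ (fun j => ?_) j
      · simp
      · simp only [Fin.cons_succ, hP]; rfl
    rw [h1, MvPolynomial.eval₂_mul_of_isHomogeneous hF]
    have h2 := congrArg ((e' : E →+* K).comp a) hF0
    rw [MvPolynomial.hom_eval₂, map_zero] at h2
    have h3 : ((algebraMap B K).comp MvPolynomial.C) = ((e' : E →+* K).comp a).comp c := by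
      ext u; exact (he' u).symm
    rw [h3]
    exact mul_eq_zero_of_right _ h2

lemma isDomain_of_isStablyRational {k R : Type} [Field k] [CommRing R]
    {c : k →+* FractionRing R} (h : IsStablyRationalFunctionField c) : IsDomain R := by
  obtain ⟨m, n, e, -⟩ := h
  have h1 : Function.Injective (algebraMap R (FractionRing R)) :=
    IsLocalization.injective _ le_rfl
  have h2 : Function.Injective (algebraMap (MvPolynomial (Fin m) (FractionRing R))
      (FractionRing (MvPolynomial (Fin m) (FractionRing R)))) :=
    IsLocalization.injective _ le_rfl
  let f : R →+* ratFuncField k n := e.toRingHom.comp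
    ((algebraMap (MvPolynomial (Fin m) (FractionRing R)) _).comp
      ((MvPolynomial.C).comp (algebraMap R (FractionRing R))))
  have hf : Function.Injective f :=
    e.injective.comp (h2.comp ((MvPolynomial.C_injective _ _).comp h1))
  exact hf.isDomain f

end Specialization

section VeryGeneralSpecialization

open MvPolynomial in
theorem veryGeneral_of_forall_valuationSubring {σ : Type} {V : Submodule ℂ (MvPolynomial σ ℂ)}
    {F₀ : MvPolynomial σ ℂ} (hF₀ : F₀ ∈ V) (S : Finset (σ →₀ ℕ)) (hS : ∀ p ∈ V, p.support ⊆ S)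
    {Q : V → Prop}
    (H : ∀ (p : V) (O : ValuationSubring ℂ), (∀ q : ℚ, (q : ℂ) ∈ O) →
      (∀ m, O.valuation (coeff m p.1 - coeff m F₀) < 1) → Q p) : VeryGeneral Q := by
  let N := S.card
  let μ : Fin N → (σ →₀ ℕ) := fun i => (S.equivFin.symm i).1
  let t (p : V) (i : Fin N) : ℂ := coeff (μ i) p.1 - coeff (μ i) F₀
  let f (G : MvPolynomial (Fin N) ℚ) (p : V) : ℂ := eval₂ (algebraMap ℚ ℂ) (t p) G
  have hcount : {G : MvPolynomial (Fin N) ℚ | constantCoeff G ≠ 0}.Countable := by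
    have : Countable (MvPolynomial (Fin N) ℚ) :=
      (AddMonoidAlgebra.coeffEquiv (R := ℚ) (M := Fin N →₀ ℕ)).injective.countable
    exact Set.to_countable _
  refine ⟨f '' {G | constantCoeff G ≠ 0}, hcount.image f, ?_, fun p hp => ?_⟩
  · rintro _ ⟨G, hG, rfl⟩
    refine ⟨⟨N, fun i => (lcoeff ℂ (μ i)).comp V.subtype,
      G.eval₂ (C.comp (algebraMap ℚ ℂ)) (fun i => X i - C (coeff (μ i) F₀)), fun p => ?_⟩, ?_⟩
    · simp only [f]
      rw [hom_eval₂]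
      congr 1
      · ext; simp
      · funext i; simp [t]
    · intro h0
      apply hG
      have h1 := congrFun h0 ⟨F₀, hF₀⟩
      have h2 : t ⟨F₀, hF₀⟩ = 0 := by funext i; simp [t]
      simpa [f, h2] using h1
  · let φ : MvPolynomial (Fin N) ℚ →+* ℂ := eval₂Hom (algebraMap ℚ ℂ) (t p)
    let I : Ideal φ.range := (RingHom.ker (constantCoeff (R := ℚ) (σ := Fin N))).map φ.rangeRestrict
    have hmem (x : φ.range) : x ∈ I ↔ ∃ G, constantCoeff G = 0 ∧ φ.rangeRestrict G = x :=
      Ideal.mem_map_iff_of_surjective _ φ.rangeRestrict_surjective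
    have hI : I ≠ ⊤ := by
      rw [Ne, Ideal.eq_top_iff_one, hmem]
      rintro ⟨G, hG, hG1⟩
      refine hp _ ⟨G - 1, ?_, rfl⟩ ?_
      · simp [hG]
      · have : φ G = 1 := congrArg Subtype.val hG1
        change φ (G - 1) = 0
        rw [map_sub, this, map_one, sub_self]
    obtain ⟨O, hO, hIsub⟩ := Ideal.image_subset_nonunits_valuationSubring I hI
    refine H p O (fun q => hO ⟨C q, by simp [φ]⟩) fun m => ?_
    by_cases hm : m ∈ S
    · rw [← ValuationSubring.mem_nonunits_iff]
      apply hIsub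
      obtain ⟨i, hi⟩ : ∃ i, μ i = m := ⟨S.equivFin ⟨m, hm⟩, by simp [μ]⟩
      refine ⟨φ.rangeRestrict (X i), (hmem _).2 ⟨X i, by simp, rfl⟩, ?_⟩
      change φ (X i) = _
      simp [φ, t, hi]
    · have h1 : coeff m p.1 = 0 := notMem_support_iff.1 fun h => hm (hS _ p.2 h)
      have h2 : coeff m F₀ = 0 := notMem_support_iff.1 fun h => hm (hS _ hF₀ h)
      simp [h1, h2]

end VeryGeneralSpecialization

section

open Polynomial

section FormsAlongPlane

variable {R : Type*} [CommRing R]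

lemma le_normalDegree_mul {a b : ℕ} {p q : MvPolynomial (Fin 6) R}
    (hp : ∀ m ∈ p.support, a ≤ m 3 + m 4 + m 5) (hq : ∀ m ∈ q.support, b ≤ m 3 + m 4 + m 5) :
    ∀ m ∈ (p * q).support, a + b ≤ m 3 + m 4 + m 5 := by
  classical
  intro m hm
  obtain ⟨u, hu, v, hv, rfl⟩ := Finset.mem_add.1 (MvPolynomial.support_mul p q hm)
  have := hp u hu
  have := hq v hv
  simp only [Finsupp.add_apply]
  omega

lemma le_normalDegree_add {a : ℕ} {p q : MvPolynomial (Fin 6) R}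
    (hp : ∀ m ∈ p.support, a ≤ m 3 + m 4 + m 5) (hq : ∀ m ∈ q.support, a ≤ m 3 + m 4 + m 5) :
    ∀ m ∈ (p + q).support, a ≤ m 3 + m 4 + m 5 := by
  classical
  intro m hm
  rcases Finset.mem_union.1 (MvPolynomial.support_add hm) with h | h
  · exact hp m h
  · exact hq m h

lemma le_normalDegree_of_mem_pow {d : ℕ} {p : MvPolynomial (Fin 6) R}
    (hp : p ∈ (Ideal.span {.X 3, .X 4, .X 5} : Ideal (MvPolynomial (Fin 6) R)) ^ d) :
    ∀ m ∈ p.support, d ≤ m 3 + m 4 + m 5 := by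
  have h1 (q : MvPolynomial (Fin 6) R)
      (hq : q ∈ (Ideal.span {.X 3, .X 4, .X 5} : Ideal (MvPolynomial (Fin 6) R))) :
      ∀ m ∈ q.support, 1 ≤ m 3 + m 4 + m 5 := by
    induction hq using Submodule.span_induction with
    | mem x hx =>
      nontriviality R
      rcases hx with rfl | rfl | rfl <;>
      · intro m hm
        rw [MvPolynomial.support_X, Finset.mem_singleton] at hm
        simp [hm]
    | zero => simp
    | add x y _ _ hx hy => exact le_normalDegree_add hx hy
    | smul a x _ hx =>
      have := le_normalDegree_mul (p := a) (fun m _ => Nat.zero_le (m 3 + m 4 + m 5)) hx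
      simpa using this
  induction d generalizing p with
  | zero => exact fun m _ => Nat.zero_le _
  | succ d ih =>
    rw [pow_succ] at hp
    induction hp using Submodule.mul_induction_on' with
    | mem_mul_mem x hx y hy => exact le_normalDegree_mul (ih hx) (h1 y hy)
    | add x _ y _ hx hy => exact le_normalDegree_add hx hy

lemma isHomogeneous_specialForm (e : ℕ) : (specialForm R e).IsHomogeneous (e + 4) := by
  have hX (i : Fin 6) : (.X i : MvPolynomial (Fin 6) R).IsHomogeneous 1 :=
    MvPolynomial.isHomogeneous_X R i
  have hXp (i : Fin 6) (n : ℕ) : (.X i ^ n : MvPolynomial (Fin 6) R).IsHomogeneous n := by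
    simpa using (hX i).pow n
  have h4 : (4 : MvPolynomial (Fin 6) R).IsHomogeneous 0 := by
    have := MvPolynomial.isHomogeneous_C (Fin 6) (4 : R)
    rwa [map_ofNat] at this
  refine (((?_ : MvPolynomial.IsHomogeneous _ _).add ?_).add ?_).add ?_
  · convert ((hX 3).mul (hXp 5 (e + 1))).mul (hXp 0 2) using 1; ring
  · convert ((hX 4).mul (hXp 5 (e + 1))).mul (hXp 1 2) using 1; ring
  · exact (hXp 5 (e + 2)).mul (hXp 2 2)
  · convert (((hX 3).mul (hX 4)).mul (hXp 5 e)).mul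
      ((by simpa using (((hX 3).add (hX 4)).add (hX 5)).pow 2 :
        ((.X 3 + .X 4 + .X 5) ^ 2 : MvPolynomial (Fin 6) R).IsHomogeneous 2).sub
        ((h4.mul (hX 3)).mul (hX 5))) using 1; ring

lemma specialForm_mem_pow (e : ℕ) : specialForm R e ∈
    (Ideal.span {.X 3, .X 4, .X 5} : Ideal (MvPolynomial (Fin 6) R)) ^ (e + 2) := by
  set I : Ideal (MvPolynomial (Fin 6) R) := Ideal.span {.X 3, .X 4, .X 5}
  have h3 : .X 3 ∈ I := Ideal.subset_span (by simp)
  have h4 : .X 4 ∈ I := Ideal.subset_span (by simp)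
  have h5 : .X 5 ∈ I := Ideal.subset_span (by simp)
  refine add_mem (add_mem (add_mem ?_ ?_) ?_) ?_ <;> refine Ideal.mul_mem_right _ _ ?_
  · rw [show e + 2 = 1 + (e + 1) by ring, pow_add, pow_one]
    exact Ideal.mul_mem_mul h3 (I.pow_mem_pow h5 _)
  · rw [show e + 2 = 1 + (e + 1) by ring, pow_add, pow_one]
    exact Ideal.mul_mem_mul h4 (I.pow_mem_pow h5 _)
  · exact I.pow_mem_pow h5 _
  · rw [show e + 2 = 1 + 1 + e by ring, pow_add, pow_add, pow_one]
    exact Ideal.mul_mem_mul (Ideal.mul_mem_mul h3 h4) (I.pow_mem_pow h5 _)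

lemma MvPolynomial.IsHomogeneous.support_subset_finsuppAntidiag {σ : Type*} [Fintype σ]
    [DecidableEq σ] {p : MvPolynomial σ R} {n : ℕ} (hp : p.IsHomogeneous n) :
    p.support ⊆ Finset.univ.finsuppAntidiag n := by
  intro m hm
  rw [Finset.mem_finsuppAntidiag]
  refine ⟨?_, Finset.subset_univ _⟩
  have := hp (MvPolynomial.mem_support_iff.1 hm)
  rw [← this, Finsupp.weight_apply, Finsupp.sum_fintype _ _ (by simp)]
  simp

/-- Dehomogenization at `x₀ = 1`, as a polynomial in `x₁` over the ring in `x₂, …, x₅`. -/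
noncomputable def affineChart (R : Type*) [CommRing R] :
    MvPolynomial (Fin 6) R →+* (MvPolynomial (Fin 4) R)[X] :=
  MvPolynomial.eval₂Hom (C.comp MvPolynomial.C)
    ![1, X, C (.X 0), C (.X 1), C (.X 2), C (.X 3)]

lemma natDegree_affineChart_le {p : MvPolynomial (Fin 6) R} {d : ℕ} (hp : p.IsHomogeneous (d + 2))
    (h : ∀ m ∈ p.support, d ≤ m 3 + m 4 + m 5) : (affineChart R p).natDegree ≤ 2 := by
  rw [affineChart, MvPolynomial.coe_eval₂Hom, MvPolynomial.eval₂_eq']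
  refine natDegree_sum_le_of_forall_le _ _ fun m hm => ?_
  have h1 := h m hm
  have h2 := (Finset.mem_finsuppAntidiag.1 (hp.support_subset_finsuppAntidiag hm)).1
  rw [Fin.sum_univ_six] at h2
  simp only [Fin.prod_univ_six]
  have h3 : (C.comp MvPolynomial.C) (p.coeff m) *
      ((![1, X, C (.X 0), C (.X 1), C (.X 2), C (.X 3)] : Fin 6 → (MvPolynomial (Fin 4) R)[X]) 0
        ^ m 0 * X ^ m 1 * C (.X 0) ^ m 2 * C (.X 1) ^ m 3 * C (.X 2) ^ m 4 * C (.X 3) ^ m 5) =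
      C (MvPolynomial.C (p.coeff m) * .X 0 ^ m 2 * .X 1 ^ m 3 * .X 2 ^ m 4 * .X 3 ^ m 5) *
        X ^ m 1 := by
    simp
    ring
  refine (congrArg natDegree h3).trans_le ((natDegree_C_mul_X_pow_le _ _).trans ?_)
  omega

lemma map_affineChart {S : Type*} [CommRing S] (φ : R →+* S) (p : MvPolynomial (Fin 6) R) :
    (affineChart R p).map (MvPolynomial.map φ) = affineChart S (MvPolynomial.map φ p) := by
  have : (mapRingHom (MvPolynomial.map φ)).comp (affineChart R) =
      (affineChart S).comp (MvPolynomial.map φ) := by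
    apply MvPolynomial.ringHom_ext
    · simp [affineChart]
    · intro i; fin_cases i <;> simp [affineChart]
  exact congrArg (· p) this

lemma finSuccEquiv_dehomP5 (p : MvPolynomial (Fin 6) ℂ) :
    MvPolynomial.finSuccEquiv ℂ 4 (dehomP5 p) = affineChart ℂ p := by
  have : (MvPolynomial.finSuccEquiv ℂ 4 : MvPolynomial (Fin 5) ℂ →+* _).comp dehomP5 =
      affineChart ℂ := by
    apply MvPolynomial.ringHom_ext
    · simp [affineChart, dehomP5, MvPolynomial.finSuccEquiv_apply]
    · intro i
      have h (j : Fin 4) := MvPolynomial.finSuccEquiv_X_succ (R := ℂ) (j := j)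
      have h0 := MvPolynomial.finSuccEquiv_X_zero (R := ℂ) (n := 4)
      have h1 := h 0
      have h2 := h 1
      have h3 := h 2
      have h4 := h 3
      simp at h1 h2 h3 h4
      fin_cases i <;> simp [affineChart, dehomP5, *]
  exact congrArg (· p) this

lemma affineChart_specialForm (e : ℕ) : affineChart R (specialForm R e) =
    C (.X 2 * .X 3 ^ (e + 1)) * X ^ 2 +
      C (.X 3 ^ e * (.X 1 * .X 3 + .X 3 ^ 2 * .X 0 ^ 2 +
        .X 1 * .X 2 * ((.X 1 + .X 2 + .X 3) ^ 2 - 4 * .X 1 * .X 3))) := by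
  simp [affineChart, specialForm, map_ofNat]
  ring

end FormsAlongPlane

end

section

open Polynomial

section NonStablyRational

lemma charZero_residueField {k : Type*} [Field k] [CharZero k] {O : ValuationSubring k}
    (hO : ∀ q : ℚ, (q : k) ∈ O) : CharZero (IsLocalRing.ResidueField O) := by
  refine charZero_of_inj_zero fun n hn => ?_
  by_contra h0
  have hinv : ((n : k))⁻¹ ∈ O := by simpa using hO (n : ℚ)⁻¹
  have h1 : (n : O) * ⟨_, hinv⟩ = 1 := Subtype.ext (mul_inv_cancel₀ (Nat.cast_ne_zero.2 h0))
  have h2 := congrArg (IsLocalRing.residue O) h1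
  rw [map_mul, map_natCast, hn, zero_mul, map_one] at h2
  exact zero_ne_one h2

lemma exists_lift_of_valuation_sub_lt_one {k σ : Type*} [Field k] {O : ValuationSubring k}
    {p : MvPolynomial σ k} {q : MvPolynomial σ O}
    (h : ∀ m, O.valuation (p.coeff m - (MvPolynomial.map O.subtype q).coeff m) < 1) :
    ∃ p' : MvPolynomial σ O, MvPolynomial.map O.subtype p' = p ∧
      MvPolynomial.map (IsLocalRing.residue O) p' = MvPolynomial.map (IsLocalRing.residue O) q := by
  have hmem (m) : p.coeff m - (MvPolynomial.map O.subtype q).coeff m ∈ O :=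
    (O.valuation_le_one_iff _).1 (h m).le
  obtain ⟨p', hp'⟩ := MvPolynomial.exists_map_subtype_eq (O := O) (p := p) fun m => by
    have := O.add_mem _ _ (hmem m) (q.coeff m).2
    rw [MvPolynomial.coeff_map] at this
    simpa using this
  refine ⟨p', hp', ?_⟩
  ext m
  rw [MvPolynomial.coeff_map, MvPolynomial.coeff_map, ← sub_eq_zero, ← map_sub,
    IsLocalRing.residue_eq_zero_iff, ValuationSubring.valuation_lt_one_iff]
  have := h m
  rw [← hp', MvPolynomial.coeff_map, MvPolynomial.coeff_map] at this
  exact this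

/-- The function field of the affine chart embeds into any field containing a root of its
equation. -/
lemma exists_functionField_embedding {p : MvPolynomial (Fin 6) ℂ} [IsDomain (hyperP5ChartRing p)]
    (hdeg : (affineChart ℂ p).natDegree ≤ 2) (h2 : (affineChart ℂ p).coeff 2 ≠ 0)
    {M : Type} [Field M] {j : MvPolynomial (Fin 4) ℂ →+* M} {ω : M}
    (hω : ω ^ 2 = j ((affineChart ℂ p).coeff 1 ^ 2 -
      4 * (affineChart ℂ p).coeff 2 * (affineChart ℂ p).coeff 0))
    (hind : ∀ a b, j a + j b * ω = 0 → a = 0 ∧ b = 0) :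
    ∃ Ψ : FractionRing (hyperP5ChartRing p) →+* M,
      (∀ c : ℂ, Ψ (hyperP5FFMap p c) = j (MvPolynomial.C c)) ∧
      ∀ i : Fin 4, Ψ (algebraMap (hyperP5ChartRing p) _ (Ideal.Quotient.mk _ (.X i.succ))) =
        j (.X i) := by
  let E := MvPolynomial.finSuccEquiv ℂ 4
  have hprime : (Ideal.span {dehomP5 p}).IsPrime :=
    (Ideal.Quotient.isDomain_iff_prime _).1 (inferInstanceAs (IsDomain (hyperP5ChartRing p)))
  have hprime' : (Ideal.span {affineChart ℂ p}).IsPrime := by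
    have := Ideal.map_isPrime_of_equiv E (I := Ideal.span {dehomP5 p})
    rwa [Ideal.map_span, Set.image_singleton, finSuccEquiv_dehomP5] at this
  have hchar : (2 : M) ≠ 0 := two_ne_zero_of_ringHom (j.comp MvPolynomial.C) (two_ne_zero' ℂ)
  have hker := Polynomial.ker_eval₂_quadratic_root hdeg h2 hchar hω hind hprime'
  set Θ := eval₂RingHom j ((ω - j ((affineChart ℂ p).coeff 1)) / (2 * j ((affineChart ℂ p).coeff 2)))
  let Θ' : MvPolynomial (Fin 5) ℂ →+* M := Θ.comp (E : MvPolynomial (Fin 5) ℂ →+* _)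
  have hker' : RingHom.ker Θ' = Ideal.span {dehomP5 p} := by
    ext g
    have h1 : g ∈ RingHom.ker Θ' ↔ E g ∈ RingHom.ker Θ := Iff.rfl
    rw [h1, hker, ← finSuccEquiv_dehomP5, Ideal.mem_span_singleton, Ideal.mem_span_singleton,
      map_dvd_iff]
  let Φ : hyperP5ChartRing p →+* M :=
    Ideal.Quotient.lift (Ideal.span {dehomP5 p}) Θ' fun a ha => by
      rwa [← hker', RingHom.mem_ker] at ha
  have hΦ : Function.Injective Φ := RingHom.lift_injective_of_ker_le_ideal _ _ hker'.le
  have hΦmk (g) : IsFractionRing.lift (K := FractionRing (hyperP5ChartRing p)) hΦ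
      (algebraMap (hyperP5ChartRing p) _ (Ideal.Quotient.mk _ g)) = Θ (E g) :=
    IsFractionRing.lift_algebraMap hΦ _
  refine ⟨IsFractionRing.lift hΦ, fun c => (hΦmk _).trans ?_, fun i => (hΦmk _).trans ?_⟩
  · simp [Θ, E, MvPolynomial.finSuccEquiv_apply]
  · simp [Θ, E, MvPolynomial.finSuccEquiv_X_succ]

lemma eval₂_chartCoordinates_eq_zero (p : MvPolynomial (Fin 6) ℂ) :
    p.eval₂ (hyperP5FFMap p) (Fin.cons 1 fun i => algebraMap (hyperP5ChartRing p)
      (FractionRing (hyperP5ChartRing p)) (Ideal.Quotient.mk _ (.X i)) : Fin 6 → _) = 0 := by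
  let f : MvPolynomial (Fin 5) ℂ →+* FractionRing (hyperP5ChartRing p) :=
    (algebraMap (hyperP5ChartRing p) _).comp (Ideal.Quotient.mk (Ideal.span {dehomP5 p}))
  have h : f.comp dehomP5 = MvPolynomial.eval₂Hom (hyperP5FFMap p)
      (Fin.cons 1 fun i => f (.X i) : Fin 6 → _) := by
    apply MvPolynomial.ringHom_ext
    · intro c
      have : dehomP5 (MvPolynomial.C c) = MvPolynomial.C c := by simp [dehomP5]
      rw [RingHom.comp_apply, this, MvPolynomial.eval₂Hom_C]
      rfl
    · intro i
      fin_cases i <;> simp [dehomP5] <;> rfl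
  refine (congrArg (· p) h).symm.trans ?_
  have : Ideal.Quotient.mk (Ideal.span {dehomP5 p}) (dehomP5 p) = 0 :=
    Ideal.Quotient.eq_zero_iff_mem.2 (Ideal.mem_span_singleton_self _)
  change algebraMap (hyperP5ChartRing p) _ (Ideal.Quotient.mk (Ideal.span {dehomP5 p}) _) = 0
  rw [this]
  exact map_zero _

end NonStablyRational

end

section

open Polynomial

section Specialization

theorem not_isStablyRational_of_specialization {e : ℕ} {p : MvPolynomial (Fin 6) ℂ}
    (hhom : p.IsHomogeneous (e + 2 + 2)) (hsupp : ∀ m ∈ p.support, e + 2 ≤ m 3 + m 4 + m 5)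
    {O : ValuationSubring ℂ} (hO : ∀ q : ℚ, (q : ℂ) ∈ O)
    (hp : ∀ m, O.valuation (p.coeff m - (specialForm ℂ e).coeff m) < 1) :
    ¬ IsStablyRationalFunctionField (hyperP5FFMap p) := by
  intro hstab
  have : IsDomain (hyperP5ChartRing p) := isDomain_of_isStablyRational hstab
  let κ := IsLocalRing.ResidueField O
  let ρ : O →+* κ := IsLocalRing.residue O
  have : CharZero κ := charZero_residueField hO
  obtain ⟨q, hqp, hq⟩ := exists_lift_of_valuation_sub_lt_one (O := O) (p := p)
    (q := specialForm O e) (by rwa [map_specialForm])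
  rw [map_specialForm] at hq
  have hqsupp : ∀ m ∈ q.support, e + 2 ≤ m 3 + m 4 + m 5 := fun m hm => hsupp m (by
    rw [← hqp, MvPolynomial.support_map_of_injective _ Subtype.val_injective]
    exact hm)
  have hqhom : q.IsHomogeneous (e + 2 + 2) :=
    MvPolynomial.IsHomogeneous.of_map (f := O.subtype) Subtype.val_injective (by rwa [hqp])
  obtain ⟨Λ, _, φ, τ, hind, hτ, hnot⟩ := exists_field_not_isotropicTernary κ e
  have hred : (affineChart O q).map (MvPolynomial.map ρ) = _ :=
    ((map_affineChart ρ q).trans (congrArg _ hq)).trans (affineChart_specialForm e)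
  have hgen : (affineChart O q).map (MvPolynomial.map O.subtype) = affineChart ℂ p := by
    rw [map_affineChart, hqp]
  have hcoeff (i : ℕ) : (affineChart ℂ p).coeff i =
      MvPolynomial.map O.subtype ((affineChart O q).coeff i) := by
    rw [← hgen, coeff_map]
  let g (i : ℕ) := (affineChart O q).coeff i
  have hg (i : ℕ) := (coeff_map (MvPolynomial.map ρ) (p := affineChart O q) i).symm.trans
    (congrArg (coeff · i) hred)
  have hg2 := hg 2
  have hg1 := hg 1
  have hg0 := hg 0
  simp only [coeff_add, coeff_C_mul_X_pow, coeff_C, if_true, if_false, OfNat.ofNat_ne_zero,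
    OfNat.zero_ne_ofNat, OfNat.one_ne_ofNat, one_ne_zero, add_zero, zero_add] at hg2 hg1 hg0
  obtain ⟨M, _, j, ω, hω, hind', W, r, φS, hφS, hrφS, hr, hv⟩ :=
    exists_quadratic_gauss_extension ρ (g 1 ^ 2 - 4 * g 2 * g 0) φ τ (by
      rw [hτ]
      simp only [map_sub, map_mul, map_pow, map_ofNat, g, hg2, hg1, hg0]
      simp [map_ofNat]) hind
  obtain ⟨Ψ, hΨC, hΨX⟩ := exists_functionField_embedding (p := p)
    (natDegree_affineChart_le hhom hsupp) (by
      rw [hcoeff]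
      intro h0
      rw [map_eq_zero_iff _ (MvPolynomial.map_injective _ Subtype.val_injective)] at h0
      rw [h0, map_zero] at hg2
      exact mul_ne_zero (MvPolynomial.X_ne_zero _) (pow_ne_zero _ (MvPolynomial.X_ne_zero _))
        hg2.symm) (j := j) (ω := ω) (by
      rw [hω, hcoeff, hcoeff, hcoeff]
      simp [g, map_ofNat]) hind'
  have hinf : Infinite (FractionRing (hyperP5ChartRing p)) :=
    Infinite.of_injective _ (hyperP5FFMap p).injective
  obtain ⟨n, P, Q, ζ, hQ0, hQP, hrel⟩ := exists_retract_of_isStablyRational hstab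
    fun i => algebraMap (hyperP5ChartRing p) _ (Ideal.Quotient.mk _ (.X i))
  have hP := hrel _ p hhom (eval₂_chartCoordinates_eq_zero p)
  let ι : ℂ →+* M := j.comp MvPolynomial.C
  have hΨ (F : MvPolynomial (Fin n) ℂ) :
      Ψ (F.eval₂ (hyperP5FFMap p) ζ) = F.eval₂ ι (fun i => Ψ (ζ i)) := by
    rw [MvPolynomial.hom_eval₂]
    congr 1
    ext c
    exact hΨC c
  have hcoord (i : Fin 4) : (P i.succ).eval₂ ι (fun i => Ψ (ζ i)) =
      Ψ (Q.eval₂ (hyperP5FFMap p) ζ) * (φS (.X i) : M) := by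
    rw [← hΨ, ← hQP, map_mul, hΨX, hφS, MvPolynomial.map_X]
  have hΛ : (r.comp (φS.comp MvPolynomial.C)) = (φ.comp MvPolynomial.C).comp ρ := by
    ext c
    simp [hrφS]
  have : CharZero Λ := charZero_of_injective_ringHom (φ.comp MvPolynomial.C).injective
  have hI : Complex.I ∈ O := by
    rcases O.mem_or_inv_mem Complex.I with h | h
    · exact h
    · rw [Complex.inv_I] at h
      simpa using O.neg_mem _ h
  have hsq : IsSquare (-1 : Λ) := by
    refine ⟨φ (MvPolynomial.C (ρ ⟨_, hI⟩)), ?_⟩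
    rw [← map_mul, ← map_mul, ← map_mul,
      show (⟨_, hI⟩ * ⟨_, hI⟩ : O) = -1 from Subtype.ext Complex.I_mul_I]
    simp
  have key := isotropicTernary_of_parametrization (ι := ι) (W := W) (r := r) hv hr hsq hqsupp hqhom
    (φS.comp MvPolynomial.C)
    (by rw [hΛ, ← MvPolynomial.map_map, hq, map_specialForm]) (ψ := O.subtype)
    (by ext c; simp [hφS, ι])
    (P := Fin.cons Q P) (by rwa [← MvPolynomial.eval₂_map, hqp]) (fun i => Ψ (ζ i))
    ((map_ne_zero Ψ).2 hQ0) (hcoord 1) (hcoord 2) (hcoord 3)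
  rw [hrφS, hrφS, hrφS, MvPolynomial.map_X, MvPolynomial.map_X, MvPolynomial.map_X] at key
  exact hnot key

end Specialization

end

theorem very_general_hypersurface_multiplicity_along_plane_not_stably_rational
    (d : ℕ) (hd : 2 ≤ d) :
    VeryGeneral
      (P := (MvPolynomial.homogeneousSubmodule (Fin 6) ℂ (d + 2) ⊓
        Submodule.restrictScalars ℂ
          ((Ideal.span {MvPolynomial.X 3, MvPolynomial.X 4, MvPolynomial.X 5} :
            Ideal (MvPolynomial (Fin 6) ℂ)) ^ d) :
        Submodule ℂ (MvPolynomial (Fin 6) ℂ)))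
      (fun F => ¬ IsStablyRationalFunctionField
        (hyperP5FFMap (F : MvPolynomial (Fin 6) ℂ))) := by
  obtain ⟨e, rfl⟩ := Nat.exists_eq_add_of_le' hd
  refine veryGeneral_of_forall_valuationSubring (F₀ := specialForm ℂ e)
    (Submodule.mem_inf.2 ⟨isHomogeneous_specialForm e, specialForm_mem_pow e⟩)
    (Finset.univ.finsuppAntidiag (e + 2 + 2)) (fun p hp => ?_) fun p O hO hval => ?_
  · exact MvPolynomial.IsHomogeneous.support_subset_finsuppAntidiag (Submodule.mem_inf.1 hp).1
  · have hp := Submodule.mem_inf.1 p.2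
    exact not_isStablyRational_of_specialization hp.1 (le_normalDegree_of_mem_pow hp.2) hO hval

end
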